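/- arXiv:2005.00099 — 3 statements merged into one kernel-verified Lean document; each statement's English description precedes it below -/
import Mathlib

section
/- There is a constant C > 0 such that for all n ≥ 5 and every subset A of the alternating group A_n, | #{(σ,τ) ∈ S_n × S_n : [σ,τ] ∈ A}/(n!)² − #A/#A_n | ≤ C/n. That is, the total variation distance between P_{w_c,n} and the uniform measure on A_n is O(1/n). -/
open Finset

namespace TVC

set_option linter.unusedSectionVars false

noncomputable section

section General

variable (G : Type) [Group G] [Fintype G]

abbrev A := MonoidAlgebra ℂ G

theorem wed : ∃ (m : ℕ) (d : Fin m → ℕ), (∀ i, NeZero (d i)) ∧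
    Nonempty (A G ≃ₐ[ℂ] Π i, Matrix (Fin (d i)) (Fin (d i)) ℂ) := by
  have : NeZero (Nat.card G : ℂ) := ⟨by simp [Nat.card_eq_fintype_card]⟩
  have : FiniteDimensional ℂ (A G) :=
    Module.Finite.equiv (MonoidAlgebra.coeffLinearEquiv ℂ : A G ≃ₗ[ℂ] (G →₀ ℂ)).symm
  exact IsSemisimpleRing.exists_algEquiv_pi_matrix_of_isAlgClosed ℂ (A G)

abbrev Ir := Fin (wed G).choose

variable {G}

def dm (i : Ir G) : ℕ := (wed G).choose_spec.choose i

instance (i : Ir G) : NeZero (dm i) := (wed G).choose_spec.choose_spec.1 i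

abbrev Mt (i : Ir G) := Matrix (Fin (dm i)) (Fin (dm i)) ℂ

def Phi : A G ≃ₐ[ℂ] Π i : Ir G, Mt i := (wed G).choose_spec.choose_spec.2.some

def R (i : Ir G) : A G →ₐ[ℂ] Mt i := (Pi.evalAlgHom ℂ _ i).comp (Phi (G := G)).toAlgHom

def e (i : Ir G) : A G := Phi.symm (Pi.single i 1)

abbrev sg (g : G) : A G := MonoidAlgebra.single g 1

theorem sg_mul (g h : G) : sg g * sg h = sg (g * h) := by
  simp [sg, MonoidAlgebra.single_mul_single]

theorem sg_one : sg (1 : G) = 1 := rfl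

theorem R_apply (i : Ir G) (x : A G) : R i x = Phi x i := rfl

theorem R_ext {x y : A G} (h : ∀ i, R i x = R i y) : x = y :=
  Phi.injective (funext h)

theorem R_e_self (i : Ir G) : R i (e i) = 1 := by simp [R_apply, e]

theorem R_e_ne {i j : Ir G} (h : i ≠ j) : R i (e j) = 0 := by simp [R_apply, e, h]

theorem R_surj (i : Ir G) (M : Mt i) : ∃ x, R i x = M :=
  ⟨Phi.symm (Pi.single i M), by simp [R_apply]⟩

theorem e_comm (i : Ir G) (x : A G) : e i * x = x * e i := by
  apply R_ext
  intro j
  by_cases h : j = i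
  · subst h; simp [R_e_self]
  · simp [R_e_ne h]

theorem e_mul_self (i : Ir G) : e i * e i = e i := by
  apply R_ext
  intro j
  by_cases h : j = i
  · subst h; simp [R_e_self]
  · simp [R_e_ne h]

theorem e_mul_ne {i k : Ir G} (hik : i ≠ k) : e i * e k = 0 := by
  apply R_ext
  intro j
  by_cases h : j = i
  · subst h; simp [R_e_ne hik]
  · simp [R_e_ne h]

theorem sum_e : ∑ i : Ir G, e i = 1 := by
  apply R_ext
  intro j
  rw [map_sum, Finset.sum_eq_single j]
  · simp [R_e_self]
  · intro b _ hb; exact R_e_ne hb.symm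
  · simp

theorem e_ne_zero (i : Ir G) : e i ≠ 0 := by
  intro h
  have := R_e_self i
  rw [h, map_zero] at this
  exact zero_ne_one this

theorem mul_e_eq_zero {i : Ir G} {x : A G} : x * e i = 0 ↔ R i x = 0 := by
  constructor
  · intro h
    have := congrArg (R i) h
    simpa [R_e_self] using this
  · intro h
    apply R_ext
    intro j
    by_cases hj : j = i
    · subst hj; simp [h]
    · simp [R_e_ne hj]

theorem scalar_of_commute {d : ℕ} {M : Matrix (Fin d) (Fin d) ℂ}
    (h : ∀ N : Matrix (Fin d) (Fin d) ℂ, N * M = M * N) : ∃ c : ℂ, M = c • 1 := by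
  have : M ∈ Set.range (Matrix.scalar (Fin d)) :=
    Matrix.mem_range_scalar_of_commute_single (fun i j _ => h _)
  obtain ⟨c, hc⟩ := this
  refine ⟨c, ?_⟩
  rw [← hc]
  ext a b
  simp [Matrix.diagonal_apply, Matrix.one_apply]

theorem lin_ext {V : Type*} [AddCommMonoid V] [Module ℂ V] {f g : A G →ₗ[ℂ] V}
    (h : ∀ x : G, f (sg x) = g (sg x)) : f = g := by
  apply LinearMap.ext
  intro x
  induction x using MonoidAlgebra.induction_linear with
  | zero => simp
  | add x y hx hy => simp [hx, hy]
  | single m r =>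
    have : (MonoidAlgebra.single m r : A G) = r • sg m := by simp [sg]
    rw [this, map_smul, map_smul, h]

theorem commute_of_sg {B : Type*} [Ring B] [Algebra ℂ B] (f : A G →ₐ[ℂ] B) {z : B}
    (h : ∀ g : G, f (sg g) * z = z * f (sg g))
    (x : A G) : f x * z = z * f x := by
  have : (LinearMap.mulRight ℂ z) ∘ₗ f.toLinearMap = (LinearMap.mulLeft ℂ z) ∘ₗ f.toLinearMap := by
    apply lin_ext
    intro g
    simpa using h g
  simpa using LinearMap.congr_fun this x

theorem R_scalar (i : Ir G) {M : Mt i} (h : ∀ g : G, R i (sg g) * M = M * R i (sg g)) :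
    ∃ c : ℂ, M = c • 1 := by
  apply scalar_of_commute
  intro N
  obtain ⟨x, rfl⟩ := R_surj i N
  exact commute_of_sg _ h x

theorem mul_e_of_R {i : Ir G} {z : A G} {c : ℂ} (h : R i z = c • 1) : z * e i = c • e i := by
  have : (z - c • 1) * e i = 0 := by
    rw [mul_e_eq_zero]; simp [h]
  rw [sub_mul, sub_eq_zero] at this
  simpa using this

theorem central_scalar (i : Ir G) {z : A G} (h : ∀ g : G, sg g * z = z * sg g) :
    ∃ c : ℂ, z * e i = c • e i := by
  obtain ⟨c, hc⟩ := R_scalar i (M := R i z) (fun g => by rw [← map_mul, h, map_mul])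
  exact ⟨c, mul_e_of_R hc⟩

theorem sum_delta {d : ℕ} (x y : Fin d) :
    ∑ r : Fin d, (if r = x ∧ r = y then (1 : ℂ) else 0) = if x = y then 1 else 0 := by
  rw [Finset.sum_eq_single x]
  · simp
  · intro b _ hb; simp [hb]
  · simp

theorem exists_sum_eq_one {d : ℕ} {M : Matrix (Fin d) (Fin d) ℂ} (hM : M ≠ 0) :
    ∃ (a b : Fin d → Matrix (Fin d) (Fin d) ℂ), ∑ r, a r * M * b r = 1 := by
  obtain ⟨p, q, hpq⟩ : ∃ p q, M p q ≠ 0 := by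
    by_contra! h
    exact hM (by ext p q; simp [h])
  refine ⟨fun r => Matrix.single r p (M p q)⁻¹, fun r => Matrix.single q r 1, ?_⟩
  ext x y
  simp only [Matrix.single_mul_mul_single, Matrix.sum_apply, Matrix.single_apply, Matrix.one_apply]
  simp only [mul_one, inv_mul_cancel₀ hpq]
  exact sum_delta x y

theorem exists_sum_eq_e {i : Ir G} {x : A G} (hx : x * e i ≠ 0) :
    ∃ (a b : Fin (dm i) → A G), ∑ r, a r * (x * e i) * b r = e i := by
  have h : R i x ≠ 0 := fun h => hx (mul_e_eq_zero.2 h)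
  obtain ⟨a, b, hab⟩ := exists_sum_eq_one h
  choose a' ha using fun r => R_surj i (a r)
  choose b' hb using fun r => R_surj i (b r)
  refine ⟨a', b', ?_⟩
  apply R_ext
  intro j
  by_cases hj : j = i
  · subst hj; simp [ha, hb, R_e_self, hab]
  · simp [R_e_ne hj]

theorem simple {B : Type*} [Ring B] [Algebra ℂ B] (f : A G →ₐ[ℂ] B) {i : Ir G} {x : A G}
    (h : f (x * e i) = 0) (hf : f (e i) ≠ 0) : x * e i = 0 := by
  by_contra hx
  obtain ⟨a, b, hab⟩ := exists_sum_eq_e hx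
  apply hf
  rw [← hab, map_sum]
  apply Finset.sum_eq_zero
  intro r _
  rw [map_mul, map_mul, h]; simp

theorem prime {i : Ir G} {x y : A G} (hx : x * e i ≠ 0) (hy : y * e i ≠ 0) :
    ∃ g : G, x * sg g * y * e i ≠ 0 := by
  by_contra! h
  have h2 : ∀ z : A G, x * z * y * e i = 0 := by
    have : (LinearMap.mulRight ℂ (y * e i)) ∘ₗ (LinearMap.mulLeft ℂ x) = 0 := by
      apply lin_ext
      intro g
      simpa [mul_assoc] using h g
    intro z
    simpa [mul_assoc] using LinearMap.congr_fun this z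
  obtain ⟨a, b, hab⟩ := exists_sum_eq_e hy
  apply hx
  rw [← hab, Finset.mul_sum]
  apply Finset.sum_eq_zero
  intro r _
  have := h2 (a r)
  calc x * (a r * (y * e i) * b r) = (x * a r * y * e i) * b r := by noncomm_ring
    _ = 0 := by rw [this, zero_mul]

def piBasis : Module.Basis (Σ i : Ir G, Fin (dm i) × Fin (dm i)) ℂ (Π i : Ir G, Mt i) :=
  Pi.basis (fun i => Matrix.stdBasis ℂ (Fin (dm i)) (Fin (dm i)))

def grpBasis : Module.Basis G ℂ (A G) := ⟨MonoidAlgebra.coeffLinearEquiv ℂ⟩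

theorem trace_formula (x : A G) :
    ∑ i : Ir G, (dm i : ℂ) * (R i x).trace = Fintype.card G * x.coeff 1 := by
  classical
  have h1 : LinearMap.trace ℂ _ (LinearMap.mulLeft ℂ x) = Fintype.card G * x.coeff 1 := by
    rw [LinearMap.trace_eq_matrix_trace ℂ grpBasis]
    have : ∀ g : G, (LinearMap.toMatrix grpBasis grpBasis (LinearMap.mulLeft ℂ x)) g g
        = x.coeff 1 := by
      intro g
      have hb : (grpBasis g : A G) = sg g := by
        apply (grpBasis (G := G)).repr.injective
        rw [Module.Basis.repr_self]
        rfl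
      rw [LinearMap.toMatrix_apply, hb]
      change (x * sg g).coeff g = _
      simp [sg]
    simp only [Matrix.trace, Matrix.diag_apply, this]
    simp
  have h2 : LinearMap.trace ℂ _ (LinearMap.mulLeft ℂ x)
      = LinearMap.trace ℂ _ (LinearMap.mulLeft ℂ (Phi x)) := by
    rw [← LinearMap.trace_conj' _ (Phi (G := G)).toLinearEquiv]
    congr 1
    apply LinearMap.ext
    intro y
    simp [LinearEquiv.conj_apply]
  rw [← h1, h2, LinearMap.trace_eq_matrix_trace ℂ piBasis, Matrix.trace, Fintype.sum_sigma]
  apply Finset.sum_congr rfl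
  intro i _
  have : ∀ p : Fin (dm i) × Fin (dm i),
      (LinearMap.toMatrix piBasis piBasis (LinearMap.mulLeft ℂ (Phi x))).diag ⟨i, p⟩
        = (R i x) p.1 p.1 := by
    rintro ⟨p, q⟩
    rw [Matrix.diag_apply, LinearMap.toMatrix_apply]
    simp [piBasis, Pi.basis_apply, Matrix.stdBasis_eq_single, R_apply]
    have hr : ∀ M : Mt i, (Matrix.stdBasis ℂ (Fin (dm i)) (Fin (dm i))).repr M (p, q) = M p q := by
      intro M
      simp [Matrix.stdBasis]
    rw [hr]
    simp [Matrix.mul_apply, Matrix.single_apply]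
  simp_rw [this, Fintype.sum_prod_type]
  simp [Matrix.trace, Finset.mul_sum]

theorem idem_trace {d : ℕ} {M : Matrix (Fin d) (Fin d) ℂ} (h : M * M = M) :
    ∃ m : ℕ, M.trace = m ∧ (M ≠ 0 → 1 ≤ m) := by
  have hi : IsIdempotentElem (Matrix.toLin' M) := by
    change _ * _ = _
    rw [Module.End.mul_eq_comp, ← Matrix.toLin'_mul, h]
  refine ⟨Module.finrank ℂ (LinearMap.range (Matrix.toLin' M)), ?_, ?_⟩
  · rw [← Matrix.trace_toLin'_eq, (LinearMap.IsIdempotentElem.isProj_range _ hi).trace]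
  · intro hM
    rw [Nat.one_le_iff_ne_zero]
    intro h0
    have h2 := (LinearMap.IsIdempotentElem.isProj_range _ hi).trace
    rw [h0, Nat.cast_zero, LinearMap.IsIdempotentElem.trace_eq_zero_iff hi] at h2
    exact hM (by simpa using h2)

theorem mult {d : ℕ} (f : A G →ₐ[ℂ] Matrix (Fin d) (Fin d) ℂ) (i : Ir G) :
    ∃ m : ℕ, (f (e i)).trace = m * dm i ∧ (f (e i) ≠ 0 → 1 ≤ m) := by
  let u (p q : Fin (dm i)) : A G := Phi.symm (Pi.single i (Matrix.single p q 1))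
  have hu : ∀ p q r, u p q * u q r = u p r := by
    intro p q r
    simp only [u]
    rw [← map_mul, ← Pi.single_mul]
    simp
  have hsum : e i = ∑ p, u p p := by
    simp only [u, e]
    rw [← map_sum]
    congr 1
    funext j
    by_cases hj : j = i
    · subst hj
      rw [Finset.sum_apply]
      simp only [Pi.single_eq_same]
      ext a b
      simp only [Matrix.sum_apply, Matrix.single_apply, Matrix.one_apply]
      exact (sum_delta a b).symm
    · simp [hj]
  obtain ⟨m, hm, hm1⟩ := idem_trace (M := f (u 0 0)) (by rw [← map_mul, hu])
  have ht : ∀ p, (f (u p p)).trace = m := by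
    intro p
    rw [← hm, ← hu p 0 p, map_mul, Matrix.trace_mul_comm, ← map_mul, hu]
  refine ⟨m, ?_, ?_⟩
  · rw [hsum, map_sum, Matrix.trace_sum]
    simp [ht, mul_comm]
  · intro h
    apply hm1
    intro h0
    apply h
    rw [hsum, map_sum]
    apply Finset.sum_eq_zero
    intro p _
    rw [← hu p 0 p, ← hu p 0 0, map_mul, map_mul, h0]
    simp

end General

section Comm

variable {G : Type} [Group G] [Fintype G]

theorem dm_ne (i : Ir G) : (dm i : ℂ) ≠ 0 := by
  exact_mod_cast NeZero.ne (dm i)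

theorem avg (i : Ir G) (M : Mt i) :
    ∑ g : G, R i (sg g) * M * R i (sg g⁻¹) = (Fintype.card G * M.trace / dm i : ℂ) • 1 := by
  obtain ⟨c, hc⟩ := R_scalar i (M := ∑ g : G, R i (sg g) * M * R i (sg g⁻¹)) (by
    intro h
    rw [Finset.mul_sum, Finset.sum_mul]
    apply Fintype.sum_equiv (Equiv.mulLeft h)
    intro g
    simp only [Equiv.coe_mulLeft, mul_inv_rev, ← sg_mul, map_mul]
    have : R i (sg h⁻¹) * R i (sg h) = 1 := by
      rw [← map_mul, sg_mul]; simp [sg_one]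
    simp only [mul_assoc, this, mul_one])
  have ht : (∑ g : G, R i (sg g) * M * R i (sg g⁻¹)).trace = Fintype.card G * M.trace := by
    rw [Matrix.trace_sum]
    have : ∀ g : G, (R i (sg g) * M * R i (sg g⁻¹)).trace = M.trace := by
      intro g
      rw [Matrix.trace_mul_comm, ← mul_assoc, ← map_mul, sg_mul]
      simp [sg_one]
    simp [this]
  rw [hc] at ht ⊢
  congr 1
  rw [← ht]
  field_simp [dm_ne i]
  simp

theorem avg2 (i : Ir G) :
    ∑ g : G, (R i (sg g)).trace • R i (sg g⁻¹) = (Fintype.card G / dm i : ℂ) • 1 := by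
  refine Matrix.ext fun c d => ?_
  have h : ∀ a, (∑ g : G, R i (sg g) * Matrix.single a c 1 * R i (sg g⁻¹) : Mt i) a d
      = ((Fintype.card G * (Matrix.single a c (1 : ℂ)).trace / dm i : ℂ) • (1 : Mt i)) a d := by
    intro a; rw [avg]
  have h2 : ∀ a (g : G), (R i (sg g) * Matrix.single a c 1 * R i (sg g⁻¹) : Mt i) a d
      = (R i (sg g)) a a * R i (sg g⁻¹) c d := by
    intro a g
    simp [Matrix.mul_apply, Matrix.single_apply, Finset.sum_ite_eq, ite_and]
  simp only [Matrix.sum_apply, h2] at h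
  have h3 := Finset.sum_congr rfl (fun a (_ : a ∈ Finset.univ) => h a)
  rw [Finset.sum_comm] at h3
  simp only [Matrix.sum_apply, Matrix.smul_apply, smul_eq_mul, Matrix.trace, Matrix.diag_apply,
    Finset.sum_mul] at h3 ⊢
  rw [h3]
  have h5 : ∀ b : Fin (dm i), ∑ j, (Matrix.single b c (1 : ℂ)) j j = if b = c then 1 else 0 := by
    intro b
    by_cases hb : b = c
    · subst hb
      rw [if_pos rfl]; exact Matrix.trace_single_eq_same b (1 : ℂ)
    · rw [if_neg hb]; exact Matrix.trace_single_eq_of_ne b c (1 : ℂ) hb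
  simp only [h5]
  rw [Finset.sum_eq_single c]
  · simp
  · intro b _ hb
    simp [hb, Matrix.one_apply]
  · simp

def commEl (G : Type) [Group G] [Fintype G] : A G :=
  ∑ τ : G, ∑ σ : G, sg (σ * τ * σ⁻¹ * τ⁻¹)

theorem R_commEl (i : Ir G) : R i (commEl G) = ((Fintype.card G : ℂ) ^ 2 / (dm i : ℂ) ^ 2) • 1 := by
  simp only [commEl, map_sum, ← sg_mul, map_mul]
  simp only [← Finset.sum_mul, avg]
  have : ∀ τ : G, (Fintype.card G * (R i (sg τ)).trace / dm i : ℂ) • (1 : Mt i) * R i (sg τ⁻¹)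
      = (Fintype.card G / dm i : ℂ) • ((R i (sg τ)).trace • R i (sg τ⁻¹)) := by
    intro τ
    rw [smul_mul_assoc, one_mul, smul_smul]
    congr 1; ring
  simp only [this]
  rw [← Finset.smul_sum, avg2, smul_smul]
  congr 1
  ring

def Nc [DecidableEq G] (π : G) : ℕ :=
  (univ.filter (fun p : G × G => p.1 * p.2 * p.1⁻¹ * p.2⁻¹ = π)).card

theorem coeff_commEl [DecidableEq G] (π : G) : (commEl G).coeff π = Nc π := by
  simp only [commEl, MonoidAlgebra.coeff_sum, Finsupp.finsetSum_apply, Nc, sg,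
    MonoidAlgebra.coeff_single]
  rw [Finset.sum_comm, ← Fintype.sum_prod_type' (f := fun σ τ : G =>
    (Finsupp.single (σ * τ * σ⁻¹ * τ⁻¹) (1:ℂ)) π)]
  simp [Finsupp.single_apply]

theorem Nc_inv [DecidableEq G] (π : G) : Nc π⁻¹ = Nc π := by
  unfold Nc
  apply Finset.card_equiv (Equiv.prodComm G G)
  rintro ⟨a, b⟩
  simp only [mem_filter, mem_univ, true_and, Equiv.prodComm_apply, Prod.fst_swap, Prod.snd_swap]
  rw [← inv_inj]
  simp [mul_assoc]

def Zt (G : Type) [Group G] [Fintype G] : ℝ := ∑ i : Ir G, ((dm i : ℝ) ^ 2)⁻¹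

theorem sum_Nc_sq [DecidableEq G] :
    ∑ π : G, (Nc π : ℝ) ^ 2 = (Fintype.card G : ℝ) ^ 3 * Zt G := by
  have h := trace_formula (commEl G * commEl G)
  have hG : (Fintype.card G : ℂ) ≠ 0 := by simp
  have h1 : (commEl G * commEl G).coeff 1 = ∑ π : G, (Nc π : ℂ) ^ 2 := by
    rw [MonoidAlgebra.coeff_mul_apply_left, Finsupp.sum_fintype _ _ (by simp)]
    apply Finset.sum_congr rfl
    intro g _
    rw [mul_one, coeff_commEl, coeff_commEl, Nc_inv]; ring
  have h2 : ∀ i : Ir G, (dm i : ℂ) * (R i (commEl G * commEl G)).trace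
      = (Fintype.card G : ℂ) ^ 4 * ((dm i : ℂ) ^ 2)⁻¹ := by
    intro i
    have := dm_ne i
    rw [map_mul, R_commEl]
    simp
    field_simp
  rw [h1] at h
  simp only [h2, ← Finset.mul_sum] at h
  have h3 : (Fintype.card G : ℂ) * ∑ π : G, (Nc π : ℂ) ^ 2
      = (Fintype.card G : ℂ) * ((Fintype.card G : ℂ) ^ 3 * ∑ i : Ir G, ((dm i : ℂ) ^ 2)⁻¹) := by
    rw [← h]; ring
  have h4 := mul_left_cancel₀ hG h3
  unfold Zt
  apply Complex.ofReal_injective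
  push_cast
  exact h4

theorem sum_Nc [DecidableEq G] : ∑ π : G, (Nc π : ℝ) = (Fintype.card G : ℝ) ^ 2 := by
  have : ∑ π : G, Nc π = (univ : Finset (G × G)).card := by
    unfold Nc
    exact (Finset.card_eq_sum_card_fiberwise (fun _ _ => Finset.mem_coe.2 (mem_univ _))).symm
  rw [← Nat.cast_sum, this]
  simp [sq]

end Comm

abbrev SS (n : ℕ) := Equiv.Perm (Fin n)

theorem tv_bound (n : ℕ) (hn : 2 ≤ n) (S : Set (Equiv.Perm (Fin n)))
    (hS : S ⊆ (alternatingGroup (Fin n) : Set (Equiv.Perm (Fin n)))) :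
    |(Nat.card {p : Equiv.Perm (Fin n) × Equiv.Perm (Fin n) //
            p.1 * p.2 * p.1⁻¹ * p.2⁻¹ ∈ S} : ℝ) / (n.factorial : ℝ) ^ 2
          - (Nat.card S : ℝ) / (Nat.card (alternatingGroup (Fin n)) : ℝ)|
      ≤ √(Zt (Equiv.Perm (Fin n)) - 2) := by
  classical
  have : Nontrivial (Fin n) := Fin.nontrivial_iff_two_le.2 hn
  have hcard : Fintype.card (SS n) = n.factorial := by rw [Fintype.card_perm, Fintype.card_fin]
  set N : ℝ := (n.factorial : ℝ) with hN
  have hNpos : 0 < N := by positivity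
  have halt : (Nat.card (alternatingGroup (Fin n)) : ℝ) = N / 2 := by
    have := two_mul_nat_card_alternatingGroup (α := Fin n)
    rw [Nat.card_eq_fintype_card (α := SS n), hcard] at this
    have h2 : (2 : ℝ) * (Nat.card (alternatingGroup (Fin n)) : ℝ) = N := by
      rw [hN, ← this]; push_cast; ring
    linarith
  let Af : Finset (SS n) := univ.filter (fun π => π ∈ alternatingGroup (Fin n))
  let Sf : Finset (SS n) := univ.filter (fun π => π ∈ S)
  have hsub : Sf ⊆ Af := by
    intro x hx
    simp only [Sf, Af, mem_filter, mem_univ, true_and] at hx ⊢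
    exact hS hx
  have hAf : (Af.card : ℝ) = N / 2 := by
    rw [← halt, Nat.card_eq_fintype_card, Fintype.card_subtype]
  have hSf : (Nat.card S : ℝ) = Sf.card := by
    rw [Nat.card_eq_fintype_card, ← Set.toFinset_card]
    congr 2
    ext; simp [Sf]
  have hcomm : (Nat.card {p : (SS n) × (SS n) // p.1 * p.2 * p.1⁻¹ * p.2⁻¹ ∈ S} : ℝ)
      = ∑ π ∈ Sf, (Nc π : ℝ) := by
    rw [Nat.card_eq_fintype_card, Fintype.card_subtype, ← Nat.cast_sum]
    congr 1
    rw [Finset.card_eq_sum_card_fiberwise (f := fun p : (SS n) × (SS n) => p.1 * p.2 * p.1⁻¹ * p.2⁻¹) (t := Sf)]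
    · apply Finset.sum_congr rfl
      intro π hπ
      unfold Nc
      congr 1
      ext p
      simp only [mem_filter, mem_univ, true_and]
      constructor
      · exact fun h => h.2
      · intro h
        refine ⟨?_, h⟩
        rw [h]; simpa [Sf] using hπ
    · intro p hp
      simpa [Sf] using hp
  have hz : ∀ π : (SS n), π ∉ Af → Nc π = 0 := by
    intro π hπ
    unfold Nc
    rw [Finset.card_eq_zero, Finset.filter_eq_empty_iff]
    rintro ⟨a, b⟩ _ h
    apply hπ
    simp only [Af, mem_filter, mem_univ, true_and, Equiv.Perm.mem_alternatingGroup]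
    rw [← h]
    simp only [map_mul, Equiv.Perm.sign_inv]
    rcases Int.units_eq_one_or (Equiv.Perm.sign a) with h1 | h1 <;>
    rcases Int.units_eq_one_or (Equiv.Perm.sign b) with h2 | h2 <;> simp [h1, h2]
  let q : (SS n) → ℝ := fun π => Nc π / N ^ 2 - 2 / N
  have hsum1 : ∑ π ∈ Af, (Nc π : ℝ) = N ^ 2 := by
    rw [Finset.sum_subset (Finset.subset_univ Af) (fun x _ hx => by simp [hz x hx]), sum_Nc, hcard]
  have hsum2 : ∑ π ∈ Af, (Nc π : ℝ) ^ 2 = N ^ 3 * Zt (SS n) := by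
    rw [Finset.sum_subset (Finset.subset_univ Af) (fun x _ hx => by simp [hz x hx]), sum_Nc_sq, hcard]
  have hq : ∑ π ∈ Af, q π ^ 2 = (Zt (SS n) - 2) / N := by
    have : ∀ π, q π ^ 2 = (Nc π : ℝ) ^ 2 / N ^ 4 - (Nc π : ℝ) * (4 / N ^ 3) + 4 / N ^ 2 := by
      intro π
      simp only [q]
      field_simp
      ring
    simp only [this, Finset.sum_add_distrib, Finset.sum_sub_distrib, ← Finset.sum_div,
      ← Finset.sum_mul, hsum1, hsum2, Finset.sum_const, nsmul_eq_mul, hAf]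
    field_simp
    ring
  have hmain : (Nat.card {p : (SS n) × (SS n) // p.1 * p.2 * p.1⁻¹ * p.2⁻¹ ∈ S} : ℝ) / N ^ 2
      - (Nat.card S : ℝ) / (Nat.card (alternatingGroup (Fin n)) : ℝ) = ∑ π ∈ Sf, q π := by
    rw [hcomm, hSf, halt]
    simp only [q, Finset.sum_sub_distrib, ← Finset.sum_div, Finset.sum_const, nsmul_eq_mul]
    field_simp
  rw [hmain]
  apply Real.abs_le_sqrt
  calc (∑ π ∈ Sf, q π) ^ 2 ≤ Sf.card * ∑ π ∈ Sf, q π ^ 2 := sq_sum_le_card_mul_sum_sq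
    _ ≤ N * ∑ π ∈ Af, q π ^ 2 := by
        have h1 : (Sf.card : ℝ) ≤ N := by
          have : (Sf.card : ℝ) ≤ Af.card := by exact_mod_cast Finset.card_le_card hsub
          linarith
        apply mul_le_mul h1 _ (Finset.sum_nonneg (fun _ _ => sq_nonneg _)) hNpos.le
        exact Finset.sum_le_sum_of_subset_of_nonneg hsub (fun _ _ _ => sq_nonneg _)
    _ = Zt (SS n) - 2 := by rw [hq]; field_simp

section Grp

def iF (n : ℕ) (e : SS n) : SS (n + 1) where
  toFun := Fin.cases 0 (fun i => (e i).succ)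
  invFun := Fin.cases 0 (fun i => (e⁻¹ i).succ)
  left_inv := by
    intro x
    refine Fin.cases ?_ (fun i => ?_) x <;> simp
  right_inv := by
    intro x
    refine Fin.cases ?_ (fun i => ?_) x <;> simp

theorem iF_zero {n : ℕ} (e : SS n) : iF n e 0 = 0 := rfl
theorem iF_succ {n : ℕ} (e : SS n) (i : Fin n) : iF n e i.succ = (e i).succ := rfl

def iG (n : ℕ) : SS n →* SS (n + 1) where
  toFun := iF n
  map_one' := by
    ext x
    refine Fin.cases ?_ (fun i => ?_) x <;> simp [iF_zero, iF_succ]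
  map_mul' := by
    intro a b
    ext x
    refine Fin.cases ?_ (fun i => ?_) x <;> simp [iF_zero, iF_succ]

theorem iG_zero {n : ℕ} (e : SS n) : iG n e 0 = 0 := rfl
theorem iG_succ {n : ℕ} (e : SS n) (i : Fin n) : iG n e i.succ = (e i).succ := rfl

theorem iG_swap {n : ℕ} (p q : Fin n) : iG n (Equiv.swap p q) = Equiv.swap p.succ q.succ := by
  ext x
  refine Fin.cases ?_ (fun i => ?_) x
  · rw [iG_zero, Equiv.swap_apply_of_ne_of_ne (Fin.succ_ne_zero _).symm (Fin.succ_ne_zero _).symm]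
  · rw [iG_succ]
    simp only [Equiv.swap_apply_def, Fin.succ_inj]
    split_ifs <;> rfl

theorem exists_iG {n : ℕ} (g : SS (n + 1)) (h : g 0 = 0) : ∃ k, g = iG n k := by
  have hs : ∀ (g : SS (n + 1)), g 0 = 0 → ∀ i : Fin n, g i.succ ≠ 0 := by
    intro g h i hi
    rw [← h] at hi
    exact Fin.succ_ne_zero _ (g.injective hi)
  have h' : g⁻¹ 0 = 0 := by rw [Equiv.Perm.inv_eq_iff_eq, h]
  refine ⟨⟨fun i => (g i.succ).pred (hs g h i), fun i => (g⁻¹ i.succ).pred (hs _ h' i), ?_, ?_⟩, ?_⟩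
  · intro i; simp
  · intro i; simp
  · ext x
    refine Fin.cases ?_ (fun i => ?_) x
    · rw [iG_zero, h]
    · rw [iG_succ]; simp

def sw (n : ℕ) : SS (n + 2) := Equiv.swap 0 1

theorem sw_sq (n : ℕ) : sw n * sw n = 1 := Equiv.swap_mul_self 0 1

theorem sw_comm {n : ℕ} (k : SS n) :
    sw n * iG (n + 1) (iG n k) = iG (n + 1) (iG n k) * sw n := by
  have : iG (n + 1) (iG n k) * sw n * (iG (n + 1) (iG n k))⁻¹ = sw n := by
    unfold sw
    rw [← Equiv.swap_apply_apply]
    congr 1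
  exact (mul_inv_eq_iff_eq_mul.1 this).symm

theorem decomp {n : ℕ} (g : SS (n + 2)) :
    (∃ h, g = iG (n + 1) h) ∨ ∃ h h', g = iG (n + 1) h * sw n * iG (n + 1) h' := by
  by_cases h0 : g 0 = 0
  · exact Or.inl (exists_iG g h0)
  · right
    obtain ⟨p, hp⟩ := Fin.exists_succ_eq.2 h0
    let h : SS (n + 1) := Equiv.swap 0 p
    have : ((iG (n + 1) h * sw n)⁻¹ * g) 0 = 0 := by
      rw [Equiv.Perm.mul_apply, Equiv.Perm.inv_eq_iff_eq, ← hp, Equiv.Perm.mul_apply]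
      have : sw n 0 = (0 : Fin (n + 1)).succ := by simp [sw]
      rw [this, iG_succ]
      simp [h]
    obtain ⟨h', hh'⟩ := exists_iG _ this
    exact ⟨h, h', by rw [← hh']; group⟩

def io (n : ℕ) : A (SS n) →ₐ[ℂ] A (SS (n + 1)) := MonoidAlgebra.mapDomainAlgHom ℂ ℂ (iG n)

theorem io_sg {n : ℕ} (g : SS n) : io n (sg g) = sg (iG n g) := by
  simp [io, sg]

def TT (n : ℕ) : A (SS n) := ∑ p : Fin n, ∑ q : Fin n, sg (Equiv.swap p q)
def XX (n : ℕ) : A (SS (n + 1)) := ∑ p : Fin n, sg (Equiv.swap 0 p.succ)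

theorem TT_central {n : ℕ} (g : SS n) : sg g * TT n = TT n * sg g := by
  simp only [TT, Finset.mul_sum, Finset.sum_mul, sg_mul]
  apply Fintype.sum_equiv g
  intro p
  apply Fintype.sum_equiv g
  intro q
  congr 1
  rw [Equiv.swap_apply_apply]; group

theorem TT_succ (n : ℕ) : TT (n + 1) = io n (TT n) + (2 : ℂ) • XX n + 1 := by
  simp only [TT, XX, map_sum, io_sg, iG_swap, Fin.sum_univ_succ, Equiv.swap_self,
    Finset.sum_add_distrib]
  have : ∀ x : Fin n, Equiv.swap x.succ 0 = Equiv.swap 0 x.succ := fun x => Equiv.swap_comm _ _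
  simp only [this, two_smul]
  have h1 : sg (Equiv.refl (Fin (n + 1))) = (1 : A (SS (n + 1))) := rfl
  rw [h1]
  abel

theorem sX (n : ℕ) : io (n + 1) (XX n) * sg (sw n) = sg (sw n) * XX (n + 1) - 1 := by
  simp only [XX, map_sum, io_sg, iG_swap, Finset.sum_mul, Finset.mul_sum, sg_mul]
  rw [Fin.sum_univ_succ (n := n)]
  have h0 : sw n * Equiv.swap 0 (Fin.succ 0) = 1 := sw_sq n
  rw [h0, sg_one, add_sub_cancel_left]
  refine Finset.sum_congr rfl fun p _ => ?_
  congr 1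
  have : sw n * Equiv.swap 0 p.succ.succ * (sw n)⁻¹ = Equiv.swap (Fin.succ 0) p.succ.succ := by
    rw [← Equiv.swap_apply_apply]
    congr 1
  rw [← this]; group

end Grp

section Branch

theorem TT_comm {n : ℕ} (x : A (SS n)) : x * TT n = TT n * x := by
  have h := commute_of_sg (AlgHom.id ℂ (A (SS n))) (z := TT n) (fun g => by
    simpa only [AlgHom.id_apply] using TT_central g) x
  simpa only [AlgHom.id_apply] using h

theorem XX_eq (n : ℕ) : XX n = (2⁻¹ : ℂ) • (TT (n + 1) - io n (TT n) - 1) := by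
  have : TT (n + 1) - io n (TT n) - 1 = (2 : ℂ) • XX n := by rw [TT_succ]; abel
  rw [this, smul_smul]
  norm_num

theorem XX_comm {n : ℕ} (x : A (SS n)) : io n x * XX n = XX n * io n x := by
  rw [XX_eq, mul_smul_comm, smul_mul_assoc, mul_sub, mul_sub, sub_mul, sub_mul, TT_comm, ← map_mul,
    TT_comm, map_mul, one_mul, mul_one]

def ct {n : ℕ} (i : Ir (SS n)) : ℂ := ((central_scalar i (z := TT n) TT_central).choose - n) / 2

theorem TT_e {n : ℕ} (i : Ir (SS n)) : TT n * e i = (2 * ct i + n) • e i := by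
  rw [(central_scalar i (z := TT n) TT_central).choose_spec]
  congr 1
  unfold ct; ring

theorem XE {n : ℕ} (j : Ir (SS n)) (i : Ir (SS (n + 1))) :
    XX n * (io n (e j) * e i) = (ct i - ct j) • (io n (e j) * e i) := by
  have h1 : TT (n + 1) * (io n (e j) * e i) = (2 * ct i + (n + 1)) • (io n (e j) * e i) := by
    rw [← mul_assoc, ← TT_comm, mul_assoc, TT_e, mul_smul_comm]
    push_cast; rfl
  have h2 : io n (TT n) * (io n (e j) * e i) = (2 * ct j + n) • (io n (e j) * e i) := by
    rw [← mul_assoc, ← map_mul, TT_e, map_smul, smul_mul_assoc]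
  rw [XX_eq, smul_mul_assoc, sub_mul, sub_mul, h1, h2, one_mul]
  module

/-- `j` occurs in the restriction of `i` -/
def Bl {n : ℕ} (j : Ir (SS n)) (i : Ir (SS (n + 1))) : Prop := R i (io n (e j)) ≠ 0

theorem XE_R {n : ℕ} (j : Ir (SS n)) (i : Ir (SS (n + 1))) :
    R i (XX n) * R i (io n (e j)) = (ct i - ct j) • R i (io n (e j)) := by
  have := congrArg (R i) (XE j i)
  simpa [R_e_self] using this

variable {n : ℕ} (i : Ir (SS (n + 2)))

abbrev EE (j : Ir (SS (n + 1))) : Mt i := R i (io (n + 1) (e j))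
abbrev FF (k : Ir (SS n)) : Mt i := R i (io (n + 1) (io n (e k)))
abbrev ss : Mt i := R i (sg (sw n))

theorem ss_sq : ss i * ss i = 1 := by
  rw [← map_mul, sg_mul, sw_sq, sg_one, map_one]

theorem ss_comm (x : A (SS n)) :
    R i (io (n + 1) (io n x)) * ss i = ss i * R i (io (n + 1) (io n x)) := by
  have := commute_of_sg ((io (n + 1)).comp (io n)) (z := sg (sw n)) (by
    intro g
    simp only [AlgHom.comp_apply, io_sg, sg_mul, sw_comm]) x
  rw [AlgHom.comp_apply] at this
  rw [← map_mul, this, map_mul]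

theorem EE_self (j) : EE i j * EE i j = EE i j := by
  rw [← map_mul, ← map_mul, e_mul_self]

theorem EE_ne {j j'} (h : j ≠ j') : EE i j * EE i j' = 0 := by
  rw [← map_mul, ← map_mul, e_mul_ne h, map_zero, map_zero]

theorem FF_self (k) : FF i k * FF i k = FF i k := by
  rw [← map_mul, ← map_mul, ← map_mul, e_mul_self]

theorem sum_EE : ∑ j, EE i j = 1 := by
  rw [← map_sum, ← map_sum, sum_e, map_one, map_one]

theorem sum_FF : ∑ k, FF i k = 1 := by
  rw [← map_sum, ← map_sum, ← map_sum, sum_e, map_one, map_one, map_one]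

theorem EE_comm (j) (x : A (SS (n + 1))) :
    EE i j * R i (io (n + 1) x) = R i (io (n + 1) x) * EE i j := by
  rw [← map_mul, ← map_mul, e_comm, map_mul, map_mul]

theorem FE_ne {i : Ir (SS (n + 2))} {j k} (h1 : Bl k j) (h2 : Bl j i) : FF i k * EE i j ≠ 0 := by
  intro h
  have := simple ((R i).comp (io (n + 1))) (i := j) (x := io n (e k)) (by
    rw [AlgHom.comp_apply, map_mul, map_mul, h]) h2
  exact h1 (mul_e_eq_zero.1 this)

theorem FE_zero {i : Ir (SS (n + 2))} {j k} (h1 : ¬ Bl k j) : FF i k * EE i j = 0 := by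
  have : R j (io n (e k)) = 0 := not_not.1 h1
  rw [← map_mul, ← map_mul, mul_e_eq_zero.2 this, map_zero, map_zero]

theorem X1_FE (j k) : R i (io (n + 1) (XX n)) * (FF i k * EE i j) =
    (ct j - ct k) • (FF i k * EE i j) := by
  rw [← map_mul, ← map_mul, ← map_mul, ← map_mul, XE, map_smul, map_smul]

theorem X1_s : R i (io (n + 1) (XX n)) * ss i = ss i * R i (XX (n + 1)) - 1 := by
  rw [← map_mul, sX, map_sub, map_mul, map_one]

theorem FE_X1 (j k) : FF i k * EE i j * R i (io (n + 1) (XX n)) =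
    (ct j - ct k) • (FF i k * EE i j) := by
  rw [← X1_FE, mul_assoc, EE_comm, ← mul_assoc, ← mul_assoc]
  congr 1
  rw [← map_mul, ← map_mul, XX_comm, map_mul, map_mul]

theorem key (j j' k) : ((ct i - ct j') - (ct j - ct k)) • (FF i k * EE i j * ss i * EE i j') =
    FF i k * EE i j * EE i j' := by
  have h : FF i k * EE i j * (R i (io (n + 1) (XX n)) * ss i) * EE i j' =
    FF i k * EE i j * (ss i * R i (XX (n + 1)) - 1) * EE i j' := by rw [X1_s]
  rw [← mul_assoc, FE_X1, mul_sub, sub_mul, mul_one, smul_mul_assoc, smul_mul_assoc,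
    ← mul_assoc, mul_assoc _ (R i (XX (n + 1))), XE_R, mul_smul_comm] at h
  rw [sub_smul, h]; abel

theorem ba_ne {i : Ir (SS (n + 2))} {j k} (h1 : Bl k j) (h2 : Bl j i) :
    (ct i - ct j) - (ct j - ct k) ≠ 0 := by
  intro h
  have := key i j j k
  rw [h, zero_smul, mul_assoc, EE_self] at this
  exact FE_ne h1 h2 this.symm

theorem EsE_k (j k) : FF i k * EE i j * ss i * EE i j =
    ((ct i - ct j) - (ct j - ct k))⁻¹ • (FF i k * EE i j) := by
  by_cases h : (ct i - ct j) - (ct j - ct k) = 0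
  · have : FF i k * EE i j = 0 := by
      have := key i j j k
      rw [h, zero_smul, mul_assoc, EE_self] at this
      exact this.symm
    rw [this]; simp
  · rw [eq_inv_smul_iff₀ h, key, mul_assoc, EE_self]

open Classical in
theorem EsE (j) : EE i j * ss i * EE i j = ∑ k : {k // Bl k j},
    ((ct i - ct j) - (ct j - ct k.1))⁻¹ • (FF i k.1 * EE i j) := by
  have h : EE i j * ss i * EE i j = ∑ k, FF i k * EE i j * ss i * EE i j := by
    simp only [← Finset.sum_mul, sum_FF, one_mul]
  rw [h, ← Finset.sum_subtype (univ.filter (fun k => Bl k j)) (by simp)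
    (f := fun k => ((ct i - ct j) - (ct j - ct k))⁻¹ • (FF i k * EE i j)),
    Finset.sum_filter_of_ne]
  · simp only [EsE_k]
  · intro k _ hk
    by_contra hb
    exact hk (by rw [FE_zero hb, smul_zero])

theorem lower_distinct {i : Ir (SS (n + 2))} {j j'} (h1 : Bl j i) (h2 : Bl j' i)
    (hc : ct j = ct j') : j = j' := by
  by_contra hne
  obtain ⟨g, hg⟩ := prime (i := i) (x := io (n + 1) (e j)) (y := io (n + 1) (e j'))
    (fun h => h1 (mul_e_eq_zero.1 h)) (fun h => h2 (mul_e_eq_zero.1 h))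
  have hg' : EE i j * R i (sg g) * EE i j' ≠ 0 := by
    intro h
    apply hg
    rw [mul_e_eq_zero, map_mul, map_mul, h]
  rcases decomp g with ⟨h, rfl⟩ | ⟨h, h', rfl⟩
  · apply hg'
    rw [← io_sg, EE_comm, mul_assoc, EE_ne i hne, mul_zero]
  · have hs : EE i j * ss i * EE i j' ≠ 0 := by
      intro h0
      apply hg'
      rw [← sg_mul, ← sg_mul, ← io_sg, ← io_sg, map_mul, map_mul]
      rw [← mul_assoc, ← mul_assoc, EE_comm, mul_assoc _ _ (EE i j'), ← EE_comm i j']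
      have : ∀ a b : Mt i, a * EE i j * ss i * (EE i j' * b) = a * (EE i j * ss i * EE i j') * b := by
        intro a b; simp only [mul_assoc]
      rw [this, h0, mul_zero, zero_mul]
    have : ∃ k, FF i k * EE i j * ss i * EE i j' ≠ 0 := by
      by_contra! h0
      apply hs
      have : EE i j * ss i * EE i j' = ∑ k, FF i k * EE i j * ss i * EE i j' := by
        simp only [← Finset.sum_mul, sum_FF, one_mul]
      rw [this]
      simp [h0]
    obtain ⟨k, hk⟩ := this
    have hB : Bl k j := by
      by_contra hb
      exact hk (by rw [FE_zero hb, zero_mul, zero_mul])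
    have hkey := key i j j' k
    rw [mul_assoc (FF i k) (EE i j) (EE i j'), EE_ne i hne, mul_zero, ← hc] at hkey
    rcases smul_eq_zero.1 hkey with h0 | h0
    · exact ba_ne hB h1 h0
    · exact hk h0

/-- the analogue of the exchange step -/
theorem exchange0 {i : Ir (SS (n + 2))} {j k} (h1 : Bl k j) (h2 : Bl j i)
    (h : ss i * (FF i k * EE i j) ≠ ((ct i - ct j) - (ct j - ct k))⁻¹ • (FF i k * EE i j)) :
    ∃ j', Bl j' i ∧ Bl k j' ∧ ct i - ct j' = ct j - ct k := by
  set b := ct i - ct j with hb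
  set a := ct j - ct k with ha
  have hba : b - a ≠ 0 := ba_ne h1 h2
  set w : Mt i := ss i * (FF i k * EE i j) - (b - a)⁻¹ • (FF i k * EE i j) with hw
  have hFE : FF i k * EE i j = EE i j * FF i k := by rw [EE_comm]
  have hXw : R i (io (n + 1) (XX n)) * w = b • w := by
    have e1 : R i (io (n + 1) (XX n)) * (ss i * (FF i k * EE i j))
        = b • (ss i * (FF i k * EE i j)) - FF i k * EE i j := by
      rw [← mul_assoc, X1_s, sub_mul, one_mul, mul_assoc, hFE, ← mul_assoc (R i (XX (n + 1))), XE_R,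
        smul_mul_assoc, mul_smul_comm]
    rw [hw, mul_sub, mul_smul_comm, X1_FE, e1, ← ha, smul_sub, smul_smul, smul_smul]
    have e2 : b * (b - a)⁻¹ = (b - a)⁻¹ * a + 1 := by field_simp; ring
    rw [e2, add_smul, one_smul]
    abel
  have hw0 : w ≠ 0 := sub_ne_zero.2 h
  have hFw : FF i k * w = w := by
    rw [hw, mul_sub, ← mul_assoc, ss_comm, mul_smul_comm, mul_assoc, ← mul_assoc (FF i k) (FF i k),
      FF_self]
  obtain ⟨j', hj'⟩ : ∃ j', EE i j' * w ≠ 0 := by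
    by_contra! h0
    apply hw0
    rw [← one_mul w, ← sum_EE, Finset.sum_mul]
    simp [h0]
  have hj2 : FF i k * EE i j' * w ≠ 0 := by
    rwa [← EE_comm, mul_assoc, hFw]
  have hb1 : Bl j' i := by
    intro h0
    apply hj'
    change R i (io (n + 1) (e j')) * w = 0
    rw [h0, zero_mul]
  have hb2 : Bl k j' := by
    by_contra h0
    apply hj2
    rw [FE_zero h0, zero_mul]
  refine ⟨j', hb1, hb2, ?_⟩
  have e5 : (ct j' - ct k) • (FF i k * EE i j' * w) = b • (FF i k * EE i j' * w) := by
    rw [← mul_smul_comm b, ← hXw, ← mul_assoc _ _ w, FE_X1, smul_mul_assoc]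
  rw [← sub_eq_zero, ← sub_smul, smul_eq_zero] at e5
  rcases e5 with e5 | e5
  · rw [hb] at e5
    rw [ha]
    linear_combination -e5
  · exact absurd e5 hj2

theorem exchange {i : Ir (SS (n + 2))} {j k} (h1 : Bl k j) (h2 : Bl j i)
    (h : ((ct i - ct j) - (ct j - ct k)) ^ 2 ≠ 1) :
    ∃ j', Bl j' i ∧ Bl k j' ∧ ct i - ct j' = ct j - ct k := by
  have hba := ba_ne h1 h2
  refine exchange0 h1 h2 fun e1 => ?_
  set b := ct i - ct j with hb
  set a := ct j - ct k with ha
  have e2 : ss i * (ss i * (FF i k * EE i j)) = FF i k * EE i j := by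
    rw [← mul_assoc, ss_sq, one_mul]
  rw [e1, mul_smul_comm, e1, smul_smul] at e2
  have e3 : ((b - a)⁻¹ * (b - a)⁻¹ - 1) • (FF i k * EE i j) = 0 := by
    rw [sub_smul, e2, one_smul, sub_self]
  rcases smul_eq_zero.1 e3 with e4 | e4
  · apply h
    field_simp at e4
    linear_combination -e4
  · exact FE_ne h1 h2 e4

end Branch

section Cover

open Classical

variable {n : ℕ}

def vv (j : Ir (SS (n + 1))) (i : Ir (SS (n + 2))) (m : Option {k : Ir (SS n) // Bl k j}) : ℂ :=
  m.elim 1 (fun k => ((ct i - ct j) - (ct j - ct k.1))⁻¹)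

def dn (j : Ir (SS (n + 1))) : ℕ := (univ.filter (fun k : Ir (SS n) => Bl k j)).card

theorem Yg (j : Ir (SS (n + 1))) (g : SS (n + 2)) :
    ∃ y : Option {k : Ir (SS n) // Bl k j} → A (SS (n + 1)), ∀ i,
      EE i j * R i (sg g) * EE i j = R i (io (n + 1) ((∑ m, vv j i m • y m) * e j)) := by
  rcases decomp g with ⟨h, rfl⟩ | ⟨h, h', rfl⟩
  · refine ⟨fun m => m.elim (sg h) (fun _ => 0), fun i => ?_⟩
    rw [Fintype.sum_option]
    simp only [vv, Option.elim, smul_zero, Finset.sum_const_zero, add_zero, one_smul]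
    rw [← io_sg, EE_comm, mul_assoc, EE_self, map_mul, map_mul]
  · refine ⟨fun m => m.elim 0 (fun k => sg h * io n (e k.1) * sg h'), fun i => ?_⟩
    rw [Fintype.sum_option]
    simp only [vv, Option.elim, smul_zero, zero_add]
    have e1 : EE i j * R i (sg (iG (n + 1) h * sw n * iG (n + 1) h')) * EE i j
        = R i (io (n + 1) (sg h)) * (EE i j * ss i * EE i j) * R i (io (n + 1) (sg h')) := by
      rw [← sg_mul, ← sg_mul, ← io_sg, ← io_sg, map_mul, map_mul]
      rw [← mul_assoc, ← mul_assoc, EE_comm, mul_assoc _ _ (EE i j), ← EE_comm i j (sg h')]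
      simp only [mul_assoc]
    rw [e1, EsE]
    simp only [Finset.mul_sum, Finset.sum_mul, map_sum, mul_smul_comm, smul_mul_assoc, map_smul]
    refine Finset.sum_congr rfl fun k _ => ?_
    congr 1
    simp only [map_mul]
    rw [mul_assoc _ _ (EE i j), ← EE_comm i j (sg h')]
    simp only [mul_assoc]

theorem Yx (j : Ir (SS (n + 1))) (x : A (SS (n + 2))) :
    ∃ y : Option {k : Ir (SS n) // Bl k j} → A (SS (n + 1)), ∀ i,
      EE i j * R i x * EE i j = R i (io (n + 1) ((∑ m, vv j i m • y m) * e j)) := by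
  induction x using MonoidAlgebra.induction_linear with
  | zero => exact ⟨fun _ => 0, fun i => by simp⟩
  | add x x' hx hx' =>
    obtain ⟨y, hy⟩ := hx
    obtain ⟨y', hy'⟩ := hx'
    refine ⟨fun m => y m + y' m, fun i => ?_⟩
    rw [map_add, mul_add, add_mul, hy, hy', ← map_add, ← map_add, ← add_mul,
      ← Finset.sum_add_distrib]
    simp only [smul_add]
  | single g r =>
    obtain ⟨y, hy⟩ := Yg j g
    refine ⟨fun m => r • y m, fun i => ?_⟩
    have : (MonoidAlgebra.single g r : A (SS (n + 2))) = r • sg g := by simp [sg]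
    rw [this, map_smul, mul_smul_comm, smul_mul_assoc, hy, ← map_smul, ← map_smul,
      ← smul_mul_assoc, Finset.smul_sum]
    simp only [smul_comm r]

theorem cover_li (j : Ir (SS (n + 1))) :
    LinearIndependent ℂ (fun i : {i : Ir (SS (n + 2)) // Bl j i} => vv j i.1) := by
  rw [Fintype.linearIndependent_iff]
  intro c hc i0
  obtain ⟨y, hy⟩ := Yx j (e i0.1)
  have h : ∀ i : {i : Ir (SS (n + 2)) // Bl j i},
      (∑ m, vv j i.1 m • y m) * e j = if i = i0 then e j else 0 := by
    intro i
    have hi := hy i.1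
    split_ifs with hii
    · subst hii
      rw [R_e_self, mul_one, EE_self, ← sub_eq_zero, ← map_sub, ← map_sub, ← one_sub_mul] at hi
      have := simple ((R i.1).comp (io (n + 1))) hi i.2
      rw [one_sub_mul, sub_eq_zero] at this
      exact this.symm
    · have : i.1 ≠ i0.1 := fun h => hii (Subtype.ext h)
      rw [R_e_ne this, mul_zero, zero_mul] at hi
      exact simple ((R i.1).comp (io (n + 1))) hi.symm i.2
  have h2 : ∑ i, c i • ((∑ m, vv j i.1 m • y m) * e j) = c i0 • e j := by
    simp only [h]
    simp
  have h3 : ∑ i, c i • ((∑ m, vv j i.1 m • y m) * e j) = 0 := by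
    simp only [← smul_mul_assoc, ← Finset.sum_mul, Finset.smul_sum, smul_smul]
    rw [Finset.sum_comm]
    simp only [← Finset.sum_smul]
    have : ∀ m, ∑ i, c i * vv j i.1 m = 0 := by
      intro m
      have := congrFun hc m
      simpa using this
    simp [this]
  rw [h3] at h2
  exact (smul_eq_zero.1 h2.symm).resolve_right (e_ne_zero j)

theorem upper_distinct {j : Ir (SS (n + 1))} {i i' : Ir (SS (n + 2))} (h : Bl j i) (h' : Bl j i')
    (hc : ct i = ct i') : i = i' := by
  have := (cover_li j).injective (a₁ := ⟨i, h⟩) (a₂ := ⟨i', h'⟩) (by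
    funext m
    simp only [vv, hc])
  exact congrArg Subtype.val this

theorem cover_card (j : Ir (SS (n + 1))) :
    (univ.filter (fun i : Ir (SS (n + 2)) => Bl j i)).card ≤ dn j + 1 := by
  have := (cover_li j).fintype_card_le_finrank
  rw [Module.finrank_fintype_fun_eq_card, Fintype.card_option, Fintype.card_subtype,
    Fintype.card_subtype] at this
  exact this

theorem dn_pos (i : Ir (SS (n + 1))) : 1 ≤ dn i := by
  by_contra h
  have h0 : dn i = 0 := by omega
  unfold dn at h0
  rw [Finset.card_eq_zero, Finset.filter_eq_empty_iff] at h0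
  have : ∑ j, R i (io n (e j)) = 1 := by
    rw [← map_sum, ← map_sum, sum_e, map_one, map_one]
  rw [Finset.sum_eq_zero (fun j hj => not_not.1 (h0 hj))] at this
  exact zero_ne_one this

def DD (i : Ir (SS (n + 1))) : Finset ℂ :=
  (univ.filter (fun k : Ir (SS n) => Bl k i)).image (fun k => ct i - ct k)

theorem DD_card (i : Ir (SS (n + 2))) : (DD i).card = dn i := by
  unfold DD dn
  apply Finset.card_image_of_injOn
  intro j hj j' hj' h
  simp only [coe_filter, mem_univ, true_and, Set.mem_ofPred_eq] at hj hj'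
  simp only [sub_right_inj] at h
  exact lower_distinct hj hj' h

theorem mem_DD {i : Ir (SS (n + 1))} {x : ℂ} : x ∈ DD i ↔ ∃ k, Bl k i ∧ ct i - ct k = x := by
  simp [DD]

theorem DD_not_mem {j : Ir (SS (n + 1))} {i : Ir (SS (n + 2))} (h : Bl j i) :
    ct i - ct j ∉ DD j := by
  rw [mem_DD]
  rintro ⟨k, hk, h2⟩
  exact ba_ne hk h (by rw [h2, sub_self])

theorem DD_sub {j : Ir (SS (n + 1))} {i : Ir (SS (n + 2))} (h : Bl j i) :
    insert (ct i - ct j) (DD j \ {ct i - ct j - 1, ct i - ct j + 1}) ⊆ DD i := by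
  intro x hx
  rw [Finset.mem_insert] at hx
  rcases hx with rfl | hx
  · exact mem_DD.2 ⟨j, h, rfl⟩
  · rw [Finset.mem_sdiff, mem_DD] at hx
    obtain ⟨⟨k, hk, rfl⟩, hx⟩ := hx
    obtain ⟨j', h1, _, h2⟩ := exchange hk h (by
      intro h3
      apply hx
      have h4 : ((ct i - ct j - (ct j - ct k)) - 1) * ((ct i - ct j - (ct j - ct k)) + 1) = 0 := by
        linear_combination h3
      simp only [Finset.mem_insert, Finset.mem_singleton]
      rcases mul_eq_zero.1 h4 with h3 | h3
      · left; linear_combination -h3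
      · right; linear_combination -h3)
    exact mem_DD.2 ⟨j', h1, h2⟩

/-- lower bound for the number of corners -/
theorem dn_ge {j : Ir (SS (n + 2))} {i : Ir (SS (n + 3))} (h : Bl j i) :
    1 + (DD j \ {ct i - ct j - 1, ct i - ct j + 1}).card ≤ dn i := by
  rw [← DD_card, add_comm, ← Finset.card_insert_of_notMem (a := ct i - ct j)]
  · exact Finset.card_le_card (DD_sub h)
  · intro h2
    exact DD_not_mem h (Finset.mem_sdiff.1 h2).1

theorem dn_ge' {j : Ir (SS (n + 2))} {i : Ir (SS (n + 3))} (h : Bl j i) :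
    dn j ≤ dn i + 1 := by
  have h1 := dn_ge h
  have h2 := Finset.le_card_sdiff {ct i - ct j - 1, ct i - ct j + 1} (DD j)
  have h3 : ({ct i - ct j - 1, ct i - ct j + 1} : Finset ℂ).card ≤ 2 := Finset.card_le_two
  rw [DD_card] at h2
  omega

theorem dn_two {j : Ir (SS (n + 2))} {i i' : Ir (SS (n + 3))} (h : Bl j i) (h' : Bl j i')
    (hj : dn j = 2) (hi : dn i = 1) (hi' : dn i' = 1) : i = i' := by
  have key : ∀ i : Ir (SS (n + 3)), Bl j i → dn i = 1 → ∑ x ∈ DD j, x = 2 * (ct i - ct j) := by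
    intro i h hi
    have h1 := dn_ge h
    have h2 : DD j \ {ct i - ct j - 1, ct i - ct j + 1} = ∅ := by
      rw [← Finset.card_eq_zero]; omega
    rw [Finset.sdiff_eq_empty_iff_subset] at h2
    have h3 : DD j = {ct i - ct j - 1, ct i - ct j + 1} := by
      apply Finset.eq_of_subset_of_card_le h2
      rw [DD_card, hj]
      exact Finset.card_le_two
    rw [h3, Finset.sum_pair]
    · ring
    · intro h4
      have : (2 : ℂ) = 0 := by linear_combination -h4
      norm_num at this
  have := (key i h hi).symm.trans (key i' h' hi')
  apply upper_distinct h h'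
  linear_combination this / 2

end Cover

section Linear

open Classical

variable {n : ℕ}

def Lin (i : Ir (SS n)) : Prop := ∀ g, ∃ c : ℂ, R i (sg g) = c • 1

theorem not_lin_dm {i : Ir (SS n)} (h : ¬ Lin i) : 2 ≤ dm i := by
  by_contra hd
  have h1 : dm i = 1 := by
    have := NeZero.ne (dm i)
    omega
  apply h
  intro g
  have : Subsingleton (Fin (dm i)) := by rw [h1]; infer_instance
  refine ⟨R i (sg g) 0 0, ?_⟩
  refine Matrix.ext fun a b => ?_
  rw [Subsingleton.elim a 0, Subsingleton.elim b 0]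
  simp

theorem pair_all {i i' : Ir (SS n)}
    (h : ∀ g, ∃ c : ℂ, R i (sg g) = c • 1 ∧ R i' (sg g) = c • 1) (x : A (SS n)) :
    ∃ c : ℂ, R i x = c • 1 ∧ R i' x = c • 1 := by
  induction x using MonoidAlgebra.induction_linear with
  | zero => exact ⟨0, by simp⟩
  | add x x' hx hx' =>
    obtain ⟨c, h1, h2⟩ := hx
    obtain ⟨c', h1', h2'⟩ := hx'
    exact ⟨c + c', by rw [map_add, h1, h1', add_smul], by rw [map_add, h2, h2', add_smul]⟩
  | single g r =>
    obtain ⟨c, h1, h2⟩ := h g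
    have : (MonoidAlgebra.single g r : A (SS n)) = r • sg g := by simp [sg]
    exact ⟨r * c, by rw [this, map_smul, h1, smul_smul], by rw [this, map_smul, h2, smul_smul]⟩

theorem pair_eq {i i' : Ir (SS n)}
    (h : ∀ g, ∃ c : ℂ, R i (sg g) = c • 1 ∧ R i' (sg g) = c • 1) : i = i' := by
  by_contra hne
  obtain ⟨c, h1, h2⟩ := pair_all h (e i)
  rw [R_e_self] at h1
  rw [R_e_ne (Ne.symm hne)] at h2
  have h3 : c = 0 := by
    rcases smul_eq_zero.1 h2.symm with h3 | h3
    · exact h3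
    · exact absurd h3 one_ne_zero
  rw [h3, zero_smul] at h1
  exact one_ne_zero h1

theorem lin_all {i : Ir (SS n)} (h : Lin i) (x : A (SS n)) : ∃ c : ℂ, R i x = c • 1 := by
  obtain ⟨c, hc, _⟩ := pair_all (i := i) (i' := i) (fun g => by
    obtain ⟨c, hc⟩ := h g
    exact ⟨c, hc, hc⟩) x
  exact ⟨c, hc⟩

theorem swap_conj {i : Ir (SS n)} {p q a b : Fin n} {t : ℂ} (hpq : p ≠ q) (hab : a ≠ b)
    (h : R i (sg (Equiv.swap p q)) = t • 1) : R i (sg (Equiv.swap a b)) = t • 1 := by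
  obtain ⟨c, hc⟩ := isConj_iff.1 (Equiv.Perm.isConj_swap hpq hab)
  rw [← hc, ← sg_mul, ← sg_mul, map_mul, map_mul, h, mul_smul_comm, mul_one, smul_mul_assoc,
    ← map_mul, sg_mul, mul_inv_cancel, sg_one, map_one]

theorem pair_of_swap {i i' : Ir (SS n)} {p q p' q' : Fin n} {t : ℂ} (hpq : p ≠ q) (hpq' : p' ≠ q')
    (h : R i (sg (Equiv.swap p q)) = t • 1) (h' : R i' (sg (Equiv.swap p' q')) = t • 1) (g : SS n) :
    ∃ c : ℂ, R i (sg g) = c • 1 ∧ R i' (sg g) = c • 1 := by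
  induction g using Equiv.Perm.swap_induction_on with
  | one => exact ⟨1, by rw [sg_one, map_one, one_smul], by rw [sg_one, map_one, one_smul]⟩
  | swap_mul f x y hxy ih =>
    obtain ⟨c, h1, h2⟩ := ih
    refine ⟨t * c, ?_, ?_⟩
    · rw [← sg_mul, map_mul, h1, swap_conj hpq hxy h, smul_mul_assoc, one_mul, smul_smul]
    · rw [← sg_mul, map_mul, h2, swap_conj hpq' hxy h', smul_mul_assoc, one_mul, smul_smul]

theorem lin_of_swap {i : Ir (SS n)} {p q : Fin n} {t : ℂ} (hpq : p ≠ q)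
    (h : R i (sg (Equiv.swap p q)) = t • 1) : Lin i := by
  intro g
  obtain ⟨c, hc, _⟩ := pair_of_swap hpq hpq h h g
  exact ⟨c, hc⟩

theorem dn_one {i : Ir (SS (n + 1))} {j : Ir (SS n)} (hd : dn i = 1) (h : Bl j i) :
    R i (io n (e j)) = 1 := by
  obtain ⟨j0, hj0⟩ := Finset.card_eq_one.1 hd
  have hmem : ∀ j', Bl j' i → j' = j0 := by
    intro j' hj'
    have : j' ∈ univ.filter (fun k : Ir (SS n) => Bl k i) := by simp [hj']
    rw [hj0] at this
    simpa using this
  have : ∑ j, R i (io n (e j)) = 1 := by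
    rw [← map_sum, ← map_sum, sum_e, map_one, map_one]
  rw [← this, Finset.sum_eq_single j]
  · intro b _ hb
    by_contra h0
    exact hb ((hmem b h0).trans (hmem j h).symm)
  · simp

theorem lin_of_dn {j : Ir (SS (n + 1))} {i : Ir (SS (n + 2))} (h : Bl j i) (hj : dn j = 1)
    (hi : dn i = 1) : Lin i := by
  obtain ⟨k, hk⟩ := Finset.card_eq_one.1 hj
  have hk' : Bl k j := by
    have : k ∈ univ.filter (fun k : Ir (SS n) => Bl k j) := by rw [hk]; simp
    simpa using this
  have h1 : EE i j = 1 := dn_one hi h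
  have h2 : FF i k * EE i j = EE i j := by
    have := mul_e_of_R (c := 1) ((dn_one hj hk').trans (one_smul _ _).symm)
    rw [one_smul] at this
    rw [← map_mul, ← map_mul, this]
  have h3 := EsE_k i j k
  rw [h2, h1, mul_one, one_mul] at h3
  exact lin_of_swap (p := 0) (q := 1) (by simp) h3

theorem lin_down {j : Ir (SS (n + 1))} {k : Ir (SS n)} (h : Bl k j) {g : SS n} {c : ℂ}
    (hc : R j (sg (iG n g)) = c • 1) : R k (sg g) = c • 1 := by
  have := simple ((R j).comp (io n)) (i := k) (x := sg g - c • 1) (by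
    rw [AlgHom.comp_apply, map_mul, map_mul, map_sub, map_sub, io_sg, hc, map_smul, map_smul,
      map_one, map_one, sub_self, zero_mul]) h
  rw [mul_e_eq_zero, map_sub, map_smul, map_one, sub_eq_zero] at this
  exact this

theorem lin_down' {j : Ir (SS (n + 1))} {k : Ir (SS n)} (hj : Lin j) (h : Bl k j) : Lin k := by
  intro g
  obtain ⟨c, hc⟩ := hj (iG n g)
  exact ⟨c, lin_down h hc⟩

theorem exists_Bl (j : Ir (SS (n + 1))) : ∃ k, Bl k j := by
  have := dn_pos j
  unfold dn at this
  obtain ⟨k, hk⟩ := Finset.card_pos.1 this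
  exact ⟨k, by simpa using hk⟩

theorem lin_dn {j : Ir (SS (n + 1))} (hj : Lin j) : dn j = 1 := by
  apply le_antisymm _ (dn_pos j)
  unfold dn
  rw [Finset.card_le_one]
  intro a ha b hb
  simp only [mem_filter, mem_univ, true_and] at ha hb
  by_contra hne
  obtain ⟨c, hc⟩ := lin_all hj (io n (e a))
  have h1 : R j (io n (e a)) * R j (io n (e b)) = 0 := by
    rw [← map_mul, ← map_mul, e_mul_ne hne, map_zero, map_zero]
  rw [hc, smul_mul_assoc, one_mul, smul_eq_zero] at h1
  rcases h1 with h1 | h1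
  · apply ha
    rw [hc, h1, zero_smul]
  · exact hb h1

theorem lin_same {j j' : Ir (SS (n + 3))} {k : Ir (SS (n + 2))} (hj : Lin j) (hj' : Lin j')
    (h : Bl k j) (h' : Bl k j') : j = j' := by
  obtain ⟨c, hc⟩ := hj (iG (n + 2) (sw n))
  obtain ⟨c', hc'⟩ := hj' (iG (n + 2) (sw n))
  have h1 := (lin_down h hc).symm.trans (lin_down h' hc')
  have h2 : c = c' := by
    have h3 : (c - c') • (1 : Mt k) = 0 := by rw [sub_smul, h1, sub_self]
    rcases smul_eq_zero.1 h3 with h3 | h3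
    · exact sub_eq_zero.1 h3
    · exact absurd h3 one_ne_zero
  subst h2
  rw [sw, iG_swap] at hc hc'
  have hne : (0 : Fin (n + 2)).succ ≠ (1 : Fin (n + 2)).succ := by
    intro h; simpa using Fin.succ_injective _ h
  exact pair_eq (pair_of_swap hne hne hc hc')

theorem lin_card : (univ.filter (fun i : Ir (SS (n + 2)) => Lin i)).card ≤ 2 := by
  have hex : ∀ i : Ir (SS (n + 2)), ∃ c : ℂ, Lin i → R i (sg (sw n)) = c • 1 := by
    intro i
    by_cases h : Lin i
    · obtain ⟨c, hc⟩ := h (sw n)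
      exact ⟨c, fun _ => hc⟩
    · exact ⟨0, fun h' => absurd h' h⟩
  choose c hc using hex
  have h2 : ({1, -1} : Finset ℂ).card ≤ 2 := Finset.card_le_two
  refine (Finset.card_le_card_of_injOn c ?_ ?_).trans h2
  · intro i hi
    simp only [coe_filter, mem_univ, true_and, Set.mem_ofPred_eq] at hi
    have h1 := ss_sq i
    rw [ss, hc i hi, smul_mul_assoc, one_mul, smul_smul] at h1
    have h3 : (c i * c i - 1) • (1 : Mt i) = 0 := by rw [sub_smul, h1, one_smul, sub_self]
    rcases smul_eq_zero.1 h3 with h3 | h3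
    · have h4 : (c i - 1) * (c i + 1) = 0 := by linear_combination h3
      simp only [coe_insert, coe_singleton, Set.mem_insert_iff, Set.mem_singleton_iff]
      rcases mul_eq_zero.1 h4 with h5 | h5
      · left; linear_combination h5
      · right; linear_combination h5
    · exact absurd h3 one_ne_zero
  · intro i hi i' hi' h
    simp only [coe_filter, mem_univ, true_and, Set.mem_ofPred_eq] at hi hi'
    have h1 := hc i hi
    have h2 := hc i' hi'
    rw [← h] at h2
    have hne : (0 : Fin (n + 2)) ≠ 1 := by simp
    exact pair_eq (pair_of_swap hne hne h1 h2)

theorem dim_sum (i : Ir (SS (n + 1))) :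
    ∑ j ∈ univ.filter (fun j : Ir (SS n) => Bl j i), dm j ≤ dm i := by
  have h1 : ∑ j, R i (io n (e j)) = 1 := by
    rw [← map_sum, ← map_sum, sum_e, map_one, map_one]
  have h2 := congrArg Matrix.trace h1
  rw [Matrix.trace_sum] at h2
  choose m hm using fun j => mult ((R i).comp (io n)) j
  have h3 : ∀ j, (R i (io n (e j))).trace = ((m j * dm j : ℕ) : ℂ) := by
    intro j
    have := (hm j).1
    rw [AlgHom.comp_apply] at this
    rw [this]; push_cast; rfl
  simp only [h3] at h2
  rw [← Nat.cast_sum, Matrix.trace_one, Fintype.card_fin] at h2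
  have h4 : ∑ j, m j * dm j = dm i := by exact_mod_cast h2
  rw [← h4, Finset.sum_filter]
  apply Finset.sum_le_sum
  intro j _
  split_ifs with hj
  · exact Nat.le_mul_of_pos_left _ ((hm j).2 hj)
  · exact Nat.zero_le _

theorem lin_of_stable {j : Ir (SS (n + 1))} {i : Ir (SS (n + 2))} (hj : Lin j) (h : Bl j i) {t : ℂ}
    (hs : ss i * EE i j = t • EE i j) : Lin i := by
  have h1 : ∀ g : SS (n + 1), ∃ c : ℂ, R i (io (n + 1) (sg g)) * EE i j = c • EE i j := by
    intro g
    obtain ⟨c, hc⟩ := hj g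
    exact ⟨c, by rw [← map_mul, ← map_mul, mul_e_of_R hc, map_smul, map_smul]⟩
  have h2 : ∀ g : SS (n + 2), ∃ c : ℂ, R i (sg g) * EE i j = c • EE i j := by
    intro g
    rcases decomp g with ⟨h, rfl⟩ | ⟨h, h', rfl⟩
    · rw [← io_sg]; exact h1 h
    · obtain ⟨c, hc⟩ := h1 h
      obtain ⟨c', hc'⟩ := h1 h'
      refine ⟨c' * (t * c), ?_⟩
      rw [← sg_mul, ← sg_mul, map_mul, map_mul, ← io_sg, ← io_sg, mul_assoc, hc', mul_smul_comm,
        mul_assoc, hs, mul_smul_comm, hc, smul_smul, smul_smul, mul_assoc]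
  intro g
  apply R_scalar i
  intro g'
  by_contra hne
  have hx : (sg g' * sg g - sg g * sg g') * e i ≠ 0 := by
    intro h0
    rw [mul_e_eq_zero, map_sub, map_mul, map_mul, sub_eq_zero] at h0
    exact hne h0
  obtain ⟨u, hu⟩ := prime (i := i) hx (y := io (n + 1) (e j)) (fun h0 => h (mul_e_eq_zero.1 h0))
  apply hu
  rw [mul_e_eq_zero, map_mul, map_mul]
  obtain ⟨a, ha⟩ := h2 u
  obtain ⟨b, hb⟩ := h2 g
  obtain ⟨c, hc⟩ := h2 g'
  rw [mul_assoc, ha, mul_smul_comm, map_sub, map_mul, map_mul, sub_mul, mul_assoc, mul_assoc, hb, hc,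
    mul_smul_comm, mul_smul_comm, hb, hc, smul_smul, smul_smul, mul_comm b c, sub_self, smul_zero]

theorem hook (m : ℕ) : ∀ i : Ir (SS (m + 3)), ¬ Lin i → (∃ j, Lin j ∧ Bl j i) → m + 2 ≤ dm i := by
  induction m with
  | zero => intro i hi _; exact not_lin_dm hi
  | succ m ih =>
    rintro i hi ⟨j, hj, hji⟩
    obtain ⟨k, hk⟩ := exists_Bl j
    have hFE : FF i k * EE i j = EE i j := by
      have := mul_e_of_R (c := 1) ((dn_one (lin_dn hj) hk).trans (one_smul _ _).symm)
      rw [one_smul] at this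
      rw [← map_mul, ← map_mul, this]
    obtain ⟨j', h1, h2, h3⟩ := exchange0 hk hji (by
      rw [hFE]
      intro h
      exact hi (lin_of_stable hj hji h))
    have hne : j ≠ j' := by
      rintro rfl
      exact ba_ne hk hji (by rw [h3, sub_self])
    have hj' : ¬ Lin j' := fun h => hne (lin_same hj h hk h2)
    have h4 := ih j' hj' ⟨k, lin_down' hj hk, h2⟩
    have h5 := dim_sum i
    have h6 : dm j + dm j' ≤ ∑ j ∈ univ.filter (fun j => Bl j i), dm j := by
      rw [← Finset.sum_pair (f := fun j => dm j) hne]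
      apply Finset.sum_le_sum_of_subset
      intro x hx
      simp only [Finset.mem_insert, Finset.mem_singleton] at hx
      rcases hx with rfl | rfl <;> simp [hji, h1]
    have h7 := NeZero.ne (dm j)
    omega

end Linear

section Recursion

open Classical

theorem power_mean {ι : Type*} (s : Finset ι) (x : ι → ℝ) (hx : ∀ i ∈ s, 0 < x i) :
    (s.card : ℝ) ^ 3 ≤ (∑ i ∈ s, x i) ^ 2 * ∑ i ∈ s, (x i ^ 2)⁻¹ := by
  rcases Nat.eq_zero_or_pos s.card with h0 | h0
  · rw [h0]
    have : 0 ≤ (∑ i ∈ s, x i) ^ 2 * ∑ i ∈ s, (x i ^ 2)⁻¹ :=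
      mul_nonneg (sq_nonneg _) (Finset.sum_nonneg fun i _ => by positivity)
    simpa using this
  have hk : (0 : ℝ) < s.card := by exact_mod_cast h0
  have h1 : (s.card : ℝ) ^ 2 ≤ (∑ i ∈ s, x i) * ∑ i ∈ s, (x i)⁻¹ := by
    have := Finset.sum_mul_sq_le_sq_mul_sq s (fun i => √(x i)) (fun i => (√(x i))⁻¹)
    have e1 : ∑ i ∈ s, √(x i) * (√(x i))⁻¹ = s.card := by
      rw [Finset.sum_congr rfl (fun i hi => mul_inv_cancel₀ (Real.sqrt_pos.2 (hx i hi)).ne')]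
      simp
    rw [e1] at this
    have e2 : ∑ i ∈ s, √(x i) ^ 2 = ∑ i ∈ s, x i :=
      Finset.sum_congr rfl (fun i hi => Real.sq_sqrt (hx i hi).le)
    have e3 : ∑ i ∈ s, (√(x i))⁻¹ ^ 2 = ∑ i ∈ s, (x i)⁻¹ :=
      Finset.sum_congr rfl (fun i hi => by rw [inv_pow, Real.sq_sqrt (hx i hi).le])
    rw [e2, e3] at this
    exact this
  have h2 : (∑ i ∈ s, (x i)⁻¹) ^ 2 ≤ s.card * ∑ i ∈ s, (x i ^ 2)⁻¹ := by
    have := sq_sum_le_card_mul_sum_sq (s := s) (f := fun i => (x i)⁻¹)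
    simpa only [inv_pow] using this
  have h3 : (s.card : ℝ) * (s.card : ℝ) ^ 3 ≤
      s.card * ((∑ i ∈ s, x i) ^ 2 * ∑ i ∈ s, (x i ^ 2)⁻¹) := by
    calc (s.card : ℝ) * (s.card : ℝ) ^ 3 = ((s.card : ℝ) ^ 2) ^ 2 := by ring
      _ ≤ ((∑ i ∈ s, x i) * ∑ i ∈ s, (x i)⁻¹) ^ 2 := by gcongr
      _ = (∑ i ∈ s, x i) ^ 2 * (∑ i ∈ s, (x i)⁻¹) ^ 2 := by ring
      _ ≤ (∑ i ∈ s, x i) ^ 2 * (s.card * ∑ i ∈ s, (x i ^ 2)⁻¹) := by gcongr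
      _ = _ := by ring
  exact le_of_mul_le_mul_left h3 hk

variable {n : ℕ}

def ww (i : Ir (SS (n + 1))) : ℝ := if dn i = 1 then 1 / 2 else 1

theorem ww_le (i : Ir (SS (n + 1))) : ww i ≤ 1 := by unfold ww; split_ifs <;> norm_num
theorem ww_ge (i : Ir (SS (n + 1))) : 1 / 2 ≤ ww i := by unfold ww; split_ifs <;> norm_num

theorem term_le {i : Ir (SS (n + 1))} {k : ℕ} (hk : 1 ≤ k) (h : k ≤ dn i) :
    ww i / (dn i : ℝ) ^ 3 ≤ 1 / (k : ℝ) ^ 3 := by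
  have h1 : (1 : ℝ) ≤ k := by exact_mod_cast hk
  have h2 : (k : ℝ) ≤ dn i := by exact_mod_cast h
  exact div_le_div₀ zero_le_one (ww_le i) (by positivity) (by gcongr)

theorem local_bound (j : Ir (SS (n + 2))) :
    ∑ i ∈ univ.filter (fun i : Ir (SS (n + 3)) => Bl j i ∧ ¬ Lin i), ww i / (dn i : ℝ) ^ 3
      ≤ 7 / 8 * ww j := by
  set S := univ.filter (fun i : Ir (SS (n + 3)) => Bl j i ∧ ¬ Lin i) with hS
  have hmem : ∀ i ∈ S, Bl j i ∧ ¬ Lin i := by intro i hi; simpa [hS] using hi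
  have hcard : S.card ≤ dn j + 1 := by
    refine le_trans (Finset.card_le_card ?_) (cover_card j)
    intro i hi
    simp [(hmem i hi).1]
  have hcard' : (S.card : ℝ) ≤ dn j + 1 := by exact_mod_cast hcard
  have hpos := dn_pos j
  by_cases h1 : dn j = 1
  · have : ∀ i ∈ S, ww i / (dn i : ℝ) ^ 3 ≤ 1 / 8 := by
      intro i hi
      obtain ⟨a, b⟩ := hmem i hi
      have h2 : dn i ≠ 1 := fun h => b (lin_of_dn a h1 h)
      have := dn_pos i
      refine (term_le (k := 2) (by norm_num) (by omega)).trans (by norm_num)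
    have h3 := Finset.sum_le_card_nsmul S _ _ this
    have h4 : ww j = 1 / 2 := by simp [ww, h1]
    rw [h1] at hcard'
    rw [nsmul_eq_mul] at h3
    rw [h4]
    push_cast at hcard'
    linarith
  have hwj : ww j = 1 := by simp [ww, h1]
  rw [hwj, mul_one]
  by_cases h2 : dn j = 2
  · have : ∀ i ∈ S, ww i / (dn i : ℝ) ^ 3 ≤ 1 / 8 + if dn i = 1 then 3 / 8 else 0 := by
      intro i hi
      by_cases h : dn i = 1
      · simp only [ww, h, if_true]; norm_num
      · have := dn_pos i
        rw [if_neg h, add_zero]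
        refine (term_le (k := 2) (by norm_num) (by omega)).trans (by norm_num)
    have h3 := Finset.sum_le_sum this
    have h4 : (S.filter (fun i => dn i = 1)).card ≤ 1 := by
      rw [Finset.card_le_one]
      intro a ha b hb
      rw [Finset.mem_filter] at ha hb
      exact dn_two (hmem a ha.1).1 (hmem b hb.1).1 h2 ha.2 hb.2
    have h4' : ((S.filter (fun i => dn i = 1)).card : ℝ) ≤ 1 := by exact_mod_cast h4
    rw [Finset.sum_add_distrib, ← Finset.sum_filter, Finset.sum_const, Finset.sum_const,
      nsmul_eq_mul, nsmul_eq_mul] at h3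
    rw [h2] at hcard'
    push_cast at hcard'
    linarith
  · have h3 : 3 ≤ dn j := by omega
    obtain ⟨k, hk⟩ : ∃ k, dn j = k + 1 := ⟨dn j - 1, by omega⟩
    have hk2 : 2 ≤ k := by omega
    have : ∀ i ∈ S, ww i / (dn i : ℝ) ^ 3 ≤ 1 / (k : ℝ) ^ 3 := by
      intro i hi
      have := dn_ge' (hmem i hi).1
      exact term_le (by omega) (by omega)
    have h4 := Finset.sum_le_card_nsmul S _ _ this
    rw [nsmul_eq_mul] at h4
    refine h4.trans ?_
    have hk3 : (2 : ℝ) ≤ k := by exact_mod_cast hk2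
    rw [mul_one_div, div_le_iff₀ (by positivity)]
    rw [hk] at hcard'
    push_cast at hcard'
    have h5 : (4 : ℝ) ≤ (k : ℝ) ^ 2 := by nlinarith
    have h6 : (4 : ℝ) * k ≤ (k : ℝ) ^ 3 := by nlinarith
    linarith

def FS (m : ℕ) : ℝ :=
  ∑ i ∈ univ.filter (fun i : Ir (SS (m + 3)) => ¬ Lin i), ww i * ((dm i : ℝ) ^ 2)⁻¹

theorem dm_pos' {G : Type} [Group G] [Fintype G] (i : Ir G) : (0 : ℝ) < dm i := by
  exact_mod_cast Nat.pos_of_ne_zero (NeZero.ne (dm i))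

theorem jensen (i : Ir (SS (n + 1))) : ((dm i : ℝ) ^ 2)⁻¹ ≤
    (1 / (dn i : ℝ) ^ 3) * ∑ j ∈ univ.filter (fun j : Ir (SS n) => Bl j i), ((dm j : ℝ) ^ 2)⁻¹ := by
  have h1 := power_mean (univ.filter (fun j : Ir (SS n) => Bl j i)) (fun j => (dm j : ℝ))
    (fun j _ => dm_pos' j)
  have h2 : (∑ j ∈ univ.filter (fun j : Ir (SS n) => Bl j i), (dm j : ℝ)) ≤ dm i := by
    exact_mod_cast dim_sum i
  change (dn i : ℝ) ^ 3 ≤ _ at h1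
  have hd : (0 : ℝ) < dn i := by exact_mod_cast dn_pos i
  have hi := dm_pos' i
  set Q := ∑ j ∈ univ.filter (fun j : Ir (SS n) => Bl j i), ((dm j : ℝ) ^ 2)⁻¹ with hQ
  have hQ0 : 0 ≤ Q := Finset.sum_nonneg fun j _ => by positivity
  have h3 : (dn i : ℝ) ^ 3 ≤ (dm i : ℝ) ^ 2 * Q := by
    refine h1.trans ?_
    have : 0 ≤ ∑ j ∈ univ.filter (fun j : Ir (SS n) => Bl j i), (dm j : ℝ) :=
      Finset.sum_nonneg fun j _ => (dm_pos' j).le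
    gcongr
  rw [one_div_mul_eq_div, le_div_iff₀ (by positivity), inv_mul_le_iff₀ (by positivity)]
  exact h3

theorem FS_rec (m : ℕ) : FS (m + 1) ≤ 7 / 8 * FS m + 4 / ((m : ℝ) + 3) ^ 2 := by
  let bad : Finset (Ir (SS (m + 4))) := univ.filter (fun i => ¬ Lin i ∧ ∃ j, Lin j ∧ Bl j i)
  let good : Finset (Ir (SS (m + 4))) := univ.filter (fun i => ¬ Lin i ∧ ¬ ∃ j, Lin j ∧ Bl j i)
  have hsplit : FS (m + 1) = ∑ i ∈ bad, ww i * ((dm i : ℝ) ^ 2)⁻¹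
      + ∑ i ∈ good, ww i * ((dm i : ℝ) ^ 2)⁻¹ := by
    unfold FS
    rw [← Finset.sum_filter_add_sum_filter_not _ (fun i => ∃ j, Lin j ∧ Bl j i)]
    rw [Finset.filter_filter, Finset.filter_filter]
  have hbadcard : bad.card ≤ 4 := by
    have hsub : bad ⊆ (univ.filter (fun j : Ir (SS (m + 3)) => Lin j)).biUnion
        (fun j => univ.filter (fun i => Bl j i)) := by
      intro i hi
      simp only [bad, mem_filter, mem_univ, true_and] at hi
      obtain ⟨_, j, hj, hji⟩ := hi
      simp only [mem_biUnion, mem_filter, mem_univ, true_and]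
      exact ⟨j, hj, hji⟩
    refine (Finset.card_le_card hsub).trans ?_
    refine (Finset.card_biUnion_le_card_mul _ _ 2 ?_).trans ?_
    · intro j hj
      simp only [mem_filter, mem_univ, true_and] at hj
      have := cover_card j
      rwa [lin_dn hj] at this
    · exact Nat.mul_le_mul_right 2 (lin_card (n := m + 1))
  have hbad : ∑ i ∈ bad, ww i * ((dm i : ℝ) ^ 2)⁻¹ ≤ 4 / ((m : ℝ) + 3) ^ 2 := by
    have : ∀ i ∈ bad, ww i * ((dm i : ℝ) ^ 2)⁻¹ ≤ 1 / ((m : ℝ) + 3) ^ 2 := by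
      intro i hi
      simp only [bad, mem_filter, mem_univ, true_and] at hi
      have h1 := hook (m + 1) i hi.1 hi.2
      have h2 : (m : ℝ) + 3 ≤ dm i := by
        have : ((m + 1 + 2 : ℕ) : ℝ) ≤ dm i := by exact_mod_cast h1
        push_cast at this; linarith
      rw [← div_eq_mul_inv]
      exact div_le_div₀ zero_le_one (ww_le i) (by positivity) (by gcongr)
    have h2 := Finset.sum_le_card_nsmul bad _ _ this
    rw [nsmul_eq_mul] at h2
    refine h2.trans ?_
    rw [mul_one_div]
    gcongr
    exact_mod_cast hbadcard
  have hgood : ∑ i ∈ good, ww i * ((dm i : ℝ) ^ 2)⁻¹ ≤ 7 / 8 * FS m := by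
    calc ∑ i ∈ good, ww i * ((dm i : ℝ) ^ 2)⁻¹
        ≤ ∑ i ∈ good, ∑ j : Ir (SS (m + 3)), (if Bl j i ∧ ¬ Lin j then
            (ww i / (dn i : ℝ) ^ 3) * ((dm j : ℝ) ^ 2)⁻¹ else 0) := by
          apply Finset.sum_le_sum
          intro i hi
          simp only [good, mem_filter, mem_univ, true_and, not_exists, not_and] at hi
          rw [← Finset.sum_filter]
          have hf : univ.filter (fun j : Ir (SS (m + 3)) => Bl j i ∧ ¬ Lin j)
              = univ.filter (fun j => Bl j i) := by
            apply Finset.filter_congr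
            intro j _
            exact ⟨fun h => h.1, fun h => ⟨h, fun h' => hi.2 j h' h⟩⟩
          rw [hf, ← Finset.mul_sum]
          have h0 : 0 ≤ ww i := le_trans (by norm_num) (ww_ge i)
          calc ww i * ((dm i : ℝ) ^ 2)⁻¹ ≤ ww i * ((1 / (dn i : ℝ) ^ 3) *
                ∑ j ∈ univ.filter (fun j => Bl j i), ((dm j : ℝ) ^ 2)⁻¹) :=
                mul_le_mul_of_nonneg_left (jensen i) h0
            _ = _ := by ring
      _ = ∑ j : Ir (SS (m + 3)), ∑ i ∈ good, (if Bl j i ∧ ¬ Lin j then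
            (ww i / (dn i : ℝ) ^ 3) * ((dm j : ℝ) ^ 2)⁻¹ else 0) := Finset.sum_comm
      _ ≤ ∑ j : Ir (SS (m + 3)), (if ¬ Lin j then 7 / 8 * (ww j * ((dm j : ℝ) ^ 2)⁻¹) else 0) := by
          apply Finset.sum_le_sum
          intro j _
          by_cases hj : ¬ Lin j
          · rw [if_pos hj]
            have hp := dm_pos' j
            have h1 := local_bound j
            have h2 : ∑ i ∈ good, (if Bl j i ∧ ¬ Lin j then
              (ww i / (dn i : ℝ) ^ 3) * ((dm j : ℝ) ^ 2)⁻¹ else 0) ≤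
              (∑ i ∈ univ.filter (fun i : Ir (SS (m + 4)) => Bl j i ∧ ¬ Lin i),
                ww i / (dn i : ℝ) ^ 3) * ((dm j : ℝ) ^ 2)⁻¹ := by
              rw [Finset.sum_mul, ← Finset.sum_filter]
              apply Finset.sum_le_sum_of_subset_of_nonneg
              · intro i hi
                simp only [good, mem_filter, mem_univ, true_and] at hi ⊢
                exact ⟨hi.2.1, hi.1.1⟩
              · intro i _ _
                have h0 : 0 ≤ ww i := le_trans (by norm_num) (ww_ge i)
                positivity
            refine h2.trans ?_
            rw [← mul_assoc]
            gcongr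
          · rw [if_neg hj]
            apply le_of_eq
            apply Finset.sum_eq_zero
            intro i _
            rw [if_neg (fun h => hj h.2)]
      _ = 7 / 8 * FS m := by
          rw [← Finset.sum_filter, ← Finset.mul_sum]; rfl
  rw [hsplit]; linarith

theorem FS_bound : ∃ C > (0 : ℝ), ∀ m, FS m ≤ C / ((m : ℝ) + 31) ^ 2 := by
  refine ⟨max 20000 (961 * FS 0), lt_of_lt_of_le (by norm_num) (le_max_left _ _), ?_⟩
  set C := max 20000 (961 * FS 0) with hC
  have hC1 : 20000 ≤ C := le_max_left _ _
  have hC2 : 961 * FS 0 ≤ C := le_max_right _ _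
  intro m
  induction m with
  | zero =>
    rw [le_div_iff₀ (by norm_num)]
    norm_num
    linarith
  | succ m ih =>
    refine (FS_rec m).trans ?_
    have hm : (0 : ℝ) ≤ m := Nat.cast_nonneg m
    have h1 : 4 / ((m : ℝ) + 3) ^ 2 ≤ 500 / ((m : ℝ) + 31) ^ 2 := by
      rw [div_le_div_iff₀ (by positivity) (by positivity)]
      nlinarith
    have h2 : 7 / 8 * (C / ((m : ℝ) + 31) ^ 2) + 500 / ((m : ℝ) + 31) ^ 2 ≤
        C * (9 / 10) / ((m : ℝ) + 31) ^ 2 := by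
      rw [← mul_div_assoc, ← add_div]
      gcongr
      linarith
    have h3 : C * (9 / 10) / ((m : ℝ) + 31) ^ 2 ≤ C / (((m + 1 : ℕ) : ℝ) + 31) ^ 2 := by
      rw [div_le_div_iff₀ (by positivity) (by positivity), mul_assoc]
      apply mul_le_mul_of_nonneg_left _ (by linarith)
      push_cast
      nlinarith
    linarith

theorem Zt_bound (m : ℕ) : Zt (SS (m + 3)) - 2 ≤ 2 * FS m := by
  unfold Zt FS
  rw [← Finset.sum_filter_add_sum_filter_not _ (fun i : Ir (SS (m + 3)) => Lin i)]
  have h1 : ∑ i ∈ univ.filter (fun i : Ir (SS (m + 3)) => Lin i), ((dm i : ℝ) ^ 2)⁻¹ ≤ 2 := by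
    have : ∀ i ∈ univ.filter (fun i : Ir (SS (m + 3)) => Lin i), ((dm i : ℝ) ^ 2)⁻¹ ≤ 1 := by
      intro i _
      apply inv_le_one_of_one_le₀
      have : (1 : ℝ) ≤ dm i := by exact_mod_cast Nat.pos_of_ne_zero (NeZero.ne (dm i))
      nlinarith
    have h2 := Finset.sum_le_card_nsmul _ _ _ this
    have h3 := lin_card (n := m + 1)
    have h4 : ((univ.filter (fun i : Ir (SS (m + 3)) => Lin i)).card : ℝ) ≤ 2 := by
      exact_mod_cast h3
    rw [nsmul_eq_mul, mul_one] at h2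
    linarith
  have h2 : ∑ i ∈ univ.filter (fun i : Ir (SS (m + 3)) => ¬ Lin i), ((dm i : ℝ) ^ 2)⁻¹ ≤
      2 * ∑ i ∈ univ.filter (fun i : Ir (SS (m + 3)) => ¬ Lin i), ww i * ((dm i : ℝ) ^ 2)⁻¹ := by
    rw [Finset.mul_sum]
    apply Finset.sum_le_sum
    intro i _
    have h0 := ww_ge i
    have : 0 ≤ ((dm i : ℝ) ^ 2)⁻¹ := by positivity
    nlinarith
  linarith

end Recursion

end

end TVC

/-- The total variation distance between the distribution of the commutator `[σ,τ]`
of two independent uniform permutations and the uniform measure on the alternating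
group `A_n` is `O(1/n)`. -/
theorem tv_commutator_uniform :
    ∃ C > (0 : ℝ), ∀ n ≥ 5, ∀ A : Set (Equiv.Perm (Fin n)),
      A ⊆ (alternatingGroup (Fin n) : Set (Equiv.Perm (Fin n))) →
      |(Nat.card {p : Equiv.Perm (Fin n) × Equiv.Perm (Fin n) //
            p.1 * p.2 * p.1⁻¹ * p.2⁻¹ ∈ A} : ℝ) / (n.factorial : ℝ) ^ 2
          - (Nat.card A : ℝ) / (Nat.card (alternatingGroup (Fin n)) : ℝ)| ≤ C / n := by
  obtain ⟨C, hC, hF⟩ := TVC.FS_bound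
  refine ⟨√(2 * C), Real.sqrt_pos.2 (by positivity), ?_⟩
  intro n hn A hA
  refine (TVC.tv_bound n (by omega) A hA).trans ?_
  obtain ⟨m, rfl⟩ : ∃ m, n = m + 3 := ⟨n - 3, by omega⟩
  have h1 := TVC.Zt_bound m
  have h2 := hF m
  have hm : (0 : ℝ) ≤ m := Nat.cast_nonneg m
  have h3 : TVC.Zt (Equiv.Perm (Fin (m + 3))) - 2 ≤ 2 * C / (((m + 3 : ℕ) : ℝ)) ^ 2 := by
    refine h1.trans ?_
    have : C / ((m : ℝ) + 31) ^ 2 ≤ C / (((m + 3 : ℕ) : ℝ)) ^ 2 := by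
      push_cast
      apply div_le_div_of_nonneg_left hC.le (by positivity)
      gcongr
      norm_num
    rw [mul_div_assoc]
    linarith
  refine (Real.sqrt_le_sqrt h3).trans ?_
  rw [Real.sqrt_div (by positivity), Real.sqrt_sq (by positivity)]
end

section
/- For every n ≥ 1 and every real number q, Σ_{σ,τ ∈ S_n} q^{C([σ,τ])} = n! · Σ_{λ ⊢ n} Π_{(i,j) ∈ λ} (q + j − i), where the outer sum is over all partitions λ of n and the product is over the cells (i,j) of the Young diagram of λ (so j − i is the content of cell (i,j)). -/
/-- Number of cycles of a permutation of `Fin n`, counting fixed points as 1-cycles. -/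
def numCycles {n : ℕ} (π : Equiv.Perm (Fin n)) : ℕ :=
  Multiset.card π.cycleType + (Finset.univ.filter fun i => π i = i).card

/-- For a partition `lam` of `n` with parts sorted in decreasing order
`L = (λ_1 ≥ λ_2 ≥ ⋯)`, the product over the cells `(a,b)` (`0`-indexed) of the
Young diagram of `q + content(a,b)` where the content of cell `(a,b)` is `b - a`. -/
noncomputable def contentProd (q : ℝ) {n : ℕ} (lam : Nat.Partition n) : ℝ :=
  let L := lam.parts.sort (· ≥ ·)
  ∏ a ∈ Finset.range L.length, ∏ b ∈ Finset.range (L.getD a 0),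
    (q + (b : ℝ) - (a : ℝ))

open Equiv

/-- number of orbits -/
noncomputable def cyc {α : Type*} (g : Perm α) : ℕ := Nat.card (Quotient (Perm.SameCycle.setoid g))

noncomputable def colEquiv {α : Type*} (g : Perm α) :
    (Quotient (Perm.SameCycle.setoid g) → Bool) ≃ {w : α → Bool // ∀ i, w (g i) = w i} where
  toFun f := ⟨fun i => f (Quotient.mk _ i), fun i => by
    refine congrArg f (Quotient.sound ?_)
    exact (Perm.sameCycle_apply_left).2 (Perm.SameCycle.refl _ _)⟩
  invFun w := Quotient.lift w.1 (by
    rintro a b ⟨k, hk⟩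
    have h : ∀ k : ℤ, ∀ a, w.1 ((g ^ k) a) = w.1 a := by
      intro k
      induction k using Int.induction_on with
      | zero => simp
      | succ i ih => intro a; rw [zpow_add_one, Perm.mul_apply, ih, w.2]
      | pred i ih =>
        intro a
        rw [zpow_sub_one, Perm.mul_apply, ih, ← w.2 (g⁻¹ a)]
        simp
    rw [← hk, h])
  left_inv f := by
    ext x
    induction x using Quotient.inductionOn
    rfl
  right_inv w := by
    ext x; rfl

lemma two_pow_cyc {α : Type*} [Fintype α] (g : Perm α) :
    2 ^ cyc g = Nat.card {w : α → Bool // ∀ i, w (g i) = w i} := by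
  classical
  rw [← Nat.card_congr (colEquiv g), Nat.card_fun]
  simp [cyc]

lemma cyc_inv {α : Type*} [Fintype α] (g : Perm α) : cyc g⁻¹ = cyc g := by
  apply Nat.pow_right_injective (le_refl 2)
  simp only [two_pow_cyc]
  congr 2
  ext w
  constructor
  · intro h i; simpa using (h (g i)).symm
  · intro h i; simpa using (h (g⁻¹ i)).symm

lemma cyc_mul_comm {α : Type*} [Fintype α] (g h : Perm α) : cyc (g * h) = cyc (h * g) := by
  apply Nat.pow_right_injective (le_refl 2)
  simp only [two_pow_cyc]
  apply Nat.card_congr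
  refine ⟨fun w => ⟨fun i => w.1 (g i), fun i => ?_⟩, fun w => ⟨fun i => w.1 (h i), fun i => ?_⟩,
    fun w => ?_, fun w => ?_⟩
  · simpa using w.2 (g i)
  · simpa using w.2 (h i)
  · ext i; simpa using w.2 i
  · ext i; simpa using w.2 i

lemma cyc_swap {α : Type*} [Fintype α] [DecidableEq α] (g : Perm α) (a b : α) (ha : g a = a)
    (hab : a ≠ b) : cyc (g * swap a b) + 1 = cyc g := by
  apply Nat.pow_right_injective (le_refl 2)
  simp only [pow_succ, two_pow_cyc]
  have : (2 : ℕ) = Nat.card Bool := by simp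
  conv_lhs => rw [this]
  rw [← Nat.card_prod]
  have hg : ∀ i, i ≠ a → g i ≠ a := fun i hi h => hi (g.injective (h.trans ha.symm))
  have key : ∀ w : α → Bool, (∀ i, w ((g * swap a b) i) = w i) →
      w a = w b ∧ ∀ i, w (g i) = w i := by
    intro w hw
    have h1 : w a = w b := by simpa [ha] using hw b
    refine ⟨h1, fun i => ?_⟩
    by_cases hia : i = a
    · rw [hia, ha]
    by_cases hib : i = b
    · have := hw a
      simp only [Perm.mul_apply, swap_apply_left] at this
      rw [hib, this, h1]
    · have := hw i
      rwa [Perm.mul_apply, swap_apply_of_ne_of_ne hia hib] at this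
  apply Nat.card_congr
  refine ⟨fun x => ⟨Function.update x.1.1 a x.2, fun i => ?_⟩,
    fun w => ⟨⟨Function.update w.1 a (w.1 b), fun i => ?_⟩, w.1 a⟩, fun x => ?_, fun w => ?_⟩
  · obtain ⟨⟨w, hw⟩, y⟩ := x
    obtain ⟨h1, h2⟩ := key w hw
    by_cases hia : i = a
    · rw [hia, ha]
    · simp [Function.update_of_ne hia, Function.update_of_ne (hg i hia), h2]
  · by_cases hia : i = a
    · subst hia
      have : g b ≠ i := hg b hab.symm
      simp [Function.update_of_ne this, w.2]
    by_cases hib : i = b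
    · subst hib
      simp [ha, Function.update_of_ne hia]
    · rw [Perm.mul_apply, swap_apply_of_ne_of_ne hia hib, Function.update_of_ne hia,
        Function.update_of_ne (hg i hia), w.2]
  · obtain ⟨⟨w, hw⟩, y⟩ := x
    obtain ⟨h1, h2⟩ := key w hw
    ext i
    · by_cases hia : i = a
      · subst hia; simp [h1, Function.update_of_ne hab.symm]
      · simp [Function.update_of_ne hia]
    · simp
  · ext i
    simp

lemma cyc_one {α : Type*} [Fintype α] : cyc (1 : Perm α) = Fintype.card α := by
  apply Nat.pow_right_injective (le_refl 2)
  simp [two_pow_cyc, Nat.card_fun]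

lemma numCycles_eq {n : ℕ} (g : Perm (Fin n)) : numCycles g = cyc g := by
  classical
  have e : (g.cycleFactorsFinset ⊕ {i // g i = i}) ≃ Quotient (Perm.SameCycle.setoid g) := by
    symm
    let F : Fin n → g.cycleFactorsFinset ⊕ {i // g i = i} := fun i =>
      if h : g i = i then Sum.inr ⟨i, h⟩ else
        Sum.inl ⟨g.cycleOf i, Perm.cycleOf_mem_cycleFactorsFinset_iff.2 (Perm.mem_support.2 h)⟩
    have hF : ∀ a b, F a = F b ↔ g.SameCycle a b := by
      intro a b
      by_cases ha : g a = a <;> by_cases hb : g b = b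
      · simp only [F, ha, hb, dif_pos]
        simp only [Sum.inr.injEq, Subtype.mk.injEq]
        constructor
        · rintro rfl; rfl
        · intro h; exact (h.eq_of_left ha)
      · simp only [F, ha, hb, dif_pos, dif_neg, not_false_eq_true]
        simp only [reduceCtorEq, false_iff]
        intro h
        exact hb (h.apply_eq_self_iff.1 ha)
      · simp only [F, ha, hb, dif_pos, dif_neg, not_false_eq_true]
        simp only [reduceCtorEq, false_iff]
        intro h
        exact ha (h.apply_eq_self_iff.2 hb)
      · simp only [F, ha, hb, dif_neg, not_false_eq_true]
        simp only [Sum.inl.injEq, Subtype.mk.injEq]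
        constructor
        · intro h
          have : b ∈ (g.cycleOf a).support := by
            rw [h]; rw [Perm.mem_support, Perm.cycleOf_apply_self]; exact hb
          exact (Perm.mem_support_cycleOf_iff.1 this).1
        · intro h; exact h.cycleOf_eq
    refine Equiv.ofBijective (Quotient.lift F fun a b h => (hF a b).2 h) ⟨?_, ?_⟩
    · intro x y
      induction x using Quotient.inductionOn
      induction y using Quotient.inductionOn
      intro h
      exact Quotient.sound ((hF _ _).1 h)
    · rintro (⟨c, hc⟩ | ⟨i, hi⟩)
      · have hc' := Perm.mem_cycleFactorsFinset_iff.1 hc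
        obtain ⟨i, hi⟩ := hc'.1.nonempty_support
        refine ⟨Quotient.mk _ i, ?_⟩
        have h1 : g i ≠ i := by
          rw [← hc'.2 i hi]; exact Perm.mem_support.1 hi
        simp only [Quotient.lift_mk, F, h1, dif_neg, not_false_eq_true]
        congr 2
        exact (Perm.cycle_is_cycleOf hi hc).symm
      · exact ⟨Quotient.mk _ i, by simp [F, hi]⟩
  rw [cyc, ← Nat.card_congr e, Nat.card_sum, numCycles, Perm.cycleType_def]
  simp [Fintype.card_subtype]

section content
variable {α : Type*} [Fintype α] [DecidableEq α]

/-- permutations preserving `k`, fixing everything outside `s` -/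
def GG (k : α → ℕ) (s : Finset α) : Finset (Perm α) :=
  Finset.univ.filter fun p => (∀ a, k (p a) = k a) ∧ ∀ a, a ∉ s → p a = a

lemma mem_GG {k : α → ℕ} {s : Finset α} {p : Perm α} :
    p ∈ GG k s ↔ (∀ a, k (p a) = k a) ∧ ∀ a, a ∉ s → p a = a := by simp [GG]

lemma GG_mul {k : α → ℕ} {s : Finset α} {p q : Perm α} (hp : p ∈ GG k s) (hq : q ∈ GG k s) :
    p * q ∈ GG k s := by
  rw [mem_GG] at *
  refine ⟨fun a => by simp [hp.1, hq.1], fun a ha => by simp [hp.2 a ha, hq.2 a ha]⟩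

lemma GG_inv {k : α → ℕ} {s : Finset α} {p : Perm α} (hp : p ∈ GG k s) :
    p⁻¹ ∈ GG k s := by
  rw [mem_GG] at *
  refine ⟨fun a => by simpa using (hp.1 (p⁻¹ a)).symm,
    fun a ha => by rw [Perm.inv_eq_iff_eq, hp.2 a ha]⟩

lemma GG_swap {k : α → ℕ} {s : Finset α} {a b : α} (ha : a ∈ s) (hb : b ∈ s) (h : k a = k b) :
    swap a b ∈ GG k s := by
  rw [mem_GG]
  refine ⟨fun x => ?_, fun x hx => swap_apply_of_ne_of_ne (by rintro rfl; exact hx ha)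
    (by rintro rfl; exact hx hb)⟩
  rw [swap_apply_def]
  split_ifs with h1 h2
  · rw [h1, h]
  · rw [h2, h]
  · rfl

lemma GG_mono {k : α → ℕ} {s t : Finset α} (h : s ⊆ t) {p : Perm α} (hp : p ∈ GG k s) :
    p ∈ GG k t := by
  rw [mem_GG] at *
  exact ⟨hp.1, fun a ha => hp.2 a fun h' => ha (h h')⟩

lemma GG_sum_insert (k : α → ℕ) (s : Finset α) (a : α) (ha : a ∉ s) (f : Perm α → ℝ) :
    ∑ p ∈ GG k (insert a s), f p =
      ∑ p ∈ GG k s, (f p + ∑ b ∈ s.filter (fun b => k b = k a), f (p * swap a b)) := by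
  have h0 : ∀ p, f p + ∑ b ∈ s.filter (fun b => k b = k a), f (p * swap a b) =
      ∑ b ∈ (insert a s).filter (fun b => k b = k a), f (p * swap a b) := by
    intro p
    rw [Finset.filter_insert, if_pos rfl, Finset.sum_insert (by simp [ha])]
    rw [Equiv.swap_self]
    rfl
  simp only [h0]
  rw [← Finset.sum_product']
  symm
  refine Finset.sum_bij' (fun x _ => x.1 * swap a x.2)
    (fun p _ => (p * swap a (p⁻¹ a), p⁻¹ a)) ?_ ?_ ?_ ?_ ?_
  · rintro ⟨p, b⟩ h
    simp only [Finset.mem_product, Finset.mem_filter] at h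
    exact GG_mul (GG_mono (Finset.subset_insert _ _) h.1)
      (GG_swap (Finset.mem_insert_self _ _) h.2.1 h.2.2.symm)
  · intro p hp
    have hpi := GG_inv hp
    have h1 : p⁻¹ a ∈ insert a s := by
      by_contra h
      rw [mem_GG] at hp
      have := hp.2 _ h
      have h9 : p (p⁻¹ a) = a := p.apply_symm_apply a
      rw [h9] at this
      rw [← this] at h
      simp at h
    have h2 : k (p⁻¹ a) = k a := (mem_GG.1 hpi).1 a
    simp only [Finset.mem_product, Finset.mem_filter]
    refine ⟨?_, h1, h2⟩
    have h3 := GG_mul hp (GG_swap (Finset.mem_insert_self _ _) h1 h2.symm)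
    rw [mem_GG] at h3 ⊢
    refine ⟨h3.1, fun x hx => ?_⟩
    by_cases hxa : x = a
    · subst hxa; simp
    · exact h3.2 x (by simp [hxa, hx])
  · rintro ⟨p, b⟩ h
    simp only [Finset.mem_product, Finset.mem_filter] at h
    have : p a = a := (mem_GG.1 h.1).2 a ha
    have h4 : p⁻¹ a = a := by rw [Perm.inv_eq_iff_eq, this]
    have h5 : (p * swap a b)⁻¹ a = b := by rw [Perm.inv_eq_iff_eq]; simp [this]
    simp only [h5, mul_assoc, swap_mul_self, mul_one]
  · intro p hp
    simp [mul_assoc]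
  · intros; rfl

lemma GG_sum_inv (k : α → ℕ) (s : Finset α) (f : Perm α → ℝ) :
    ∑ p ∈ GG k s, f p⁻¹ = ∑ p ∈ GG k s, f p :=
  Finset.sum_bij' (fun p _ => p⁻¹) (fun p _ => p⁻¹) (fun p hp => GG_inv hp)
    (fun p hp => GG_inv hp) (by simp) (by simp) (by simp)

lemma GG_sum_insert' (k : α → ℕ) (s : Finset α) (a : α) (ha : a ∉ s) (f : Perm α → ℝ) :
    ∑ p ∈ GG k (insert a s), f p =
      ∑ p ∈ GG k s, (f p + ∑ b ∈ s.filter (fun b => k b = k a), f (swap a b * p)) := by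
  rw [← GG_sum_inv, GG_sum_insert _ _ _ ha, ← GG_sum_inv]
  simp

/-- real sign -/
noncomputable def sg (p : Perm α) : ℝ := ((Perm.sign p : ℤ) : ℝ)

lemma sg_mul (p q : Perm α) : sg (p * q) = sg p * sg q := by simp [sg]
lemma sg_swap {a b : α} (h : a ≠ b) : sg (swap a b) = -1 := by simp [sg, Perm.sign_swap h]
lemma sg_one : sg (1 : Perm α) = 1 := by simp [sg]
lemma sg_mul_self (p : Perm α) : sg p * sg p = 1 := by
  rcases Int.units_eq_one_or (Perm.sign p) with h | h <;> simp [sg, h]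

/-- the content polynomial -/
noncomputable def SS (x : ℝ) (r c : α → ℕ) (s : Finset α) : ℝ :=
  ∑ p ∈ GG r s, ∑ q ∈ GG c s, sg q * x ^ cyc (p * q)

lemma cancel (x : ℝ) (r c : α → ℕ) (s : Finset α) (b' b'' d : α) (h1 : b' ∈ s) (h2 : b'' ∈ s)
    (hd : d ∈ s) (hr : r d = r b'') (hc : c d = c b') (hne : d ≠ b') (hne2 : d ≠ b'')
    (hne3 : b' ≠ b'') :
    ∑ p ∈ GG r s, ∑ q ∈ GG c s, sg q * x ^ cyc (p * swap b' b'' * q) = 0 := by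
  have hR := GG_swap hd h2 hr
  have hC := GG_swap hd h1 hc
  have : ∑ p ∈ GG r s, ∑ q ∈ GG c s, sg q * x ^ cyc (p * swap b' b'' * q) =
      ∑ p ∈ GG r s, ∑ q ∈ GG c s, -(sg q * x ^ cyc (p * swap b' b'' * q)) := by
    refine Finset.sum_bij' (fun p _ => p * swap d b'') (fun p _ => p * swap d b'')
      (fun p hp => GG_mul hp hR) (fun p hp => GG_mul hp hR) (by simp [mul_assoc])
      (by simp [mul_assoc]) ?_
    intro p hp
    refine Finset.sum_bij' (fun p _ => swap d b' * p) (fun p _ => swap d b' * p)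
      (fun p hp => GG_mul hC hp) (fun p hp => GG_mul hC hp) (by simp)
      (by simp) ?_
    intro q hq
    rw [sg_mul, sg_swap hne]
    have : swap d b'' * swap b' b'' * swap d b' = swap b' b'' := by
      have h5 : swap b' b'' * swap d b' = swap d b'' * swap b' b'' := by
        rw [Equiv.mul_swap_eq_swap_mul, swap_apply_of_ne_of_ne hne hne2, swap_apply_left]
      rw [mul_assoc, h5]
      simp
    have h6 : p * swap d b'' * swap b' b'' * (swap d b' * q) = p * swap b' b'' * q := by
      conv_rhs => rw [← this]
      simp only [mul_assoc]
    rw [h6]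
    ring
  simp only [Finset.sum_neg_distrib] at this
  linarith

lemma pow_swap (x : ℝ) (p q : Perm α) (a b : α) (hp : p a = a) (hq : q a = a) (hab : a ≠ b) :
    x * x ^ cyc (p * swap a b * q) = x ^ cyc (p * q) := by
  rw [cyc_mul_comm, ← mul_assoc, mul_comm, ← pow_succ, cyc_swap _ _ _ (by simp [hp, hq]) hab,
    cyc_mul_comm]

lemma pow_swap2 (x : ℝ) (p q : Perm α) (a b b' : α) (hp : p a = a) (hq : q a = a) (hab : a ≠ b)
    (hab' : a ≠ b') (hbb : b ≠ b') :
    x * x ^ cyc (p * swap a b * (swap a b' * q)) = x ^ cyc (p * swap b b' * q) := by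
  have : swap a b * swap a b' = swap b b' * swap a b := by
    rw [Equiv.mul_swap_eq_swap_mul, swap_apply_of_ne_of_ne hab'.symm hbb.symm, swap_apply_left]
  have h2 : p * swap a b * (swap a b' * q) = (p * swap b b') * swap a b * q := by
    rw [mul_assoc p (swap b b'), ← this]
    simp only [mul_assoc]
  rw [h2]
  apply pow_swap _ _ _ _ _ _ hq hab
  simp [swap_apply_of_ne_of_ne hab hab', hp]

lemma SS_step (x : ℝ) (r c : α → ℕ) (hinj : ∀ a b, r a = r b → c a = c b → a = b)
    (s : Finset α) (a : α) (ha : a ∉ s)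
    (hcell : ∀ b' ∈ s, ∀ b'' ∈ s, r b' = r a → c b'' = c a → ∃ d ∈ s, r d = r b'' ∧ c d = c b')
    (hcr : (s.filter fun b => r b = r a).card = c a)
    (hcc : (s.filter fun b => c b = c a).card = r a) :
    x * SS x r c (insert a s) = (x + c a - r a) * SS x r c s := by
  have e1 : SS x r c (insert a s) = ∑ p ∈ GG r s, ∑ q ∈ GG c s,
      (sg q * x ^ cyc (p * q)
       + ∑ b ∈ s.filter (fun b => r b = r a), sg q * x ^ cyc (p * swap a b * q)
       + ∑ b ∈ s.filter (fun b => c b = c a), (-(sg q * x ^ cyc (p * swap a b * q)))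
       + ∑ b ∈ s.filter (fun b => r b = r a), ∑ b' ∈ s.filter (fun b => c b = c a),
          (-(sg q * x ^ cyc (p * swap a b * (swap a b' * q))))) := by
    rw [SS, GG_sum_insert _ _ _ ha]
    refine Finset.sum_congr rfl fun p hp => ?_
    simp only [GG_sum_insert' c s a ha]
    rw [Finset.sum_comm, ← Finset.sum_add_distrib]
    refine Finset.sum_congr rfl fun q hq => ?_
    have h0 : ∀ b ∈ s.filter (fun b => c b = c a), sg (swap a b * q) = - sg q := by
      intro b hb
      rw [sg_mul, sg_swap]
      · ring
      · rintro rfl; exact ha (Finset.mem_filter.1 hb).1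
    have h1 : ∀ P : Perm α, ∑ b ∈ s.filter (fun b => c b = c a),
        sg (swap a b * q) * x ^ cyc (P * (swap a b * q)) =
        ∑ b ∈ s.filter (fun b => c b = c a), (-(sg q * x ^ cyc (P * (swap a b * q)))) := by
      intro P
      refine Finset.sum_congr rfl fun b hb => ?_
      rw [h0 b hb]; ring
    simp only [h1, Finset.sum_add_distrib]
    simp only [← mul_assoc]
    ring
  rw [e1, Finset.mul_sum]
  have e2 : ∀ p ∈ GG r s, x * ∑ q ∈ GG c s,
      (sg q * x ^ cyc (p * q)
       + ∑ b ∈ s.filter (fun b => r b = r a), sg q * x ^ cyc (p * swap a b * q)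
       + ∑ b ∈ s.filter (fun b => c b = c a), (-(sg q * x ^ cyc (p * swap a b * q)))
       + ∑ b ∈ s.filter (fun b => r b = r a), ∑ b' ∈ s.filter (fun b => c b = c a),
          (-(sg q * x ^ cyc (p * swap a b * (swap a b' * q))))) =
      (x + c a - r a) * ∑ q ∈ GG c s, sg q * x ^ cyc (p * q) -
      ∑ b ∈ s.filter (fun b => r b = r a), ∑ b' ∈ s.filter (fun b => c b = c a),
        ∑ q ∈ GG c s, sg q * x ^ cyc (p * swap b b' * q) := by
    intro p hp
    have hpa := (mem_GG.1 hp).2 a ha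
    have : ∑ b ∈ s.filter (fun b => r b = r a), ∑ b' ∈ s.filter (fun b => c b = c a),
        ∑ q ∈ GG c s, sg q * x ^ cyc (p * swap b b' * q) =
        ∑ q ∈ GG c s, ∑ b ∈ s.filter (fun b => r b = r a),
          ∑ b' ∈ s.filter (fun b => c b = c a), sg q * x ^ cyc (p * swap b b' * q) := by
      symm
      rw [Finset.sum_comm]
      refine Finset.sum_congr rfl fun b hb => ?_
      rw [Finset.sum_comm]
    rw [this, Finset.mul_sum, Finset.mul_sum, ← Finset.sum_sub_distrib]
    refine Finset.sum_congr rfl fun q hq => ?_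
    have hqa := (mem_GG.1 hq).2 a ha
    have hne : ∀ b ∈ s, a ≠ b := by rintro b hb rfl; exact ha hb
    have t1 : ∀ b ∈ s, x * (sg q * x ^ cyc (p * swap a b * q)) = sg q * x ^ cyc (p * q) := by
      intro b hb
      rw [← pow_swap x p q a b hpa hqa (hne b hb)]; ring
    have t2 : x * ∑ b ∈ s.filter (fun b => r b = r a), sg q * x ^ cyc (p * swap a b * q)
        = c a * (sg q * x ^ cyc (p * q)) := by
      rw [Finset.mul_sum, Finset.sum_congr rfl fun b hb => t1 b (Finset.mem_filter.1 hb).1]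
      simp [hcr]
    have t3 : x * ∑ b ∈ s.filter (fun b => c b = c a), (-(sg q * x ^ cyc (p * swap a b * q)))
        = - (r a * (sg q * x ^ cyc (p * q))) := by
      rw [Finset.sum_neg_distrib, mul_neg, Finset.mul_sum,
        Finset.sum_congr rfl fun b hb => t1 b (Finset.mem_filter.1 hb).1]
      simp [hcc]
    have t4 : x * ∑ b ∈ s.filter (fun b => r b = r a), ∑ b' ∈ s.filter (fun b => c b = c a),
          (-(sg q * x ^ cyc (p * swap a b * (swap a b' * q)))) =
          - ∑ b ∈ s.filter (fun b => r b = r a),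
          ∑ b' ∈ s.filter (fun b => c b = c a), sg q * x ^ cyc (p * swap b b' * q) := by
      simp only [Finset.sum_neg_distrib, mul_neg, Finset.mul_sum]
      congr 1
      refine Finset.sum_congr rfl fun b hb => Finset.sum_congr rfl fun b' hb' => ?_
      rw [Finset.mem_filter] at hb hb'
      rw [← pow_swap2 x p q a b b' hpa hqa (hne b hb.1) (hne b' hb'.1)]
      · ring
      · rintro rfl
        exact ha (hinj _ _ hb.2 hb'.2 ▸ hb.1)
    rw [mul_add, mul_add, mul_add, t2, t3, t4]
    ring
  rw [Finset.sum_congr rfl e2, Finset.sum_sub_distrib, ← Finset.mul_sum, SS, sub_eq_self,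
    Finset.sum_comm]
  refine Finset.sum_eq_zero fun b hb => ?_
  rw [Finset.sum_comm]
  refine Finset.sum_eq_zero fun b' hb' => ?_
  rw [Finset.mem_filter] at hb hb'
  obtain ⟨d, hd, hd1, hd2⟩ := hcell b hb.1 b' hb'.1 hb.2 hb'.2
  refine cancel x r c s b b' d hb.1 hb'.1 hd hd1 hd2 ?_ ?_ ?_
  · rintro rfl
    have := hinj b' a (hd1.symm.trans hb.2) hb'.2
    exact ha (this ▸ hb'.1)
  · rintro rfl
    have := hinj b a hb.2 (hd2.symm.trans hb'.2)
    exact ha (this ▸ hb.1)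
  · rintro rfl
    exact ha (hinj _ _ hb.2 hb'.2 ▸ hb.1)

lemma SS_eq (x : ℝ) (hx : x ≠ 0) (r c : α → ℕ) (hinj : ∀ a b, r a = r b → c a = c b → a = b)
    (m : ℕ) : ∀ (s : Finset α), s.card = m →
    (∀ a ∈ s, ∀ i ≤ r a, ∀ j ≤ c a, ∃ b ∈ s, r b = i ∧ c b = j) →
    SS x r c s = x ^ (sᶜ).card * ∏ a ∈ s, (x + c a - r a) := by
  induction m with
  | zero =>
    intro s hs _
    rw [Finset.card_eq_zero] at hs
    subst hs
    have : ∀ k : α → ℕ, GG k ∅ = {1} := by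
      intro k
      ext p
      rw [mem_GG]
      simp only [Finset.notMem_empty, not_false_eq_true, forall_true_left, Finset.mem_singleton]
      constructor
      · intro h; ext a; exact h.2 a
      · rintro rfl; simp
    simp [SS, this, sg_one, cyc_one]
  | succ m ih =>
    intro s hs hlow
    have hne : s.Nonempty := by rw [← Finset.card_pos]; omega
    obtain ⟨a, has, hmax⟩ := s.exists_max_image (fun a => r a + c a) hne
    set t := s.erase a with ht
    have hat : a ∉ t := by simp [ht]
    have hst : insert a t = s := Finset.insert_erase has
    have hcorner : ∀ b ∈ s, r a ≤ r b → c a ≤ c b → b = a := by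
      intro b hb h1 h2
      have := hmax b hb
      exact hinj _ _ (by omega) (by omega)
    have hmt : ∀ b, b ∈ t ↔ b ≠ a ∧ b ∈ s := by simp [ht]
    have hlt : ∀ a' ∈ t, ∀ i ≤ r a', ∀ j ≤ c a', ∃ b ∈ t, r b = i ∧ c b = j := by
      intro a' ha' i hi j hj
      rw [hmt] at ha'
      obtain ⟨b, hb, h1, h2⟩ := hlow a' ha'.2 i hi j hj
      refine ⟨b, (hmt b).2 ⟨?_, hb⟩, h1, h2⟩
      rintro rfl
      exact ha'.1 (hcorner a' ha'.2 (by omega) (by omega))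
    have htc : t.card = m := by rw [ht, Finset.card_erase_of_mem has]; omega
    have key := SS_step x r c hinj t a hat ?_ ?_ ?_
    · rw [hst, ih t htc hlt] at key
      have hcard : (tᶜ).card = (sᶜ).card + 1 := by
        rw [Finset.card_compl, Finset.card_compl]
        have := s.card_le_univ
        omega
      rw [hcard] at key
      apply mul_left_cancel₀ hx
      rw [key, ← hst, Finset.prod_insert hat]
      ring
    · intro b' hb' b'' hb'' h1 h2
      rw [hmt] at hb' hb''
      have g1 : c b' < c a := by
        by_contra h
        exact hb'.1 (hcorner b' hb'.2 h1.ge (by omega))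
      have g2 : r b'' < r a := by
        by_contra h
        exact hb''.1 (hcorner b'' hb''.2 (by omega) h2.ge)
      obtain ⟨d, hd, h3, h4⟩ := hlow a has (r b'') g2.le (c b') g1.le
      refine ⟨d, (hmt d).2 ⟨?_, hd⟩, h3, h4⟩
      rintro rfl; omega
    · rw [← Finset.card_range (c a)]
      refine Finset.card_bij (fun b _ => c b) ?_ ?_ ?_
      · intro b hb
        rw [Finset.mem_filter, hmt] at hb
        rw [Finset.mem_range]
        by_contra h
        exact hb.1.1 (hcorner b hb.1.2 hb.2.ge (by omega))
      · intro b hb b' hb' h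
        rw [Finset.mem_filter] at hb hb'
        exact hinj _ _ (hb.2.trans hb'.2.symm) h
      · intro j hj
        rw [Finset.mem_range] at hj
        obtain ⟨d, hd, h3, h4⟩ := hlow a has (r a) le_rfl j hj.le
        refine ⟨d, ?_, h4⟩
        rw [Finset.mem_filter, hmt]
        exact ⟨⟨by rintro rfl; omega, hd⟩, h3⟩
    · rw [← Finset.card_range (r a)]
      refine Finset.card_bij (fun b _ => r b) ?_ ?_ ?_
      · intro b hb
        rw [Finset.mem_filter, hmt] at hb
        rw [Finset.mem_range]
        by_contra h
        exact hb.1.1 (hcorner b hb.1.2 (by omega) hb.2.ge)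
      · intro b hb b' hb' h
        rw [Finset.mem_filter] at hb hb'
        exact hinj _ _ h (hb.2.trans hb'.2.symm)
      · intro j hj
        rw [Finset.mem_range] at hj
        obtain ⟨d, hd, h3, h4⟩ := hlow a has j hj.le (c a) le_rfl
        refine ⟨d, ?_, h3⟩
        rw [Finset.mem_filter, hmt]
        exact ⟨⟨by rintro rfl; omega, hd⟩, h4⟩

end content

section vonNeumann
variable {α : Type*} [Fintype α] [DecidableEq α]

lemma von_neumann (r c : α → ℕ) (hinj : ∀ a b, r a = r b → c a = c b → a = b)
    (hlow : ∀ a, ∀ i ≤ r a, ∀ j ≤ c a, ∃ b, r b = i ∧ c b = j) (g : Perm α)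
    (hg : ∀ a b, a ≠ b → r a = r b → c (g⁻¹ a) ≠ c (g⁻¹ b)) :
    ∃ p ∈ GG r Finset.univ, ∃ q ∈ GG c Finset.univ, g = p * q := by
  have hle : ∀ k i, (Finset.univ.filter fun a => r a = i ∧ c (g⁻¹ a) < k).card ≤
      (Finset.univ.filter fun a => r a = i ∧ c a < k).card := by
    intro k i
    by_cases h : ∃ a0, r a0 = i ∧ k ≤ c a0
    · obtain ⟨a0, h1, h2⟩ := h
      calc _ ≤ (Finset.range k).card := by
            refine Finset.card_le_card_of_injOn (fun a => c (g⁻¹ a)) ?_ ?_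
            · intro a ha; simp at ha; simp [ha.2]
            · intro a ha b hb hab
              simp at ha hb
              by_contra hne
              exact hg a b hne (ha.1.trans hb.1.symm) hab
        _ ≤ _ := by
            have : Finset.range k ⊆ (Finset.univ.filter fun a => r a = i ∧ c a < k).image c := by
              intro j hj
              rw [Finset.mem_range] at hj
              obtain ⟨b, hb1, hb2⟩ := hlow a0 i h1.ge j (by omega)
              rw [Finset.mem_image]
              exact ⟨b, by simp [hb1, hb2, hj], hb2⟩
            exact (Finset.card_le_card this).trans Finset.card_image_le
    · push Not at h
      apply Finset.card_le_card
      intro a ha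
      simp at ha ⊢
      exact ⟨ha.1, h a ha.1⟩
  have hsum : ∀ k, (Finset.univ.filter fun a => c (g⁻¹ a) < k).card =
      (Finset.univ.filter fun a => c a < k).card := by
    intro k
    refine Finset.card_bij (fun a _ => g⁻¹ a) ?_ ?_ ?_
    · intro a ha; simpa using ha
    · intro a _ b _ h; exact g⁻¹.injective h
    · intro b hb; exact ⟨g b, by simpa using hb, by simp⟩
  have hfib : ∀ (P : α → Prop) [DecidablePred P], (Finset.univ.filter P).card =
      ∑ i ∈ Finset.univ.image r, (Finset.univ.filter fun a => r a = i ∧ P a).card := by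
    intro P _
    rw [Finset.card_eq_sum_card_fiberwise (f := r) (t := Finset.univ.image r)]
    · refine Finset.sum_congr rfl fun i _ => ?_
      congr 1
      ext a
      simp [and_comm]
    · intro a _; simp
  have heq : ∀ k, ∀ i ∈ Finset.univ.image r,
      (Finset.univ.filter fun a => r a = i ∧ c (g⁻¹ a) < k).card =
      (Finset.univ.filter fun a => r a = i ∧ c a < k).card := by
    intro k
    rw [← Finset.sum_eq_sum_iff_of_le fun i _ => hle k i]
    rw [← hfib, ← hfib, hsum]
  have hex : ∀ a, ∃ b, r b = r a ∧ c b = c (g⁻¹ a) := by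
    intro a
    by_contra hno
    have hall : ∀ b, r b = r a → c b < c (g⁻¹ a) := by
      intro b hb
      by_contra h
      obtain ⟨d, hd⟩ := hlow b (r a) hb.ge (c (g⁻¹ a)) (by omega)
      exact hno ⟨d, hd⟩
    have h1 := heq (c (g⁻¹ a)) (r a) (by simp)
    have h2 : (Finset.univ.filter fun b => r b = r a ∧ c (g⁻¹ b) < c (g⁻¹ a)) ⊆
      (Finset.univ.filter fun b => r b = r a ∧ c b < c (g⁻¹ a)) := by
      intro b hb
      simp only [Finset.mem_filter, Finset.mem_univ, true_and] at hb ⊢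
      exact ⟨hb.1, hall b hb.1⟩
    have h3 := Finset.eq_of_subset_of_card_le h2 h1.ge
    have h4 : a ∈ (Finset.univ.filter fun b => r b = r a ∧ c b < c (g⁻¹ a)) := by
      simp only [Finset.mem_filter, Finset.mem_univ, true_and]
      exact hall a rfl
    rw [← h3] at h4
    simp at h4
  choose f hf1 hf2 using hex
  have finj : Function.Injective f := by
    intro a b hab
    by_contra hne
    refine hg a b hne ?_ ?_
    · rw [← hf1 a, ← hf1 b, hab]
    · rw [← hf2 a, ← hf2 b, hab]
  let F : Perm α := Equiv.ofBijective f (Finite.injective_iff_bijective.1 finj)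
  have hFr : F ∈ GG r Finset.univ := mem_GG.2 ⟨hf1, by simp⟩
  refine ⟨F⁻¹, GG_inv hFr, F * g, mem_GG.2 ⟨fun a => ?_, by simp⟩, by simp⟩
  have := hf2 (g a)
  rw [show g⁻¹ (g a) = a from g.symm_apply_apply a] at this
  exact this

end vonNeumann

section young
variable {α : Type*} [Fintype α] [DecidableEq α]

/-- A tableau shape labelling. -/
structure Tab (r c : α → ℕ) : Prop where
  inj : ∀ a b, r a = r b → c a = c b → a = b
  low : ∀ a, ∀ i ≤ r a, ∀ j ≤ c a, ∃ b, r b = i ∧ c b = j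

/-- sign-equivariance -/
def IsY (r c : α → ℕ) (y : MonoidAlgebra ℝ (Perm α)) : Prop :=
  (∀ p ∈ GG r Finset.univ, ∀ g, y.coeff (p * g) = y.coeff g) ∧
  (∀ q ∈ GG c Finset.univ, ∀ g, y.coeff (g * q) = sg q * y.coeff g)

lemma IsY.eq {r c : α → ℕ} (h : Tab r c) {y y' : MonoidAlgebra ℝ (Perm α)}
    (hy : IsY r c y) (hy' : IsY r c y') (h1 : y'.coeff 1 = 1) : y = y.coeff 1 • y' := by
  have hz : ∀ g : Perm α, (¬ ∃ p ∈ GG r Finset.univ, ∃ q ∈ GG c Finset.univ, g = p * q) →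
      ∀ y, IsY r c y → y.coeff g = 0 := by
    intro g hg y hy
    have : ∃ a b, a ≠ b ∧ r a = r b ∧ c (g⁻¹ a) = c (g⁻¹ b) := by
      by_contra hcon
      push Not at hcon
      exact hg (von_neumann r c h.inj h.low g hcon)
    obtain ⟨a, b, hab, hr, hc⟩ := this
    have e1 := hy.1 (swap a b) (GG_swap (Finset.mem_univ _) (Finset.mem_univ _) hr) g
    have e2 := hy.2 (swap (g⁻¹ a) (g⁻¹ b)) (GG_swap (Finset.mem_univ _) (Finset.mem_univ _) hc) g
    rw [sg_swap (fun h => hab (g⁻¹.injective h)), ← Equiv.swap_mul_eq_mul_swap, e1] at e2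
    linarith
  ext g
  rw [MonoidAlgebra.coeff_smul_apply, smul_eq_mul]
  by_cases hg : ∃ p ∈ GG r Finset.univ, ∃ q ∈ GG c Finset.univ, g = p * q
  · obtain ⟨p, hp, q, hq, rfl⟩ := hg
    have e : ∀ y, IsY r c y → y.coeff (p * q) = sg q * y.coeff 1 := by
      intro y hy
      rw [hy.1 p hp, ← hy.2 q hq, one_mul]
    rw [e y hy, e y' hy', h1]
    ring
  · rw [hz g hg y hy, hz g hg y' hy', mul_zero]

/-- Young symmetrizer -/
noncomputable def YS (r c : α → ℕ) : MonoidAlgebra ℝ (Perm α) :=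
  ∑ p ∈ GG r Finset.univ, ∑ q ∈ GG c Finset.univ, MonoidAlgebra.single (p * q) (sg q)

lemma isY_iff {r c : α → ℕ} {y : MonoidAlgebra ℝ (Perm α)} : IsY r c y ↔
    (∀ p ∈ GG r Finset.univ, MonoidAlgebra.single p (1 : ℝ) * y = y) ∧
    (∀ q ∈ GG c Finset.univ, y * MonoidAlgebra.single q (1 : ℝ) = sg q • y) := by
  constructor
  · intro h
    refine ⟨fun p hp => ?_, fun q hq => ?_⟩
    · ext g
      rw [MonoidAlgebra.coeff_single_mul_apply, one_mul, h.1 _ (GG_inv hp)]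
    · ext g
      rw [MonoidAlgebra.coeff_mul_single_apply, mul_one, h.2 _ (GG_inv hq),
        MonoidAlgebra.coeff_smul_apply, smul_eq_mul]
      simp [sg]
  · intro h
    refine ⟨fun p hp g => ?_, fun q hq g => ?_⟩
    · have := congrArg (fun y => y.coeff g) (h.1 _ (GG_inv hp))
      simpa only [MonoidAlgebra.coeff_single_mul_apply, one_mul, inv_inv] using this
    · have := congrArg (fun y => y.coeff (g * q)) (h.2 q hq)
      simp only [MonoidAlgebra.coeff_mul_single_apply, mul_one, mul_inv_cancel_right,
        MonoidAlgebra.coeff_smul_apply, smul_eq_mul] at this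
      rw [this, ← mul_assoc, sg_mul_self, one_mul]

lemma YS_isY (r c : α → ℕ) : IsY r c (YS r c) := by
  rw [isY_iff]
  constructor
  · intro p hp
    rw [YS, Finset.mul_sum]
    refine Finset.sum_bij' (fun x _ => p * x) (fun x _ => p⁻¹ * x) (fun x hx => GG_mul hp hx)
      (fun x hx => GG_mul (GG_inv hp) hx) (by simp) (by simp) ?_
    intro x hx
    rw [Finset.mul_sum]
    refine Finset.sum_congr rfl fun q _ => ?_
    rw [MonoidAlgebra.single_mul_single, one_mul, mul_assoc]
  · intro q hq
    rw [YS, Finset.sum_mul, Finset.smul_sum]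
    refine Finset.sum_congr rfl fun p _ => ?_
    rw [Finset.sum_mul, Finset.smul_sum]
    refine Finset.sum_bij' (fun x _ => x * q) (fun x _ => x * q⁻¹) (fun x hx => GG_mul hx hq)
      (fun x hx => GG_mul hx (GG_inv hq)) (by simp) (by simp) ?_
    intro x hx
    rw [MonoidAlgebra.single_mul_single, mul_one, mul_assoc, MonoidAlgebra.smul_single, sg_mul,
      smul_eq_mul, mul_comm (sg x), ← mul_assoc (sg q), sg_mul_self, one_mul]

lemma YS_one {r c : α → ℕ} (h : Tab r c) : (YS r c).coeff 1 = 1 := by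
  have h1 : (1 : Perm α) ∈ GG r Finset.univ := mem_GG.2 (by simp)
  have h2 : (1 : Perm α) ∈ GG c Finset.univ := mem_GG.2 (by simp)
  have key : ∀ p ∈ GG r Finset.univ, ∀ q ∈ GG c Finset.univ, p * q = 1 → p = 1 ∧ q = 1 := by
    intro p hp q hq hpq
    have hpq' : p = q⁻¹ := eq_inv_of_mul_eq_one_left hpq
    have hp1 : p = 1 := by
      ext a
      apply h.inj
      · exact (mem_GG.1 hp).1 a
      · rw [hpq']; exact (mem_GG.1 (GG_inv hq)).1 a
    subst hp1
    exact ⟨rfl, by simpa using hpq⟩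
  simp only [YS, MonoidAlgebra.coeff_sum, Finsupp.coe_finsetSum, Finset.sum_apply,
    MonoidAlgebra.coeff_single_apply]
  rw [Finset.sum_eq_single_of_mem 1 h1, Finset.sum_eq_single_of_mem 1 h2]
  · simp [sg_one]
  · intro q hq hne
    rw [if_neg]
    intro h; exact hne (key 1 h1 q hq h).2
  · intro p hp hne
    refine Finset.sum_eq_zero fun q hq => ?_
    rw [if_neg]
    intro h; exact hne (key p hp q hq h).1

noncomputable abbrev ZZ (α : Type*) := Subalgebra.center ℝ (MonoidAlgebra ℝ (Perm α))

lemma central_mul {r c : α → ℕ} (h : Tab r c) (z : MonoidAlgebra ℝ (Perm α)) (hz : z ∈ ZZ α) :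
    z * YS r c = (z * YS r c).coeff 1 • YS r c := by
  refine IsY.eq h ?_ (YS_isY r c) (YS_one h)
  have hy := isY_iff.1 (YS_isY r c)
  rw [Subalgebra.mem_center_iff] at hz
  rw [isY_iff]
  refine ⟨fun p hp => ?_, fun q hq => ?_⟩
  · rw [← mul_assoc, hz, mul_assoc, hy.1 p hp]
  · rw [mul_assoc, hy.2 q hq, mul_smul_comm]

/-- central character -/
noncomputable def om {r c : α → ℕ} (h : Tab r c) : ZZ α →ₐ[ℝ] ℝ :=
  AlgHom.ofLinearMap
    { toFun := fun z => ((z : MonoidAlgebra ℝ (Perm α)) * YS r c).coeff 1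
      map_add' := fun x y => by simp [add_mul]
      map_smul' := fun a x => by simp }
    (by simp [YS_one h])
    (by
      intro x y
      simp only [LinearMap.coe_mk, AddHom.coe_mk]
      rw [MulMemClass.coe_mul, mul_assoc, central_mul h y.1 y.2, mul_smul_comm,
        MonoidAlgebra.coeff_smul_apply, smul_eq_mul, mul_comm]
      simp only [MonoidAlgebra.coeff_smul_apply, smul_eq_mul, YS_one h, mul_one])

lemma om_apply {r c : α → ℕ} (h : Tab r c) (z : ZZ α) :
    om h z = ((z : MonoidAlgebra ℝ (Perm α)) * YS r c).coeff 1 := rfl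

lemma mem_ZZ {z : MonoidAlgebra ℝ (Perm α)} :
    z ∈ ZZ α ↔ ∀ h g : Perm α, z.coeff (h * g) = z.coeff (g * h) := by
  rw [Subalgebra.mem_center_iff]
  constructor
  · intro hz h g
    have := congrArg (fun y => y.coeff (g * h * g)) (hz (MonoidAlgebra.single g 1))
    simp only [MonoidAlgebra.coeff_single_mul_apply, MonoidAlgebra.coeff_mul_single_apply] at this
    simpa [mul_assoc] using this
  · intro hz b
    induction b using MonoidAlgebra.induction_linear with
    | zero => simp
    | add x y hx hy => rw [add_mul, mul_add, hx, hy]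
    | single g a =>
      ext k
      rw [MonoidAlgebra.coeff_single_mul_apply, MonoidAlgebra.coeff_mul_single_apply, hz, mul_comm]

/-- the central element -/
noncomputable def PhiA (α : Type*) [Fintype α] [DecidableEq α] (x : ℝ) :
    MonoidAlgebra ℝ (Perm α) :=
  MonoidAlgebra.ofCoeff (Finsupp.equivFunOnFinite.symm fun g => x ^ cyc g)

lemma PhiA_coeff (x : ℝ) (g : Perm α) : (PhiA α x).coeff g = x ^ cyc g := rfl

/-- the central element -/
noncomputable def Phi (α : Type*) [Fintype α] [DecidableEq α] (x : ℝ) : ZZ α :=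
  ⟨PhiA α x, by
    rw [mem_ZZ]; intro h g; rw [PhiA_coeff, PhiA_coeff, cyc_mul_comm]⟩

lemma om_Phi {r c : α → ℕ} (h : Tab r c) (x : ℝ) (hx : x ≠ 0) :
    om h (Phi α x) = ∏ a, (x + c a - r a) := by
  have := SS_eq x hx r c h.inj _ Finset.univ rfl (by
    intro a _ i hi j hj
    obtain ⟨b, hb⟩ := h.low a i hi j hj
    exact ⟨b, Finset.mem_univ _, hb⟩)
  simp only [Finset.compl_univ, Finset.card_empty, pow_zero, one_mul] at this
  rw [← this, om_apply, YS, SS, Finset.mul_sum]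
  simp only [Finset.mul_sum, MonoidAlgebra.coeff_sum, Finsupp.coe_finsetSum, Finset.sum_apply]
  refine Finset.sum_congr rfl fun p _ => Finset.sum_congr rfl fun q _ => ?_
  rw [MonoidAlgebra.coeff_mul_single_apply, one_mul]
  change (PhiA α x).coeff _ * _ = _
  rw [PhiA_coeff, cyc_inv, mul_comm]

end young

section trace
variable {α : Type*} [Fintype α] [DecidableEq α]

lemma finrank_ZZ_le : Module.finrank ℝ (ZZ α) ≤ Fintype.card (Fintype.card α).Partition := by
  classical
  let rep : (Fintype.card α).Partition → Perm α := fun l =>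
    if h : ∃ g : Perm α, g.partition = l then h.choose else 1
  have hrep : ∀ g : Perm α, IsConj g (rep g.partition) := by
    intro g
    have h : ∃ g' : Perm α, g'.partition = g.partition := ⟨g, rfl⟩
    rw [Perm.partition_eq_of_isConj]
    simp only [rep, dif_pos h]
    exact h.choose_spec.symm
  let F : ZZ α →ₗ[ℝ] ((Fintype.card α).Partition → ℝ) :=
    { toFun := fun z l => z.1.coeff (rep l)
      map_add' := fun x y => by ext l; simp
      map_smul' := fun a x => by ext l; simp }
  have hF : Function.Injective F := by
    intro x y hxy
    ext g
    have hcl : ∀ z : ZZ α, z.1.coeff g = z.1.coeff (rep g.partition) := by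
      intro z
      obtain ⟨k, hk⟩ := isConj_iff.1 (hrep g)
      rw [← hk, mem_ZZ.1 z.2]
      simp
    rw [hcl, hcl]
    exact congrFun hxy g.partition
  have := LinearMap.finrank_le_finrank_of_injective hF
  simpa using this

lemma trace_ZZ {T : Type*} [Fintype T] (hT : Fintype.card T = Fintype.card (Fintype.card α).Partition)
    (ω : T → (ZZ α →ₐ[ℝ] ℝ)) (hω : Function.Injective ω) (z : ZZ α) :
    LinearMap.trace ℝ (ZZ α) (LinearMap.mulLeft ℝ z) = ∑ t, ω t z := by
  classical
  have hli : LinearIndependent ℝ (fun t => ((ω t).toLinearMap : Module.Dual ℝ (ZZ α))) :=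
    (linearIndependent_algHom_toLinearMap ℝ (ZZ α) ℝ).comp ω hω
  have hfin : Module.finrank ℝ (Module.Dual ℝ (ZZ α)) = Module.finrank ℝ (ZZ α) :=
    Subspace.dual_finrank_eq
  have h1 : Fintype.card T ≤ Module.finrank ℝ (Module.Dual ℝ (ZZ α)) :=
    hli.fintype_card_le_finrank
  have h2 := finrank_ZZ_le (α := α)
  have hcard : Fintype.card T = Module.finrank ℝ (Module.Dual ℝ (ZZ α)) := by omega
  by_cases hne : Nonempty T
  · let b := basisOfLinearIndependentOfCardEqFinrank hli hcard
    have hb : ∀ t, b t = (ω t).toLinearMap := fun t => by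
      simp [b]
    rw [← LinearMap.trace_transpose', LinearMap.trace_eq_matrix_trace ℝ b, Matrix.trace]
    refine Finset.sum_congr rfl fun t _ => ?_
    rw [Matrix.diag_apply, LinearMap.toMatrix_apply]
    have : Module.Dual.transpose (R := ℝ) (LinearMap.mulLeft ℝ z) (b t) = ω t z • b t := by
      rw [hb]
      ext y
      simp [Module.Dual.transpose_apply]
    rw [this]
    simp
  · exfalso
    rw [not_nonempty_iff] at hne
    have h3 : Fintype.card T = 0 := Fintype.card_eq_zero
    have : Nonempty (Fintype.card α).Partition := ⟨(1 : Perm α).partition⟩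
    have h4 : 0 < Fintype.card (Fintype.card α).Partition := Fintype.card_pos
    omega

/-- averaged conjugation followed by multiplication -/
noncomputable def MM (z : MonoidAlgebra ℝ (Perm α)) :
    MonoidAlgebra ℝ (Perm α) →ₗ[ℝ] MonoidAlgebra ℝ (Perm α) :=
  ∑ σ : Perm α, LinearMap.mulLeft ℝ z ∘ₗ LinearMap.mulLeft ℝ (MonoidAlgebra.single σ 1) ∘ₗ
    LinearMap.mulRight ℝ (MonoidAlgebra.single σ⁻¹ 1)

lemma MM_apply (z y : MonoidAlgebra ℝ (Perm α)) : MM z y =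
    z * ∑ σ : Perm α, MonoidAlgebra.single σ 1 * (y * MonoidAlgebra.single σ⁻¹ 1) := by
  simp [MM, Finset.mul_sum]

lemma MM_mem (z y : MonoidAlgebra ℝ (Perm α)) (hz : z ∈ ZZ α) : MM z y ∈ ZZ α := by
  rw [MM_apply]
  refine Subalgebra.mul_mem _ hz ?_
  rw [mem_ZZ]
  intro h g
  simp only [MonoidAlgebra.coeff_sum, Finsupp.coe_finsetSum, Finset.sum_apply,
    MonoidAlgebra.coeff_single_mul_apply, MonoidAlgebra.coeff_mul_single_apply, one_mul, mul_one,
    inv_inv]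
  refine Fintype.sum_equiv (Equiv.mulLeft h⁻¹) _ _ fun σ => ?_
  simp [mul_assoc]

lemma MM_central (z y : MonoidAlgebra ℝ (Perm α)) (hy : y ∈ ZZ α) :
    MM z y = ((Fintype.card α).factorial : ℝ) • (z * y) := by
  rw [Subalgebra.mem_center_iff] at hy
  rw [MM_apply]
  have : ∀ σ : Perm α, MonoidAlgebra.single σ (1 : ℝ) * (y * MonoidAlgebra.single σ⁻¹ 1) = y := by
    intro σ
    rw [← mul_assoc, hy, mul_assoc, MonoidAlgebra.single_mul_single]
    simp [← MonoidAlgebra.one_def]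
  simp only [this]
  rw [Finset.sum_const, Finset.card_univ, Fintype.card_perm, mul_smul_comm, Nat.cast_smul_eq_nsmul]

lemma MM_trace (x : ℝ) : LinearMap.trace ℝ _ (MM (PhiA α x)) =
    ∑ σ : Perm α, ∑ τ : Perm α, x ^ cyc (σ * τ * σ⁻¹ * τ⁻¹) := by
  rw [LinearMap.trace_eq_matrix_trace ℝ (MonoidAlgebra.basis (Perm α) ℝ), Matrix.trace]
  refine Finset.sum_congr rfl fun σ _ => ?_
  rw [Matrix.diag_apply, LinearMap.toMatrix_apply]
  change (MM (PhiA α x) (MonoidAlgebra.single σ 1)).coeff σ = _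
  rw [MM_apply, Finset.mul_sum]
  simp only [MonoidAlgebra.coeff_sum, Finsupp.coe_finsetSum, Finset.sum_apply]
  refine Finset.sum_congr rfl fun τ _ => ?_
  rw [MonoidAlgebra.single_mul_single, MonoidAlgebra.single_mul_single,
    MonoidAlgebra.coeff_mul_single_apply, PhiA_coeff]
  simp [mul_assoc]

lemma main_trace {T : Type*} [Fintype T]
    (hT : Fintype.card T = Fintype.card (Fintype.card α).Partition)
    (ω : T → (ZZ α →ₐ[ℝ] ℝ)) (hω : Function.Injective ω) (x : ℝ) :
    ∑ σ : Perm α, ∑ τ : Perm α, x ^ cyc (σ * τ * σ⁻¹ * τ⁻¹) =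
    ((Fintype.card α).factorial : ℝ) * ∑ t, ω t (Phi α x) := by
  have hPhi : PhiA α x ∈ ZZ α := (Phi α x).2
  have hfree : Module.Finite ℝ (MonoidAlgebra ℝ (Perm α)) :=
    Module.Finite.of_basis (MonoidAlgebra.basis (Perm α) ℝ)
  rw [← MM_trace, ← trace_ZZ hT ω hω,
    ← LinearMap.trace_restrict_eq_of_forall_mem (Subalgebra.toSubmodule (ZZ α)) (MM (PhiA α x))
      (fun y => MM_mem _ y hPhi), ← smul_eq_mul, ← map_smul]
  change LinearMap.trace ℝ (ZZ α) _ = _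
  congr 1
  ext y : 1
  apply Subtype.ext
  change MM (PhiA α x) y.1 = _
  rw [MM_central _ _ y.2]
  rfl

end trace

section parts

lemma partSorted {n : ℕ} (lam : Nat.Partition n) : (lam.parts.sort (· ≥ ·)).SortedGE :=
  (Multiset.pairwise_sort _ _).sortedGE

/-- Young diagram of a partition -/
def yd {n : ℕ} (lam : Nat.Partition n) : YoungDiagram :=
  YoungDiagram.ofRowLens (lam.parts.sort (· ≥ ·)) (partSorted lam)

lemma yd_inj {n : ℕ} : Function.Injective (yd (n := n)) := by
  intro l l' h
  have hpos : ∀ l : Nat.Partition n, ∀ x ∈ l.parts.sort (· ≥ ·), 0 < x := by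
    intro l x hx
    exact l.parts_pos (by simpa using hx)
  have h2 := congrArg YoungDiagram.rowLens h
  rw [yd, yd, YoungDiagram.rowLens_ofRowLens_eq_self (hpos l),
    YoungDiagram.rowLens_ofRowLens_eq_self (hpos l')] at h2
  have h3 := congrArg (fun L : List ℕ => (L : Multiset ℕ)) h2
  simp only [Multiset.sort_eq] at h3
  exact Nat.Partition.ext h3

lemma mem_yd {n : ℕ} (lam : Nat.Partition n) (p : ℕ × ℕ) : p ∈ (yd lam).cells ↔
    p.1 ∈ Finset.range (lam.parts.sort (· ≥ ·)).length ∧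
    p.2 ∈ Finset.range ((lam.parts.sort (· ≥ ·)).getD p.1 0) := by
  rw [YoungDiagram.mem_cells, yd, YoungDiagram.mem_ofRowLens]
  simp only [Finset.mem_range]
  constructor
  · rintro ⟨h1, h2⟩
    refine ⟨h1, ?_⟩
    rwa [List.getD_eq_getElem _ _ h1]
  · rintro ⟨h1, h2⟩
    refine ⟨h1, ?_⟩
    rwa [List.getD_eq_getElem _ _ h1] at h2

lemma contentProd_eq {n : ℕ} (lam : Nat.Partition n) (q : ℝ) :
    contentProd q lam = ∏ p ∈ (yd lam).cells, (q + (p.2 : ℝ) - (p.1 : ℝ)) := by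
  rw [Finset.prod_finset_product _ (Finset.range (lam.parts.sort (· ≥ ·)).length)
    (fun a => Finset.range ((lam.parts.sort (· ≥ ·)).getD a 0)) (mem_yd lam)]
  rfl

lemma sum_getD (L : List ℕ) : ∑ a ∈ Finset.range L.length, L.getD a 0 = L.sum := by
  induction L with
  | nil => simp
  | cons x L ih =>
    rw [List.length_cons, Finset.sum_range_succ', List.sum_cons, ← ih, add_comm]
    simp

lemma card_yd {n : ℕ} (lam : Nat.Partition n) : (yd lam).cells.card = n := by
  rw [Finset.card_eq_sum_ones, Finset.sum_finset_product _ (Finset.range (lam.parts.sort (· ≥ ·)).length)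
    (fun a => Finset.range ((lam.parts.sort (· ≥ ·)).getD a 0)) (mem_yd lam)]
  simp only [Finset.sum_const, Finset.card_range, smul_eq_mul, mul_one]
  have h1 : (lam.parts.sort (· ≥ ·)).sum = n := by
    rw [← Multiset.sum_coe, Multiset.sort_eq, lam.parts_sum]
  conv_rhs => rw [← h1]
  exact sum_getD _

lemma yd_le (μ ν : YoungDiagram)
    (h : μ.cells.val.map (fun p => ((p.1 : ℝ) - p.2)) = ν.cells.val.map (fun p => ((p.1 : ℝ) - p.2))) :
    μ ≤ ν := by
  classical
  rw [← YoungDiagram.cells_subset_iff]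
  intro p hp
  by_contra hq
  have hcount := congrArg (Multiset.count ((p.1 : ℝ) - p.2)) h
  rw [Multiset.count_map, Multiset.count_map] at hcount
  have : (ν.cells.filter fun a : ℕ × ℕ => (p.1 : ℝ) - p.2 = (a.1 : ℝ) - a.2) ⊂
      (μ.cells.filter fun a : ℕ × ℕ => (p.1 : ℝ) - p.2 = (a.1 : ℝ) - a.2) := by
    rw [Finset.ssubset_iff_of_subset]
    · refine ⟨p, by simpa using hp, fun h => hq (Finset.mem_filter.1 h).1⟩
    · rintro ⟨i, j⟩ ha
      rw [Finset.mem_filter] at ha ⊢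
      refine ⟨?_, ha.2⟩
      have h3 : (p.1 : ℝ) + j = i + p.2 := by have := ha.2; simp only at this; linarith
      have h4 : p.1 + j = i + p.2 := by exact_mod_cast h3
      rcases lt_or_ge i p.1 with hlt | hge
      · exact μ.up_left_mem (i2 := p.1) (j2 := p.2) hlt.le (by omega) hp
      · exact absurd (ν.up_left_mem (i1 := p.1) (j1 := p.2) hge (by omega) ha.1) hq
  have hlt := Finset.card_lt_card this
  simp only [Finset.card_def, Finset.filter_val] at hlt
  omega

lemma yd_eq_of_prod (μ ν : YoungDiagram)
    (h : ∀ x : ℝ, x ≠ 0 → ∏ p ∈ μ.cells, (x + (p.2 : ℝ) - (p.1 : ℝ)) =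
      ∏ p ∈ ν.cells, (x + (p.2 : ℝ) - (p.1 : ℝ))) : μ = ν := by
  let P : YoungDiagram → Polynomial ℝ := fun μ =>
    ((μ.cells.val.map (fun p => ((p.1 : ℝ) - p.2))).map
      (fun a => Polynomial.X - Polynomial.C a)).prod
  have hP : ∀ μ, ∀ x, (P μ).eval x = ∏ p ∈ μ.cells, (x + (p.2 : ℝ) - (p.1 : ℝ)) := by
    intro μ x
    simp only [P, Multiset.map_map, Function.comp_def]
    change (∏ p ∈ μ.cells, (Polynomial.X - Polynomial.C ((p.1 : ℝ) - p.2))).eval x = _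
    rw [Polynomial.eval_prod]
    refine Finset.prod_congr rfl fun p _ => ?_
    simp only [Polynomial.eval_sub, Polynomial.eval_X, Polynomial.eval_C]
    ring
  have hPP : P μ = P ν := by
    apply Polynomial.eq_of_infinite_eval_eq
    refine Set.Infinite.mono (s := {0}ᶜ) ?_ (Set.finite_singleton (0 : ℝ)).infinite_compl
    intro x hx
    simp only [Set.mem_ofPred_eq, hP]
    exact h x hx
  have hr := congrArg Polynomial.roots hPP
  simp only [P, Polynomial.roots_multiset_prod_X_sub_C] at hr
  exact le_antisymm (yd_le _ _ hr) (yd_le _ _ hr.symm)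

/-- labelling of the cells -/
noncomputable def ee {n : ℕ} (lam : Nat.Partition n) : Fin n ≃ (yd lam).cells :=
  (Finset.equivFinOfCardEq (card_yd lam)).symm

lemma tab {n : ℕ} (lam : Nat.Partition n) :
    Tab (fun i => (ee lam i).1.1) (fun i => (ee lam i).1.2) where
  inj a b h1 h2 := (ee lam).injective (Subtype.ext (Prod.ext h1 h2))
  low a i hi j hj := by
    have h : (i, j) ∈ (yd lam).cells :=
      (yd lam).up_left_mem (i2 := (ee lam a).1.1) (j2 := (ee lam a).1.2) hi hj (ee lam a).2
    exact ⟨(ee lam).symm ⟨(i, j), h⟩, by simp, by simp⟩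

lemma om_tab {n : ℕ} (lam : Nat.Partition n) (x : ℝ) (hx : x ≠ 0) :
    om (tab lam) (Phi (Fin n) x) = ∏ p ∈ (yd lam).cells, (x + (p.2 : ℝ) - (p.1 : ℝ)) := by
  rw [om_Phi _ _ hx, ← Finset.prod_coe_sort (yd lam).cells (fun p => (x + (p.2 : ℝ) - (p.1 : ℝ)))]
  exact Fintype.prod_equiv (ee lam) _ _ fun i => rfl

lemma om_tab_inj {n : ℕ} : Function.Injective (fun lam : Nat.Partition n => om (tab lam)) := by
  intro l l' h
  apply yd_inj
  apply yd_eq_of_prod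
  intro x hx
  rw [← om_tab l x hx, ← om_tab l' x hx]
  exact congrArg (fun f => f (Phi (Fin n) x)) h

end parts

/-- Generating function of the number of cycles of a random commutator:
`Σ_{σ,τ ∈ S_n} q^{C([σ,τ])} = n! Σ_{λ ⊢ n} Π_{r ∈ λ} (q + cont(r))`. -/
theorem commutator_cycle_generating_function (n : ℕ) (hn : 1 ≤ n) (q : ℝ) :
    ∑ σ : Equiv.Perm (Fin n), ∑ τ : Equiv.Perm (Fin n),
        q ^ numCycles (σ * τ * σ⁻¹ * τ⁻¹)
      = (n.factorial : ℝ) * ∑ lam : Nat.Partition n, contentProd q lam := by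
  by_cases hq : q = 0
  · subst hq
    have h1 : ∀ lam : Nat.Partition n, contentProd 0 lam = 0 := by
      intro lam
      rw [contentProd_eq]
      have hne : (yd lam).cells.Nonempty := by rw [← Finset.card_pos, card_yd]; omega
      obtain ⟨p, hp⟩ := hne
      refine Finset.prod_eq_zero (i := (0, 0)) ?_ (by simp)
      exact (yd lam).up_left_mem (i2 := p.1) (j2 := p.2) (Nat.zero_le _) (Nat.zero_le _) hp
    have h2 : ∀ g : Equiv.Perm (Fin n), numCycles g ≠ 0 := by
      intro g
      rw [numCycles_eq, cyc]
      have : Nonempty (Quotient (Perm.SameCycle.setoid g)) := ⟨Quotient.mk _ ⟨0, hn⟩⟩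
      exact Nat.card_pos.ne'
    simp [h1, h2]
  · have h := main_trace (α := Fin n) (T := Nat.Partition n) (by rw [Fintype.card_fin])
      (fun lam => om (tab lam)) om_tab_inj q
    simp only [numCycles_eq, contentProd_eq]
    rw [h, Fintype.card_fin]
    simp only [om_tab _ q hq]
end

section
/- There is a constant C > 0 such that for all n ≥ 1 and all t ≥ 0, #{(σ,τ) ∈ S_n × S_n : C([σ,τ]) ≥ t} ≤ C · n · (n!)² / 2^t. Equivalently, Pr[C([σ,τ]) ≥ t] = O(n/2^t) for σ, τ independent uniform on S_n. -/
open Finset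

/-- restricted binomial -/
def chg (a l g : ℕ) : ℕ := if g ≤ l then a.choose (l - g) else 0

theorem chg_succ (a l g : ℕ) : chg (a+1) (l+1) g = chg a (l+1) g + chg a l g := by
  unfold chg
  rcases lt_trichotomy g (l+1) with h | h | h
  · rw [if_pos (by omega), if_pos (by omega), if_pos (by omega)]
    have : l + 1 - g = (l - g) + 1 := by omega
    rw [this, Nat.choose_succ_succ]; ring
  · subst h; simp
  · rw [if_neg (by omega), if_neg (by omega), if_neg (by omega)]

theorem hockey (l K : ℕ) : ∑ i ∈ range K, i.choose l ≤ K.choose (l+1) := by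
  induction K with
  | zero => simp
  | succ K ih => rw [sum_range_succ, Nat.choose_succ_succ']; omega

theorem L1 (g : ℕ → ℕ) (hg : Antitone g) (k : ℕ) : ∀ l,
    ∑ i ∈ range (k+1), i.choose (g i) * chg (k - i) l (g i) ≤ (k+1).choose (l+1) := by
  induction k with
  | zero =>
    intro l
    simp [chg]
    rcases Nat.eq_zero_or_pos (g 0) with h | h
    · rw [h]; cases l <;> simp
    · rw [Nat.choose_eq_zero_of_lt h]; simp
  | succ k ih =>
    intro l
    by_cases hk : l ≤ g (k+1)
    · have hi : ∀ i ∈ range (k+1+1), i.choose (g i) * chg (k+1-i) l (g i) ≤ i.choose l := by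
        intro i hi
        have h1 : g (k+1) ≤ g i := hg (by simp at hi; omega)
        unfold chg
        split_ifs with h
        · have : g i = l := by omega
          simp [this]
        · simp
      refine (sum_le_sum hi).trans ?_
      exact hockey l (k+1+1)
    · push Not at hk
      obtain ⟨l, rfl⟩ : ∃ l', l = l' + 1 := ⟨l-1, by omega⟩
      rw [sum_range_succ]
      have h0 : chg (k+1-(k+1)) (l+1) (g (k+1)) = 0 := by
        unfold chg
        rw [if_pos (by omega)]
        apply Nat.choose_eq_zero_of_lt; omega
      rw [h0, mul_zero, add_zero]
      have : ∀ i ∈ range (k+1), i.choose (g i) * chg (k+1-i) (l+1) (g i)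
         = i.choose (g i) * chg (k-i) (l+1) (g i) + i.choose (g i) * chg (k-i) l (g i) := by
        intro i hi
        have : k+1-i = (k-i)+1 := by simp at hi; omega
        rw [this, chg_succ]; ring
      rw [sum_congr rfl this, sum_add_distrib, Nat.choose_succ_succ (k+1) (l+1), add_comm]
      exact add_le_add (ih l) (ih (l+1))

theorem G2 {α R : Type*} [DecidableEq α] [AddCommMonoid R] (S T : Finset α) (h : Disjoint S T)
    (f : Finset α → Finset α → R) :
    ∑ H ∈ (S ∪ T).powerset, f (H ∩ S) (H ∩ T) = ∑ W ∈ S.powerset, ∑ V ∈ T.powerset, f W V := by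
  rw [← sum_product']
  refine sum_nbij' (fun H => (H ∩ S, H ∩ T)) (fun p => p.1 ∪ p.2) ?_ ?_ ?_ ?_ ?_
  · intro H hH; simp
  · rintro ⟨W, V⟩ hp
    simp only [mem_product, mem_powerset] at hp ⊢
    exact union_subset_union hp.1 hp.2
  · intro H hH
    simp only [mem_powerset] at hH
    rw [← inter_union_distrib_left]
    exact inter_eq_left.2 hH
  · rintro ⟨W, V⟩ hp
    simp only [mem_product, mem_powerset] at hp
    have h' := Finset.disjoint_left.1 h
    ext x
    · simp only [mem_inter, mem_union]
      have := @hp.1 x; have := @hp.2 x; have := @h' x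
      tauto
    · simp only [mem_inter, mem_union]
      have := @hp.1 x; have := @hp.2 x; have := @h' x
      tauto
  · intro H hH; rfl

theorem G2n {α R : Type*} [DecidableEq α] [AddCommMonoid R] (S T : Finset α) (h : Disjoint S T)
    (f : ℕ → ℕ → R) :
    ∑ H ∈ (S ∪ T).powerset, f (#(H ∩ S)) (#(H ∩ T)) =
     ∑ x ∈ range (#S + 1), ∑ y ∈ range (#T + 1), ((#S).choose x * (#T).choose y) • f x y := by
  rw [G2 S T h (fun W V => f (#W) (#V))]
  rw [sum_congr rfl (fun W _ => sum_powerset_apply_card (fun y => f (#W) y) (x := T))]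
  rw [sum_powerset_apply_card (fun x => ∑ m ∈ range (#T + 1), (#T).choose m • f x m)]
  simp only [smul_sum, mul_smul]

theorem L2 (m k l : ℕ) :
    ∑ i ∈ range (k+1) with i ≤ m, ∑ q ∈ range (l+1),
      (i.choose q * (m-i).choose (l-q)) * (i.choose (l-q) * (k-i).choose q)
      ≤ m.choose l * (k+1).choose (l+1) := by
  have key : ∀ i ∈ (range (k+1)).filter (· ≤ m), ∑ q ∈ range (l+1),
      (i.choose q * (m-i).choose (l-q)) * (i.choose (l-q) * (k-i).choose q)
      = ∑ V ∈ (range m).powerset with #V = l,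
          i.choose (l - #(V ∩ range i)) * (k-i).choose (#(V ∩ range i)) := by
    intro i hi
    have him : i ≤ m := (mem_filter.1 hi).2
    have hd : Disjoint (range i) (Ico i m) := by
      rw [Finset.disjoint_left]; intro x; simp; omega
    have hu : range m = range i ∪ Ico i m := by
      ext x; simp; omega
    rw [sum_filter, hu]
    have := G2n (range i) (Ico i m) hd (fun x y => if x + y = l then i.choose (l-x) * (k-i).choose x else 0)
    rw [card_range, Nat.card_Ico] at this
    simp only [smul_eq_mul] at this
    have e : ∀ V ∈ (range i ∪ Ico i m).powerset, (if #V = l then i.choose (l - #(V ∩ range i)) * (k-i).choose (#(V ∩ range i)) else 0)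
       = if #(V ∩ range i) + #(V ∩ Ico i m) = l then i.choose (l-#(V ∩ range i)) * (k-i).choose (#(V ∩ range i)) else 0 := by
      intro V hV
      rw [← card_union_of_disjoint, ← inter_union_distrib_left, inter_eq_left.2 (mem_powerset.1 hV)]
      exact hd.mono inter_subset_right inter_subset_right
    rw [sum_congr rfl e, this]
    have e1 : ∀ x ∈ range (i+1), ∑ y ∈ range (m - i + 1), i.choose x * (m-i).choose y * (if x + y = l then i.choose (l-x) * (k-i).choose x else 0)
       = if x ∈ range (l+1) then (i.choose x * (m-i).choose (l-x)) * (i.choose (l-x) * (k-i).choose x) else 0 := by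
      intro x hx
      split_ifs with hxl
      · simp only [mem_range] at hxl
        by_cases hy : l - x ∈ range (m-i+1)
        · rw [sum_eq_single_of_mem _ hy]
          · rw [if_pos (by omega)]
          · intro b _ hb; rw [if_neg (by omega), mul_zero]
        · rw [Nat.choose_eq_zero_of_lt (n := m-i) (k := l-x) (by simp at hy; omega)]
          simp only [mul_zero, zero_mul]
          apply sum_eq_zero
          intro y hy'
          rw [if_neg, mul_zero]
          rintro rfl
          apply hy; simpa using hy'
      · apply sum_eq_zero; intro y _; rw [if_neg, mul_zero]; simp at hxl; omega
    rw [sum_congr rfl e1, ← sum_filter]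
    symm
    apply sum_subset_zero_on_sdiff
    · intro x; simp
    · intro x hx
      rw [Nat.choose_eq_zero_of_lt (n := i) (k := x)]
      · simp
      · simp at hx; omega
    · intros; rfl
  rw [sum_congr rfl key, sum_comm]
  have hc : #((range m).powerset.filter (fun V => #V = l)) = m.choose l := by
    rw [← powersetCard_eq_filter, card_powersetCard, card_range]
  rw [← hc, ← smul_eq_mul]
  apply sum_le_card_nsmul
  intro V hV
  have hV' := (mem_filter.1 hV).2
  have := L1 (fun i => l - #(V ∩ range i)) (by
    intro i j hij
    have : #(V ∩ range i) ≤ #(V ∩ range j) :=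
      card_le_card (inter_subset_inter_left (range_mono hij))
    simp only; omega) k l
  refine le_trans ?_ this
  refine (sum_le_sum_of_subset (filter_subset _ _)).trans ?_
  apply le_of_eq
  apply sum_congr rfl
  intro i _
  have : #(V ∩ range i) ≤ l := hV' ▸ card_le_card inter_subset_left
  simp only [chg]
  rw [if_pos (by omega)]
  congr 2; omega

theorem chooseId (a b c d : ℕ) : (a+b).choose a * (c+d).choose c * ((a+c).factorial * (b+d).factorial)
   = (a+b).factorial * (c+d).factorial * ((a+c).choose a * (b+d).choose b) := by
  have h1 := Nat.add_choose_mul_factorial_mul_factorial a b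
  have h2 := Nat.add_choose_mul_factorial_mul_factorial c d
  have h3 := Nat.add_choose_mul_factorial_mul_factorial a c
  have h4 := Nat.add_choose_mul_factorial_mul_factorial b d
  rw [← h1, ← h2, ← h3, ← h4, ← Nat.choose_symm_add (a := a) (b := b), ← Nat.choose_symm_add (a := a) (b := c),
    ← Nat.choose_symm_add (a := c) (b := d), ← Nat.choose_symm_add (a := b) (b := d)]
  ring


open scoped Pointwise Nat

theorem L3 {α : Type*} [Fintype α] [DecidableEq α] (A E H : Finset α) :
    #{a : Equiv.Perm α | a • A = H ∧ a • H = E} ≤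
      if #H = #A ∧ #(H ∩ A) = #(H ∩ E) then
        (#(H ∩ A))! * (#(A \ H))! * (#(H \ A))! * (#(Aᶜ \ H))! else 0 := by
  rcases Finset.eq_empty_or_nonempty ({a : Equiv.Perm α | a • A = H ∧ a • H = E} : Finset _) with h | ⟨a0, h⟩
  · rw [h]; simp
  obtain ⟨h1, h2⟩ := (mem_filter.1 h).2
  rw [if_pos]
  swap
  · constructor
    · rw [← h1, card_smul_finset]
    · rw [← card_smul_finset a0, smul_finset_inter, h1, h2, inter_comm]
  let f : α → Bool × Bool := fun x => (decide (x ∈ A), decide (x ∈ H))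
  have hc := DomMulAct.stabilizer_card f
  have hp : ∏ i, (Fintype.card { a // f a = i })! =
      (#(H ∩ A))! * (#(A \ H))! * (#(H \ A))! * (#(Aᶜ \ H))! := by
    rw [Fintype.prod_prod_type]
    simp only [Fintype.prod_bool]
    rw [Fintype.card_of_subtype (H ∩ A), Fintype.card_of_subtype (A \ H),
      Fintype.card_of_subtype (H \ A), Fintype.card_of_subtype (Aᶜ \ H)]
    · ring
    all_goals intro x; simp [f, and_comm]
  rw [← hp, ← hc, Fintype.card_subtype]
  apply card_le_card_of_injOn (fun a => a0⁻¹ * a)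
  · intro a ha
    obtain ⟨g1, g2⟩ := (mem_filter.1 ha).2
    simp only [coe_filter, mem_univ, true_and, Set.mem_ofPred_eq]
    have hA : (a0⁻¹ * a) • A = A := by rw [mul_smul, g1, ← h1, inv_smul_smul]
    have hH : (a0⁻¹ * a) • H = H := by rw [mul_smul, g2, ← h2, inv_smul_smul]
    have key : ∀ (g : Equiv.Perm α) (B : Finset α), g • B = B → ∀ x, g x ∈ B ↔ x ∈ B := by
      intro g B hB x
      conv_lhs => rw [← hB]
      exact smul_mem_smul_finset_iff g
    funext x
    simp only [f, Function.comp]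
    simp only [key _ A hA, key _ H hH]
  · intro a _ b _ hab
    exact mul_left_cancel hab

theorem L4a (k m l : ℕ) (hk : l ≤ k) (hm : l ≤ m) :
    ∑ p ∈ range (k-l+1), ∑ q ∈ range (l+1), ∑ r ∈ range (l+1), ∑ s ∈ range (m-l+1),
      ((k-l).choose p * l.choose q) * ((l.choose r * (m-l).choose s) *
        (if p + q + (r + s) = k ∧ q = r then (p+q)! * (k-(p+q))! * (r+s)! * (m-(r+s))! else 0))
    ≤ (l ! * (k-l)! * (l ! * (m-l)!)) * (m.choose l * (k+1).choose (l+1)) := by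
  set Φ : ℕ × ℕ → ℕ := fun y => (y.1.choose y.2 * (m-y.1).choose (l-y.2)) * (y.1.choose (l-y.2) * (k-y.1).choose y.2) with hΦ
  refine le_trans ?_ (Nat.mul_le_mul_left _ (L2 m k l))
  rw [← sum_product' (f := fun i q => Φ (i,q))]
  rw [← sum_product', ← sum_product', ← sum_product']
  set P := ((((range (k - l + 1) ×ˢ range (l + 1)) ×ˢ range (l + 1)) ×ˢ range (m - l + 1)).filter
    (fun x => x.1.1.1 + x.1.1.2 + (x.1.2 + x.2) = k ∧ x.1.1.2 = x.1.2)) with hP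
  have e : ∑ x ∈ P, (l ! * (k-l)! * (l ! * (m-l)!)) * Φ (x.1.1.2 + x.2, x.1.1.2) ≤
      (l ! * (k-l)! * (l ! * (m-l)!)) * ∑ x ∈ (range (k + 1)).filter (· ≤ m) ×ˢ range (l + 1), Φ (x.1, x.2) := by
    rw [← mul_sum]
    apply Nat.mul_le_mul_left
    have := sum_image (s := P) (f := Φ) (g := fun x => (x.1.1.2 + x.2, x.1.1.2)) (by
      rintro ⟨⟨⟨p,q⟩,r⟩,s⟩ h ⟨⟨⟨p',q'⟩,r'⟩,s'⟩ h' hh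
      simp [hP] at h h' hh ⊢
      omega)
    rw [← this]
    apply sum_le_sum_of_subset
    intro y hy
    obtain ⟨⟨⟨⟨p,q⟩,r⟩,s⟩, hx, rfl⟩ := mem_image.1 hy
    simp [hP] at hx ⊢
    omega
  refine le_trans (le_of_eq ?_) e
  rw [hP, sum_filter]
  apply sum_congr rfl
  rintro ⟨⟨⟨p,q⟩,r⟩,s⟩ hx
  simp only [mem_product, mem_range] at hx
  simp only
  split_ifs with hc
  swap
  · simp
  obtain ⟨hc, rfl⟩ := hc
  have i1 := chooseId q (l-q) p (k-l-p)
  have i2 := chooseId q (l-q) s (m-l-s)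
  rw [show q + (l-q) = l by omega, show p + (k-l-p) = k-l by omega, show l - q + (k-l-p) = q + s by omega] at i1
  rw [show q + (l-q) = l by omega, show s + (m-l-s) = m-l by omega, show l - q + (m-l-s) = m - (q + s) by omega] at i2
  rw [show k - (p+q) = q + s by omega]
  simp only [hΦ]
  rw [show k - (q+s) = q + p by omega, add_comm p q]
  calc _ = (l.choose q * (k-l).choose p * ((q+p)! * (q+s)!)) * (l.choose q * (m-l).choose s * ((q+s)! * (m-(q+s))!)) := by ring
    _ = _ := by rw [i1, i2]; ring

theorem L4 {α : Type*} [Fintype α] [DecidableEq α] (A E : Finset α) (hAE : #A = #E) :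
    #{a : Equiv.Perm α | a • a • A = E} * (#(A \ E) + 1) ≤ (#A + 1)! * (#Aᶜ)! := by
  set k := #A with hk
  set m := #Aᶜ with hm
  set l := #(A \ E) with hl
  have hlk : l ≤ k := card_le_card sdiff_subset
  have hl' : #(E \ A) = l := by
    have h1 := card_sdiff_add_card_inter A E
    have h2 := card_sdiff_add_card_inter E A
    rw [inter_comm] at h2
    omega
  have hlm : l ≤ m := by
    rw [← hl']; apply card_le_card; intro x; simp
  have hAi : #(A ∩ E) = k - l := by
    have h1 := card_sdiff_add_card_inter A E
    omega
  have hR : #(Aᶜ \ E) = m - l := by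
    have h1 := card_sdiff_add_card_inter Aᶜ E
    have : Aᶜ ∩ E = E \ A := by ext; simp [and_comm]
    rw [this] at h1
    omega
  let F : ℕ → ℕ → ℕ → ℕ → ℕ := fun p q r s =>
    if p + q + (r + s) = k ∧ q = r then (p+q)! * (k-(p+q))! * (r+s)! * (m-(r+s))! else 0
  have s1 : #{a : Equiv.Perm α | a • a • A = E} ≤ ∑ H : Finset α,
      F (#((H ∩ A) ∩ (A ∩ E))) (#((H ∩ A) ∩ (A \ E))) (#((H ∩ Aᶜ) ∩ (E \ A))) (#((H ∩ Aᶜ) ∩ (Aᶜ \ E))) := by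
    have : #{a : Equiv.Perm α | a • a • A = E} = ∑ H : Finset α, #{a : Equiv.Perm α | a • A = H ∧ a • H = E} := by
      rw [card_eq_sum_card_fiberwise (f := fun a => a • A) (t := univ) (by intro x _; simp)]
      apply sum_congr rfl
      intro H _
      congr 1
      ext a
      simp only [mem_filter, mem_univ, true_and]
      constructor
      · rintro ⟨h, rfl⟩; exact ⟨rfl, h⟩
      · rintro ⟨rfl, h⟩; exact ⟨h, rfl⟩
    rw [this]
    apply sum_le_sum
    intro H _
    refine (L3 A E H).trans (le_of_eq ?_)
    have c1 : #((H ∩ A) ∩ (A ∩ E)) + #((H ∩ A) ∩ (A \ E)) = #(H ∩ A) := by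
      rw [← card_union_of_disjoint]
      · congr 1; ext x; simp; tauto
      · rw [Finset.disjoint_left]; intro x; simp; tauto
    have c2 : #((H ∩ Aᶜ) ∩ (E \ A)) + #((H ∩ Aᶜ) ∩ (Aᶜ \ E)) = #(H \ A) := by
      rw [← card_union_of_disjoint]
      · congr 1; ext x; simp; tauto
      · rw [Finset.disjoint_left]; intro x; simp; tauto
    have c3 : #((H ∩ A) ∩ (A ∩ E)) + #((H ∩ Aᶜ) ∩ (E \ A)) = #(H ∩ E) := by
      rw [← card_union_of_disjoint]
      · congr 1; ext x; simp; tauto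
      · rw [Finset.disjoint_left]; intro x; simp; tauto
    have c4 : #(A \ H) = k - #(H ∩ A) := by
      have := card_sdiff_add_card_inter A H
      rw [inter_comm] at this; omega
    have c5 : #(Aᶜ \ H) = m - #(H \ A) := by
      have := card_sdiff_add_card_inter Aᶜ H
      have e : Aᶜ ∩ H = H \ A := by ext; simp [and_comm]
      rw [e] at this; omega
    have c6 := card_sdiff_add_card_inter H A
    simp only [F]
    rw [c1, c2, c4, c5]
    congr 1
    apply propext
    constructor <;> rintro ⟨h1, h2⟩ <;> constructor <;> omega
  have s2 : ∑ H : Finset α,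
      F (#((H ∩ A) ∩ (A ∩ E))) (#((H ∩ A) ∩ (A \ E))) (#((H ∩ Aᶜ) ∩ (E \ A))) (#((H ∩ Aᶜ) ∩ (Aᶜ \ E)))
      = ∑ p ∈ range (k-l+1), ∑ q ∈ range (l+1), ∑ r ∈ range (l+1), ∑ s ∈ range (m-l+1),
      ((k-l).choose p * l.choose q) * ((l.choose r * (m-l).choose s) * F p q r s) := by
    have g := G2 A Aᶜ disjoint_compl_right (fun W V => F (#(W ∩ (A ∩ E))) (#(W ∩ (A \ E))) (#(V ∩ (E \ A))) (#(V ∩ (Aᶜ \ E))))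
    rw [union_compl, powerset_univ] at g
    rw [g]
    have dA : Disjoint (A ∩ E) (A \ E) := by
      rw [Finset.disjoint_left]; intro x; simp; tauto
    have dB : Disjoint (E \ A) (Aᶜ \ E) := by
      rw [Finset.disjoint_left]; intro x; simp; tauto
    have uA : (A ∩ E) ∪ (A \ E) = A := by ext; simp; tauto
    have uB : (E \ A) ∪ (Aᶜ \ E) = Aᶜ := by ext; simp; tauto
    have gB := fun p q => G2n (E \ A) (Aᶜ \ E) dB (fun r s => F p q r s)
    rw [uB, hl', hR] at gB
    rw [sum_congr rfl (fun W _ => gB _ _)]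
    have gA := G2n (A ∩ E) (A \ E) dA (fun p q => ∑ x ∈ range (l + 1), ∑ y ∈ range (m - l + 1),
      (l.choose x * (m - l).choose y) • F p q x y)
    rw [uA, hAi, ← hl] at gA
    rw [gA]
    simp only [smul_eq_mul, mul_sum]
  have s3 := (s1.trans (le_of_eq s2)).trans (L4a k m l hlk hlm)
  have f1 := Nat.choose_mul_factorial_mul_factorial hlm
  have f2 := Nat.choose_mul_factorial_mul_factorial (n := k+1) (k := l+1) (by omega)
  rw [show k + 1 - (l+1) = k - l by omega, Nat.factorial_succ l] at f2
  refine (Nat.mul_le_mul_right _ s3).trans (le_of_eq ?_)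
  rw [← f1, ← f2]
  ring

theorem L5 {α : Type*} [Fintype α] [DecidableEq α] (A E : Finset α) (hAE : #A = #E) :
    #{a : Equiv.Perm α | a • a • A = E} * (#(A \ E) + 1) ≤ (min (#A) (#Aᶜ) + 1) * ((#A)! * (#Aᶜ)!) := by
  have h1 := L4 A E hAE
  have h2 := L4 Aᶜ Eᶜ (by rw [card_compl, card_compl, hAE])
  have hc : ∀ (a : Equiv.Perm α) (B : Finset α), a • Bᶜ = (a • B)ᶜ := by
    intro a B
    rw [compl_eq_univ_sdiff, smul_finset_sdiff, smul_finset_univ, compl_eq_univ_sdiff]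
  have hl : #(Aᶜ \ Eᶜ) = #(A \ E) := by
    have e : Aᶜ \ Eᶜ = E \ A := by ext; simp [and_comm]
    rw [e]
    have h1 := card_sdiff_add_card_inter A E
    have h2 := card_sdiff_add_card_inter E A
    rw [inter_comm] at h2
    omega
  simp only [hc, compl_inj_iff, compl_compl] at h2
  rw [hl] at h2
  rcases le_total (#A) (#Aᶜ) with h | h
  · rw [min_eq_left h]; rw [Nat.factorial_succ] at h1; linarith
  · rw [min_eq_right h]; rw [Nat.factorial_succ] at h2; linarith

theorem L6 {α : Type*} [Fintype α] [DecidableEq α] (A : Finset α) :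
    ∑ E : Finset α, (if #A = #E then (1 : ℝ) / ((#(A \ E) : ℝ) + 1)^2 else 0) ≤
      ((#A + #Aᶜ + 2).choose (#A + 1) : ℝ) / ((#A + 1) * (#Aᶜ + 1)) := by
  set k := #A with hk
  set m := #Aᶜ with hm
  have g := G2n A Aᶜ disjoint_compl_right (fun x y => if k = x + y then (1:ℝ) / ((y:ℝ) + 1)^2 else 0)
  rw [union_compl, powerset_univ, ← hk, ← hm] at g
  have e : ∀ E ∈ (univ : Finset (Finset α)), (if k = #E then (1 : ℝ) / ((#(A \ E) : ℝ) + 1)^2 else 0)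
     = if k = #(E ∩ A) + #(E ∩ Aᶜ) then (1:ℝ) / ((#(E ∩ Aᶜ):ℝ) + 1)^2 else 0 := by
    intro E _
    have h1 := card_sdiff_add_card_inter A E
    have h2 := card_sdiff_add_card_inter E A
    have h3 : E ∩ Aᶜ = E \ A := by ext; simp
    rw [inter_comm] at h1
    rw [h3]
    by_cases h : k = #E
    · rw [if_pos h, if_pos (by omega), show #(A \ E) = #(E \ A) by omega]
    · rw [if_neg h, if_neg (by omega)]
  rw [sum_congr rfl e, g]
  have hv : ((k + m + 2).choose (k+1) : ℝ) = ∑ x ∈ range (k+1+1), ((k+1).choose x : ℝ) * ((m+1).choose (k+1-x) : ℝ) := by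
    rw [show k + m + 2 = (k+1) + (m+1) by ring, Nat.add_choose_eq,
      Finset.Nat.sum_antidiagonal_eq_sum_range_succ (fun i j => (k+1).choose i * (m+1).choose j)]
    push_cast; rfl
  rw [hv, le_div_iff₀ (by positivity), sum_range_succ _ (k+1), sum_mul]
  refine le_trans (sum_le_sum ?_) (le_add_of_nonneg_right (by positivity))
  intro x hx
  have hx : x ≤ k := by simp at hx; omega
  have hs : ∑ y ∈ range (m + 1), (k.choose x * m.choose y) • (if k = x + y then (1:ℝ) / ((y:ℝ) + 1)^2 else 0)
      ≤ (k.choose x * m.choose (k - x) : ℝ) * (1 / (((k-x : ℕ) : ℝ) + 1)^2) := by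
    by_cases hy : k - x ∈ range (m+1)
    · rw [sum_eq_single_of_mem _ hy]
      · rw [if_pos (by omega)]; simp
      · intro b _ hb; rw [if_neg (by omega), smul_zero]
    · rw [sum_eq_zero]
      · positivity
      · intro y hy'
        rw [if_neg, smul_zero]
        intro hxy
        apply hy; simp at hy' ⊢; omega
  refine (mul_le_mul_of_nonneg_right hs (by positivity)).trans (le_of_eq ?_)
  have c1 := Nat.choose_mul_succ_eq k x
  have c2 := Nat.add_one_mul_choose_eq m (k-x)
  rw [show k + 1 - x = (k - x) + 1 by omega] at *
  have c1' : (k.choose x : ℝ) * (k+1) = (k+1).choose x * ((k-x : ℕ) + 1) := by exact_mod_cast c1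
  have c2' : ((m:ℝ)+1) * m.choose (k-x) = (m+1).choose (k-x+1) * ((k-x : ℕ) + 1) := by exact_mod_cast c2
  have hpos : (((k-x : ℕ):ℝ) + 1) ≠ 0 := by positivity
  calc _ = ((k.choose x : ℝ) * (k+1)) * (((m:ℝ)+1) * m.choose (k-x)) / (((k-x : ℕ) : ℝ) + 1)^2 := by ring
    _ = _ := by rw [c1', c2']; field_simp

/-- number of square roots moving `A` to `E` -/
def NN {α : Type*} [Fintype α] [DecidableEq α] (A E : Finset α) : ℕ :=
  #{a : Equiv.Perm α | a • a • A = E}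

theorem L7 {α : Type*} [Fintype α] [DecidableEq α] (A : Finset α) :
    ∑ E : Finset α, ((NN A E : ℝ) * NN E A) ≤ 4 * (Fintype.card α)! * ((#A)! * (#Aᶜ)!) := by
  set k := #A with hk
  set m := #Aᶜ with hm
  have hn : k + m = Fintype.card α := card_add_card_compl A
  set b : ℝ := ((min k m : ℕ) + 1) * (k ! * m !) with hb
  have h1 : ∀ E ∈ (univ : Finset (Finset α)), ((NN A E : ℝ) * NN E A) ≤
      b^2 * (if k = #E then (1 : ℝ) / ((#(A \ E) : ℝ) + 1)^2 else 0) := by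
    intro E _
    split_ifs with h
    · have a1 := L5 A E h
      have a2 := L5 E A h.symm
      have hl : #(E \ A) = #(A \ E) := by
        have h1 := card_sdiff_add_card_inter A E
        have h2 := card_sdiff_add_card_inter E A
        rw [inter_comm] at h2
        omega
      rw [hl, show #Eᶜ = m by rw [hm, card_compl, card_compl]; omega, ← h] at a2
      rw [← hk, ← hm] at a1
      have a1' : (NN A E : ℝ) * (#(A \ E) + 1) ≤ b := by rw [hb]; exact_mod_cast a1
      have a2' : (NN E A : ℝ) * (#(A \ E) + 1) ≤ b := by rw [hb]; exact_mod_cast a2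
      rw [mul_one_div, le_div_iff₀ (by positivity)]
      calc _ = ((NN A E : ℝ) * (#(A \ E) + 1)) * ((NN E A : ℝ) * (#(A \ E) + 1)) := by ring
        _ ≤ b * b := by gcongr
        _ = _ := by ring
    · have : NN A E = 0 := by
        unfold NN
        rw [card_eq_zero, filter_eq_empty_iff]
        intro a _ ha
        apply h
        rw [← ha, card_smul_finset, card_smul_finset]
      simp [this]
  refine (sum_le_sum h1).trans ?_
  rw [← mul_sum]
  have h6 := L6 A
  rw [← hk, ← hm] at h6
  refine (mul_le_mul_of_nonneg_left h6 (by positivity)).trans ?_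
  have f := Nat.add_choose_mul_factorial_mul_factorial (k+1) (m+1)
  rw [← Nat.choose_symm_add, show k + 1 + (m+1) = k + m + 2 by ring] at f
  rw [← hn]
  have f' : ((k+m+2).choose (k+1) : ℝ) * ((k+1) * k !) * ((m+1) * m !) = (k+m+2) * ((k+m+1) * (k+m)!) := by
    rw [show (k+m+2)! = (k+m+2) * ((k+m+1) * (k+m)!) by
      rw [show k+m+2 = (k+m+1)+1 by ring, Nat.factorial_succ, Nat.factorial_succ], Nat.factorial_succ, Nat.factorial_succ] at f
    exact_mod_cast f
  have hmin : (((min k m : ℕ) : ℝ) + 1) * (k + m + 2) ≤ 2 * ((k+1) * (m+1)) := by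
    have : ((min k m) + 1) * (k + m + 2) ≤ 2 * ((k+1) * (m+1)) := by
      rcases le_total k m with h | h
      · rw [min_eq_left h]; nlinarith
      · rw [min_eq_right h]; nlinarith
    exact_mod_cast this
  set M : ℝ := ((min k m : ℕ) : ℝ) + 1 with hM
  have hM0 : 0 < M := by positivity
  set c : ℝ := ((k+m+2).choose (k+1) : ℝ)
  set x : ℝ := (k:ℝ) + 1 with hx
  set y : ℝ := (m:ℝ) + 1 with hy
  have hx0 : 0 < x := by positivity
  have hy0 : 0 < y := by positivity
  set z : ℝ := (k:ℝ) + m + 2 with hz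
  have hz0 : 0 < z := by positivity
  have hsq : (M * z)^2 ≤ (2 * (x*y))^2 := by gcongr
  set u : ℝ := (k ! : ℝ)
  set v : ℝ := (m ! : ℝ)
  have hu : 0 < u := by positivity
  have hv : 0 < v := by positivity
  set w : ℝ := ((k+m)! : ℝ)
  have hw : 0 < w := by positivity
  rw [← mul_div_assoc, div_le_iff₀ (by positivity)]
  have hq : (k:ℝ) + m + 1 ≤ z := by linarith
  have f2 : c * (x*u) * (y*v) ≤ z^2 * w := by
    rw [f']
    calc z * ((k+m+1) * w) ≤ z * (z * w) := by gcongr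
      _ = _ := by ring
  have : (b^2 * c) * (x*y) ≤ (4 * w * (u*v) * (x*y)) * (x * y) := by
    calc (b^2 * c) * (x*y) = M^2 * (u*v) * (c * (x*u) * (y*v)) := by rw [hb]; ring
      _ ≤ M^2 * (u*v) * (z^2 * w) := by gcongr
      _ = (M*z)^2 * (u*v*w) := by ring
      _ ≤ (2 * (x*y))^2 * (u*v*w) := by gcongr
      _ = _ := by ring
  exact le_of_mul_le_mul_right this (by positivity)

theorem L8 {α : Type*} [Fintype α] [DecidableEq α] :
    ∑ A : Finset α, ∑ E : Finset α, ((NN A E : ℝ) * NN E A) ≤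
      4 * (Fintype.card α + 1) * ((Fintype.card α)! : ℝ)^2 := by
  refine (sum_le_sum (fun A _ => L7 A)).trans (le_of_eq ?_)
  rw [← mul_sum]
  have := sum_powerset_apply_card (fun k => (k ! * (Fintype.card α - k)! : ℝ)) (x := (univ : Finset α))
  rw [powerset_univ] at this
  simp_rw [card_compl]
  rw [this, card_univ]
  have : ∀ k ∈ range (Fintype.card α + 1), (Fintype.card α).choose k • (k ! * (Fintype.card α - k)! : ℝ) = ((Fintype.card α)! : ℝ) := by
    intro k hk
    have := Nat.choose_mul_factorial_mul_factorial (n := Fintype.card α) (k := k) (by simp at hk; omega)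
    rw [nsmul_eq_mul, ← mul_assoc]; exact_mod_cast this
  rw [sum_congr rfl this, sum_const, card_range, nsmul_eq_mul]
  push_cast; ring

/-- number of invariant sets -/
def FF {α : Type*} [Fintype α] [DecidableEq α] (g : Equiv.Perm α) : ℕ :=
  #{A : Finset α | g • A = A}

theorem L9 {α : Type*} [Fintype α] [DecidableEq α] :
    ∑ σ : Equiv.Perm α, ∑ τ : Equiv.Perm α, FF (σ * τ * σ⁻¹ * τ⁻¹) =
    ∑ A : Finset α, ∑ E : Finset α, NN A E * NN E A := by
  have h1 : ∀ τ : Equiv.Perm α, ∑ σ : Equiv.Perm α, FF (σ * τ * σ⁻¹ * τ⁻¹) =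
      ∑ σ : Equiv.Perm α, FF (σ * τ⁻¹ * σ⁻¹ * τ⁻¹) := by
    intro τ
    obtain ⟨c, hc⟩ := isConj_iff.1 (Equiv.Perm.isConj_iff_cycleType_eq.2 (Equiv.Perm.cycleType_inv τ).symm)
    rw [← Equiv.sum_comp (Equiv.mulRight c)]
    apply sum_congr rfl
    intro σ _
    rw [← hc]
    simp only [Equiv.coe_mulRight]
    simp only [mul_inv_rev, inv_inv, mul_assoc, inv_mul_cancel_left, mul_inv_cancel_left]
  rw [sum_comm, sum_congr rfl (fun τ _ => h1 τ), sum_comm]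
  have h2 : ∀ σ : Equiv.Perm α, ∑ τ : Equiv.Perm α, FF (σ * τ⁻¹ * σ⁻¹ * τ⁻¹) =
      ∑ a : Equiv.Perm α, FF (a * σ⁻¹ * σ⁻¹ * a) := by
    intro σ
    rw [← Equiv.sum_comp ((Equiv.inv (Equiv.Perm α)).trans (Equiv.mulRight σ))]
    apply sum_congr rfl
    intro a _
    simp only [Equiv.trans_apply, Equiv.coe_mulRight, Equiv.inv_apply]
    simp only [mul_inv_rev, inv_inv, mul_assoc, inv_mul_cancel_left, mul_inv_cancel_left]
  rw [sum_congr rfl (fun τ _ => h2 τ), ← Equiv.sum_comp (Equiv.inv (Equiv.Perm α))]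
  simp only [Equiv.inv_apply, inv_inv]
  have h3 : ∀ a b : Equiv.Perm α, FF (a * b * b * a) =
      ∑ A : Finset α, ∑ E : Finset α, (if b • b • A = E then 1 else 0) * (if a • a • E = A then 1 else 0) := by
    intro a b
    unfold FF
    rw [card_filter, ← Equiv.sum_comp (MulAction.toPerm a⁻¹ : Equiv.Perm (Finset α))]
    apply sum_congr rfl
    intro A _
    rw [sum_eq_single_of_mem (b • b • A) (mem_univ _)]
    · simp only [MulAction.toPerm_apply, mul_smul, smul_inv_smul, if_true, one_mul]
      congr 1
      rw [eq_inv_smul_iff]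
    · intro E _ hE
      rw [if_neg (Ne.symm hE), zero_mul]
  simp_rw [h3, NN, card_filter, sum_mul_sum]
  rw [sum_congr rfl (fun b _ => sum_comm)]
  rw [sum_comm]
  apply sum_congr rfl
  intro A _
  rw [sum_congr rfl (fun b _ => sum_comm)]
  rw [sum_comm]

theorem L10 {n : ℕ} (π : Equiv.Perm (Fin n)) : 2 ^ numCycles π ≤ FF π := by
  unfold numCycles FF
  have hcard : Multiset.card π.cycleType = #π.cycleFactorsFinset := by
    rw [Equiv.Perm.cycleType_def, Multiset.card_map]; rfl
  rw [hcard, pow_add, ← card_powerset, ← card_powerset, ← card_product]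
  apply card_le_card_of_injOn (fun p => univ.filter (fun x => (π x = x ∧ x ∈ p.2) ∨ (π x ≠ x ∧ π.cycleOf x ∈ p.1)))
  · rintro ⟨P, Q⟩ _
    simp only [coe_filter, mem_univ, true_and, Set.mem_ofPred_eq]
    apply eq_of_subset_of_card_le
    · intro y hy
      obtain ⟨x, hx, rfl⟩ := mem_smul_finset.1 hy
      simp only [mem_filter, mem_univ, true_and, Equiv.Perm.smul_def] at hx ⊢
      rcases hx with ⟨h, hx⟩ | ⟨h, hx⟩
      · left; rw [h]; exact ⟨h, hx⟩
      · right; rw [Equiv.Perm.cycleOf_self_apply]; exact ⟨fun h' => h (π.injective h'), hx⟩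
    · rw [card_smul_finset]
  · rintro ⟨P, Q⟩ h ⟨P', Q'⟩ h' hh
    simp only [coe_product, coe_powerset, Set.mem_prod, Set.mem_preimage, Set.mem_powerset_iff, coe_subset] at h h'
    simp only at hh
    have key := fun x => congrArg (fun S => x ∈ S) hh
    simp only [mem_filter, mem_univ, true_and, eq_iff_iff] at key
    have hP : ∀ c ∈ π.cycleFactorsFinset, (c ∈ P ↔ c ∈ P') := by
      intro c hc
      obtain ⟨x, hx⟩ := (Equiv.Perm.mem_cycleFactorsFinset_iff.1 hc).1.nonempty_support
      have e := Equiv.Perm.cycle_is_cycleOf hx hc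
      have hx' : π x ≠ x := Equiv.Perm.mem_support.1 (Equiv.Perm.mem_cycleFactorsFinset_support_le hc hx)
      have := key x
      rw [← e] at this
      tauto
    have hQ : ∀ x, π x = x → (x ∈ Q ↔ x ∈ Q') := by
      intro x hx
      have := key x
      tauto
    ext c
    · exact ⟨fun hc => (hP c (h.1 hc)).1 hc, fun hc => (hP c (h'.1 hc)).2 hc⟩
    · refine ⟨fun hc => (hQ c ?_).1 hc, fun hc => (hQ c ?_).2 hc⟩
      · simpa using h.2 hc
      · simpa using h'.2 hc

/-- Large deviations for the number of cycles of a random commutator: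
`Pr[C([σ,τ]) ≥ t] = O(n/2^t)`. -/
theorem commutator_cycle_large_deviation :
    ∃ C > (0 : ℝ), ∀ n ≥ 1, ∀ t : ℕ,
      (Nat.card {p : Equiv.Perm (Fin n) × Equiv.Perm (Fin n) //
          t ≤ numCycles (p.1 * p.2 * p.1⁻¹ * p.2⁻¹)} : ℝ)
        ≤ C * n * (n.factorial : ℝ) ^ 2 / 2 ^ t := by
  refine ⟨8, by norm_num, ?_⟩
  intro n hn t
  rw [le_div_iff₀ (by positivity), Nat.card_eq_fintype_card, Fintype.card_subtype]
  have h1 : #{p : Equiv.Perm (Fin n) × Equiv.Perm (Fin n) | t ≤ numCycles (p.1 * p.2 * p.1⁻¹ * p.2⁻¹)} * 2 ^ t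
      ≤ ∑ σ : Equiv.Perm (Fin n), ∑ τ : Equiv.Perm (Fin n), FF (σ * τ * σ⁻¹ * τ⁻¹) := by
    rw [← Fintype.sum_prod_type' (f := fun σ τ => FF (σ * τ * σ⁻¹ * τ⁻¹)), ← smul_eq_mul]
    have hs := sum_le_sum_of_subset (f := fun p : Equiv.Perm (Fin n) × Equiv.Perm (Fin n) => FF (p.1 * p.2 * p.1⁻¹ * p.2⁻¹))
      (filter_subset (fun p : Equiv.Perm (Fin n) × Equiv.Perm (Fin n) =>
        t ≤ numCycles (p.1 * p.2 * p.1⁻¹ * p.2⁻¹)) univ)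
    refine le_trans ?_ hs
    apply card_nsmul_le_sum
    intro p hp
    exact (Nat.pow_le_pow_right (by norm_num) (mem_filter.1 hp).2).trans (L10 _)
  replace h1 := h1.trans (le_of_eq (L9 (α := Fin n)))
  have h2 := L8 (α := Fin n)
  rw [Fintype.card_fin] at h2
  have h3 : ((#{p : Equiv.Perm (Fin n) × Equiv.Perm (Fin n) | t ≤ numCycles (p.1 * p.2 * p.1⁻¹ * p.2⁻¹)} : ℕ) : ℝ) * 2 ^ t
     ≤ ∑ A : Finset (Fin n), ∑ E : Finset (Fin n), ((NN A E : ℝ) * NN E A) := by exact_mod_cast h1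
  refine (h3.trans h2).trans ?_
  have : (1:ℝ) ≤ n := by exact_mod_cast hn
  exact mul_le_mul_of_nonneg_right (by linarith) (by positivity)
end
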